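/- arXiv:1609.00987 — 5 statements merged into one kernel-verified Lean document; each statement's English description precedes it below -/
import Mathlib

section
/- For every real x > 0 and every real c > 0, the function u ↦ Γ(c + iu) · x^{−(c + iu)} is Lebesgue integrable on ℝ and (1/(2π)) ∫_ℝ Γ(c + iu) x^{−(c + iu)} du = e^{−x} (the Cahen–Mellin integral: the inverse Mellin transform of Γ along the vertical line Re(s) = c is the decaying exponential). -/
open MeasureTheory

theorem norm_Gamma_le_aux (s : ℂ) (hs : 0 < s.re) :
    ‖Complex.Gamma s‖ ≤ Real.Gamma s.re := by
  rw [Complex.Gamma_eq_integral hs, Real.Gamma_eq_integral hs, Complex.GammaIntegral]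
  refine (norm_integral_le_integral_norm _).trans (le_of_eq ?_)
  refine setIntegral_congr_fun measurableSet_Ioi fun t ht => ?_
  have ht' : 0 < t := ht
  simp only [norm_mul]
  rw [Complex.norm_cpow_eq_rpow_re_of_pos ht', Complex.norm_real, Real.norm_eq_abs,
    abs_of_pos (Real.exp_pos _)]
  simp

theorem vertical_bound_aux (c : ℝ) (hc : 0 < c) (u : ℝ) :
    ‖Complex.Gamma (c + u * Complex.I)‖ ≤
      Real.Gamma (c + 2) / min (c ^ 2) 1 * (1 + u ^ 2)⁻¹ := by
  set s : ℂ := c + u * Complex.I with hs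
  have hre : s.re = c := by simp [hs]
  have him : s.im = u := by simp [hs]
  have h0 : s ≠ 0 := fun h => by rw [h] at hre; simp at hre; linarith
  have h1 : s + 1 ≠ 0 := fun h => by
    have := congrArg Complex.re h
    simp [hre] at this; linarith
  have e : Complex.Gamma (s + 2) = (s + 1) * (s * Complex.Gamma s) := by
    rw [← Complex.Gamma_add_one s h0, ← Complex.Gamma_add_one (s + 1) h1]
    ring_nf
  have hb : ‖Complex.Gamma (s + 2)‖ ≤ Real.Gamma (c + 2) := by
    have := norm_Gamma_le_aux (s + 2) (by simp [hre]; linarith)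
    simpa [hre] using this
  rw [e, norm_mul, norm_mul] at hb
  have hn : ‖s‖ ≤ ‖s + 1‖ := by
    rw [Complex.norm_def, Complex.norm_def]
    apply Real.sqrt_le_sqrt
    simp only [Complex.normSq_apply, Complex.add_re, Complex.add_im, Complex.one_re,
      Complex.one_im, hre, him]
    nlinarith
  have hsq : ‖s‖ ^ 2 = c ^ 2 + u ^ 2 := by
    rw [Complex.sq_norm, Complex.normSq_apply, hre, him]; ring
  have hm : 0 < min (c ^ 2) 1 := lt_min (by positivity) one_pos
  have hk : min (c ^ 2) 1 * (1 + u ^ 2) ≤ c ^ 2 + u ^ 2 := by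
    nlinarith [min_le_left (c ^ 2) 1, min_le_right (c ^ 2) 1, sq_nonneg u]
  rw [div_mul_eq_mul_div, le_div_iff₀ hm, ← div_eq_mul_inv, le_div_iff₀ (by positivity)]
  refine le_trans ?_ hb
  have hg := norm_nonneg (Complex.Gamma s)
  calc ‖Complex.Gamma s‖ * min (c ^ 2) 1 * (1 + u ^ 2)
      = (min (c ^ 2) 1 * (1 + u ^ 2)) * ‖Complex.Gamma s‖ := by ring
    _ ≤ (‖s‖ * ‖s‖) * ‖Complex.Gamma s‖ := by
        refine mul_le_mul_of_nonneg_right ?_ hg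
        rw [← sq, hsq]; exact hk
    _ ≤ (‖s + 1‖ * ‖s‖) * ‖Complex.Gamma s‖ := by gcongr
    _ = _ := by ring

theorem continuous_vertical_aux (c : ℝ) (hc : 0 < c) :
    Continuous fun u : ℝ => Complex.Gamma (c + u * Complex.I) := by
  rw [continuous_iff_continuousAt]
  intro u
  have h : ContinuousAt Complex.Gamma (c + u * Complex.I) := by
    refine (Complex.differentiableAt_Gamma _ fun m hm => ?_).continuousAt
    have := congrArg Complex.re hm
    simp at this
    have : (0 : ℝ) ≤ m := Nat.cast_nonneg m
    linarith
  exact ContinuousAt.comp (f := fun u : ℝ => (c : ℂ) + u * Complex.I) h (by fun_prop)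

theorem integrable_vertical_aux (c : ℝ) (hc : 0 < c) :
    Integrable fun u : ℝ => Complex.Gamma (c + u * Complex.I) := by
  refine Integrable.mono' (integrable_inv_one_add_sq.const_mul
    (Real.Gamma (c + 2) / min (c ^ 2) 1))
    (continuous_vertical_aux c hc).aestronglyMeasurable ?_
  exact Filter.Eventually.of_forall (vertical_bound_aux c hc)

/-- The Cahen–Mellin integral: for `x > 0` and `c > 0`, the function
`u ↦ Γ(c + iu) x^(-(c+iu))` is integrable on `ℝ` and
`(1/(2π)) ∫_ℝ Γ(c + iu) x^(-(c+iu)) du = e^(-x)`. -/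
theorem stmt_1 (x c : ℝ) (hx : 0 < x) (hc : 0 < c) :
    Integrable (fun u : ℝ =>
      Complex.Gamma (c + u * Complex.I) * (x : ℂ) ^ (-((c : ℂ) + u * Complex.I))) ∧
    (1 / (2 * (Real.pi : ℂ))) *
        ∫ u : ℝ, Complex.Gamma (c + u * Complex.I) *
          (x : ℂ) ^ (-((c : ℂ) + u * Complex.I)) =
      Complex.exp (-(x : ℂ)) := by
  have hx0 : (x : ℂ) ≠ 0 := by exact_mod_cast hx.ne'
  constructor
  · refine (integrable_vertical_aux c hc).mul_bdd (c := x ^ (-c)) ?_ ?_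
    · refine Continuous.aestronglyMeasurable ?_
      exact Continuous.const_cpow (by fun_prop) (Or.inl hx0)
    · refine Filter.Eventually.of_forall fun u => ?_
      rw [Complex.norm_cpow_eq_rpow_re_of_pos hx]
      simp
  · have hG : ∀ s : ℂ, 0 < s.re →
        mellin (fun t : ℝ => ((Real.exp (-t) : ℝ) : ℂ)) s = Complex.Gamma s := fun s hs => by
      rw [Complex.Gamma_eq_integral hs, Complex.GammaIntegral_eq_mellin]
    have hG' : ∀ u : ℝ, mellin (fun t : ℝ => ((Real.exp (-t) : ℝ) : ℂ))
        (c + u * Complex.I) = Complex.Gamma (c + u * Complex.I) :=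
      fun u => hG _ (by simpa using hc)
    have key := mellinInv_mellin_eq c (fun t : ℝ => ((Real.exp (-t) : ℝ) : ℂ)) hx ?_ ?_ ?_
    · simp only [mellinInv, hG', smul_eq_mul] at key
      rw [Complex.real_smul] at key
      push_cast at key
      rw [← key]
      congr 2
      ext u
      rw [mul_comm]
    · have := Complex.GammaIntegral_convergent (s := c) (by simpa using hc)
      refine this.congr_fun (fun t _ => ?_) measurableSet_Ioi
      simp only [smul_eq_mul]
      rw [mul_comm]
    · simp only [Complex.VerticalIntegrable, hG']
      exact integrable_vertical_aux c hc
    · fun_prop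
end

section
/- Let α ∈ (1, 2], L > 0, b > 0, and let c₁ < 0 be real. Writing s = c₁ + iu, one has (1/(2π)) ∫_ℝ (Γ(−s)/Γ(1 − s/α)) · L^{s} · b^{−s/α} du = ∑_{n=0}^∞ ((−1)ⁿ / (n! · Γ(1 − n/α))) · Lⁿ · b^{−n/α}, where the integrand is Lebesgue integrable on ℝ and the series on the right converges absolutely. (This is the residue evaluation of the V⁽²⁾ Mellin–Barnes integral by closing the contour to the right.) -/
open MeasureTheory

namespace MB
open Complex Filter Topology

lemma poly_exp_bound (M : ℕ) {δ : ℝ} (hδ : 0 < δ) :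
    ∃ C : ℝ, 0 ≤ C ∧ ∀ u : ℝ, (1 + |u|) ^ M * Real.exp (-(δ * |u|)) ≤ C * (1 + u ^ 2)⁻¹ := by
  refine ⟨Real.exp δ * (M + 2).factorial / δ ^ (M + 2), by positivity, fun u => ?_⟩
  have h0 : 0 ≤ |u| := abs_nonneg u
  have h := Real.pow_div_factorial_le_exp (δ * (1 + |u|)) (by positivity) (M + 2)
  have e1 : Real.exp (δ * (1 + |u|)) = Real.exp δ * Real.exp (δ * |u|) := by
    rw [← Real.exp_add]; ring_nf
  rw [e1, div_le_iff₀ (by positivity), mul_pow] at h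
  have hsq : (1 + u ^ 2) ≤ (1 + |u|) ^ 2 := by
    nlinarith [sq_abs u]
  rw [Real.exp_neg, ← div_eq_mul_inv, ← div_eq_mul_inv, div_le_div_iff₀ (by positivity) (by positivity),
    div_mul_eq_mul_div, le_div_iff₀ (by positivity)]
  calc (1 + |u|) ^ M * (1 + u ^ 2) * δ ^ (M + 2)
      ≤ (1 + |u|) ^ M * (1 + |u|) ^ 2 * δ ^ (M + 2) := by gcongr
    _ = δ ^ (M + 2) * (1 + |u|) ^ (M + 2) := by ring
    _ ≤ _ := h
    _ = _ := by ring

lemma normSq_sin (z : ℂ) : ‖sin z‖ ^ 2 = Real.sin z.re ^ 2 + Real.sinh z.im ^ 2 := by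
  rw [← Complex.normSq_eq_norm_sq, Complex.sin_eq z, Complex.normSq_apply]
  rw [← Complex.ofReal_sin, ← Complex.ofReal_cos, ← Complex.ofReal_sinh, ← Complex.ofReal_cosh]
  simp only [add_re, add_im, mul_re, mul_im, I_re, I_im, ofReal_re, ofReal_im]
  ring_nf
  have := Real.cosh_sq z.im
  have h2 := Real.sin_sq_add_cos_sq z.re
  rw [this, show Real.cos z.re ^ 2 = 1 - Real.sin z.re ^ 2 by linarith]
  ring

lemma norm_sin_le (z : ℂ) : ‖sin z‖ ≤ Real.exp |z.im| := by
  have h := normSq_sin z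
  have h1 : Real.cosh z.im ≤ Real.exp |z.im| := by
    rw [← Real.cosh_abs, Real.cosh_eq]
    have : Real.exp (-|z.im|) ≤ Real.exp |z.im| :=
      Real.exp_le_exp.mpr (by linarith [abs_nonneg z.im])
    linarith
  refine le_trans ?_ h1
  refine abs_le_of_sq_le_sq' ?_ (Real.cosh_pos _).le |>.2
  rw [h, Real.cosh_sq]
  nlinarith [Real.sin_sq_le_one z.re]

lemma sinh_abs_ge {y : ℝ} (hy : 1 ≤ |y|) : Real.exp |y| / 4 ≤ |Real.sinh y| := by
  rw [Real.abs_sinh, Real.sinh_eq]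
  have h1 : (2:ℝ) ≤ Real.exp |y| := by linarith [Real.add_one_le_exp |y|]
  have h2 : Real.exp (-|y|) ≤ 1 := Real.exp_le_one_iff.mpr (by linarith)
  linarith

lemma norm_sin_ge {z : ℂ} (hz : 1 ≤ |z.im|) : Real.exp |z.im| / 4 ≤ ‖sin z‖ := by
  refine le_trans (sinh_abs_ge hz) ?_
  refine abs_le_of_sq_le_sq' ?_ (norm_nonneg _) |>.2
  rw [normSq_sin, sq_abs]
  nlinarith [sq_nonneg (Real.sin z.re)]

lemma Gamma_half (u : ℝ) : ‖Gamma ((1/2 : ℝ) + u * I)‖ ^ 2 = Real.pi / Real.cosh (Real.pi * u) := by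
  have h := Complex.Gamma_mul_Gamma_one_sub ((1/2 : ℝ) + u * I)
  have e : 1 - (((1/2 : ℝ) : ℂ) + u * I) = (starRingEnd ℂ) ((1/2 : ℝ) + u * I) := by
    simp only [map_add, map_mul, conj_ofReal, conj_I]; push_cast; ring
  rw [e, Complex.Gamma_conj, Complex.mul_conj] at h
  have e2 : sin (Real.pi * (((1/2 : ℝ) : ℂ) + u * I)) = ((Real.cosh (Real.pi * u) : ℝ) : ℂ) := by
    have : (Real.pi : ℂ) * (((1/2 : ℝ) : ℂ) + u * I) = (Real.pi * u : ℂ) * I + Real.pi / 2 := by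
      push_cast; ring
    rw [this, Complex.sin_add_pi_div_two, Complex.cos_mul_I]; simp
  rw [e2, Complex.normSq_eq_norm_sq] at h
  exact_mod_cast h

lemma norm_GammaSeq (σ u : ℝ) (n : ℕ) (hn : 0 < n) :
    ‖GammaSeq (σ + u * I) n‖ = (n:ℝ) ^ σ * n.factorial / ∏ j ∈ Finset.range (n+1), ‖((σ + j : ℝ) : ℂ) + u * I‖ := by
  unfold GammaSeq
  rw [norm_div, norm_mul, norm_prod, ← Complex.ofReal_natCast n,
    Complex.norm_cpow_eq_rpow_re_of_pos (by exact_mod_cast hn)]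
  simp only [add_re, ofReal_re, mul_re, I_re, ofReal_im, I_im]
  congr 1
  · simp
  · refine Finset.prod_congr rfl fun j _ => ?_
    congr 1; push_cast; ring

lemma cross_le {a b u : ℝ} (ha : 0 < a) (hab : a ≤ b) :
    ‖(b : ℂ) + u * I‖ * a ≤ ‖(a : ℂ) + u * I‖ * b := by
  have hb : 0 < b := lt_of_lt_of_le ha hab
  refine abs_le_of_sq_le_sq' ?_ (by positivity) |>.2
  rw [mul_pow, mul_pow, ← Complex.normSq_eq_norm_sq, ← Complex.normSq_eq_norm_sq,
    Complex.normSq_add_mul_I, Complex.normSq_add_mul_I]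
  nlinarith [mul_nonneg (sq_nonneg u) (show 0 ≤ b^2 - a^2 by nlinarith)]

lemma Gamma_ratio {σ : ℝ} (hσ : 1/2 ≤ σ) (u : ℝ) :
    Real.Gamma σ * ‖Gamma ((1/2 : ℝ) + u * I)‖ ≤ ‖Gamma (σ + u * I)‖ * Real.Gamma (1/2) := by
  have t1 := (Complex.GammaSeq_tendsto_Gamma (σ + (0:ℝ) * I)).norm
  have t2 := (Complex.GammaSeq_tendsto_Gamma ((1/2:ℝ) + u * I)).norm
  have t3 := (Complex.GammaSeq_tendsto_Gamma (σ + u * I)).norm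
  have t4 := (Complex.GammaSeq_tendsto_Gamma ((1/2:ℝ) + (0:ℝ) * I)).norm
  have e1 : ‖Gamma (σ + (0:ℝ) * I)‖ = Real.Gamma σ := by
    rw [ofReal_zero, zero_mul, add_zero, Complex.Gamma_ofReal, Complex.norm_real]
    exact abs_of_pos (Real.Gamma_pos_of_pos (by linarith))
  have e4 : ‖Gamma ((1/2:ℝ) + (0:ℝ) * I)‖ = Real.Gamma (1/2) := by
    rw [ofReal_zero, zero_mul, add_zero, Complex.Gamma_ofReal, Complex.norm_real]
    exact abs_of_pos (Real.Gamma_pos_of_pos (by norm_num))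
  rw [← e1, ← e4]
  refine le_of_tendsto_of_tendsto (t1.mul t2) (t3.mul t4) ?_
  filter_upwards [eventually_gt_atTop 0] with n hn
  rw [norm_GammaSeq _ _ _ hn, norm_GammaSeq _ _ _ hn, norm_GammaSeq _ _ _ hn, norm_GammaSeq _ _ _ hn]
  rw [div_mul_div_comm, div_mul_div_comm, ← Finset.prod_mul_distrib, ← Finset.prod_mul_distrib]
  have pos : ∀ (s v : ℝ) (j : ℕ), 0 < s → 0 < ‖((s + j : ℝ) : ℂ) + v * I‖ := by
    intro s v j hs
    rw [norm_pos_iff]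
    intro h
    have := congrArg Complex.re h
    simp at this
    have hj : (0:ℝ) ≤ j := Nat.cast_nonneg j
    linarith
  have hs0 : (0:ℝ) < σ := by linarith
  have hn' : (0:ℝ) < n := by exact_mod_cast hn
  have hh : (0:ℝ) < 1/2 := by norm_num
  refine div_le_div₀ (by positivity) (le_of_eq (by ring)) ?_ ?_
  · exact Finset.prod_pos fun j _ => mul_pos (pos _ _ _ hs0) (pos _ _ _ hh)
  · refine Finset.prod_le_prod (fun j _ => (by positivity)) fun j _ => ?_
    have := cross_le (a := 1/2 + j) (b := σ + j) (u := u) (by positivity) (by linarith)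
    have n0 : ∀ s : ℝ, 0 < s → ‖((s + j : ℝ) : ℂ) + (0:ℝ) * I‖ = s + j := by
      intro s hs
      rw [ofReal_zero, zero_mul, add_zero, Complex.norm_real]
      exact abs_of_nonneg (by positivity)
    rw [n0 _ hs0, n0 _ hh]
    linarith

lemma Gamma_lower {σ : ℝ} (hσ : 1/2 ≤ σ) (u : ℝ) :
    Real.Gamma σ ≤ ‖Gamma (σ + u * I)‖ * Real.exp (Real.pi * |u| / 2) := by
  have h := Gamma_ratio hσ u
  have h2 := Gamma_half u
  have hG : 0 < Real.Gamma σ := Real.Gamma_pos_of_pos (by linarith)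
  rw [Real.Gamma_one_half_eq] at h
  refine abs_le_of_sq_le_sq' ?_ (by positivity) |>.2
  have h3 : (Real.Gamma σ * ‖Gamma ((1/2 : ℝ) + u * I)‖)^2 ≤ (‖Gamma (σ + u * I)‖ * √Real.pi)^2 := by
    gcongr
  rw [mul_pow, h2, mul_pow, Real.sq_sqrt Real.pi_pos.le] at h3
  have hc := Real.cosh_pos (Real.pi * u)
  rw [mul_div_assoc', div_le_iff₀ hc] at h3
  have h4 : Real.Gamma σ ^ 2 ≤ ‖Gamma (σ + u * I)‖ ^ 2 * Real.cosh (Real.pi * u) := by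
    have := Real.pi_pos
    by_contra hcon
    push Not at hcon
    nlinarith
  rw [mul_pow, ← Real.exp_nat_mul]
  refine h4.trans ?_
  gcongr
  rw [← Real.cosh_abs, abs_mul, abs_of_pos Real.pi_pos, Real.cosh_eq]
  have e : ((2:ℕ):ℝ) * (Real.pi * |u| / 2) = Real.pi * |u| := by push_cast; ring
  rw [e]
  have : Real.exp (-(Real.pi * |u|)) ≤ Real.exp (Real.pi * |u|) :=
      Real.exp_le_exp.mpr (by have : 0 ≤ Real.pi * |u| := by positivity
                              linarith)
  linarith

lemma inv_Gamma_bound_aux (k : ℕ) : ∀ a b : ℝ, 1/2 ≤ a + k → ∃ C : ℝ, ∃ M : ℕ, 0 ≤ C ∧ ∀ σ ∈ Set.Icc a b,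
    ∀ u : ℝ, ‖(Gamma (σ + u * I))⁻¹‖ ≤ C * (1 + |u|) ^ M * Real.exp (Real.pi * |u| / 2) := by
  induction k with
  | zero =>
    intro a b ha
    simp only [Nat.cast_zero, add_zero] at ha
    have hcont : ContinuousOn (fun x : ℝ => (Real.Gamma x)⁻¹) (Set.Icc a b) := by
      intro x hx
      have hx0 : 0 < x := by linarith [hx.1]
      refine ContinuousAt.continuousWithinAt ?_
      refine ContinuousAt.inv₀ ?_ (Real.Gamma_pos_of_pos hx0).ne'
      refine (Real.differentiableAt_Gamma fun m => ?_).continuousAt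
      have : (0:ℝ) ≤ m := Nat.cast_nonneg m
      intro h; linarith
    obtain ⟨C, hC⟩ := isCompact_Icc.exists_bound_of_continuousOn hcont
    refine ⟨max C 0, 0, le_max_right _ _, fun σ hσ u => ?_⟩
    have h1 := Gamma_lower (ha.trans hσ.1) u
    have hG : 0 < Real.Gamma σ := Real.Gamma_pos_of_pos (by linarith [hσ.1])
    have hpos : 0 < ‖Gamma (σ + u * I)‖ := by
      by_contra hcon
      have : ‖Gamma (σ + u * I)‖ = 0 := le_antisymm (not_lt.mp hcon) (norm_nonneg _)
      rw [this, zero_mul] at h1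
      linarith
    have h2 : (Real.Gamma σ)⁻¹ ≤ max C 0 := by
      refine le_trans ?_ ((hC σ hσ).trans (le_max_left _ _))
      exact Real.le_norm_self _
    rw [norm_inv, pow_zero, mul_one]
    calc ‖Gamma (σ + u * I)‖⁻¹ ≤ (Real.Gamma σ)⁻¹ * Real.exp (Real.pi * |u| / 2) := by
          rw [← one_div, ← one_div, div_mul_eq_mul_div, div_le_div_iff₀ hpos hG]
          linarith
      _ ≤ _ := by gcongr
  | succ k ih =>
    intro a b ha
    obtain ⟨C, M, hC0, hC⟩ := ih (a + 1) (b + 1) (by push_cast at ha; linarith)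
    refine ⟨(|a| + |b| + 1) * C, M + 1, by positivity, fun σ hσ u => ?_⟩
    rw [Complex.one_div_Gamma_eq_self_mul_one_div_Gamma_add_one, norm_mul]
    have h := hC (σ + 1) ⟨by linarith [hσ.1], by linarith [hσ.2]⟩ u
    have e : (σ : ℂ) + u * I + 1 = ((σ + 1 : ℝ) : ℂ) + u * I := by push_cast; ring
    rw [e]
    have hn : ‖(σ : ℂ) + u * I‖ ≤ (|a| + |b| + 1) * (1 + |u|) := by
      have h1 : ‖(σ : ℂ) + u * I‖ ≤ |σ| + |u| := by
        refine (norm_add_le _ _).trans ?_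
        simp
      have h2 : |σ| ≤ |a| + |b| := by
        rw [abs_le]
        constructor
        · linarith [hσ.1, neg_abs_le a, abs_nonneg b]
        · linarith [hσ.2, le_abs_self b, abs_nonneg a]
      have := abs_nonneg a
      have := abs_nonneg b
      have := abs_nonneg u
      nlinarith [mul_nonneg (abs_nonneg a) (abs_nonneg u), mul_nonneg (abs_nonneg b) (abs_nonneg u)]
    calc _ ≤ ((|a| + |b| + 1) * (1 + |u|)) * (C * (1 + |u|) ^ M * Real.exp (Real.pi * |u| / 2)) := by
          gcongr
      _ = _ := by ring

lemma inv_Gamma_bound (a b : ℝ) : ∃ C : ℝ, ∃ M : ℕ, 0 ≤ C ∧ ∀ σ ∈ Set.Icc a b,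
    ∀ u : ℝ, ‖(Gamma (σ + u * I))⁻¹‖ ≤ C * (1 + |u|) ^ M * Real.exp (Real.pi * |u| / 2) := by
  obtain ⟨k, hk⟩ := exists_nat_ge (1/2 - a)
  exact inv_Gamma_bound_aux k a b (by linarith)

lemma norm_beta_le {s t : ℂ} (hs : 0 < s.re) (ht : 0 < t.re) :
    ‖betaIntegral s t‖ * Real.Gamma (s.re + t.re) ≤ Real.Gamma s.re * Real.Gamma t.re := by
  have h := Complex.Gamma_mul_Gamma_eq_betaIntegral (s := (s.re : ℂ)) (t := (t.re : ℂ)) (by simpa) (by simpa)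
  have key : ((∫ x in (0:ℝ)..1, x ^ (s.re - 1) * (1 - x) ^ (t.re - 1) : ℝ) : ℂ) = betaIntegral s.re t.re := by
    unfold betaIntegral
    rw [← intervalIntegral.integral_ofReal]
    refine intervalIntegral.integral_congr fun x hx => ?_
    rw [Set.uIcc_of_le zero_le_one] at hx
    rw [ofReal_mul, Complex.ofReal_cpow hx.1, Complex.ofReal_cpow (by linarith [hx.2])]
    push_cast; rfl
  have hle : ‖betaIntegral s t‖ ≤ ∫ x in (0:ℝ)..1, x ^ (s.re - 1) * (1 - x) ^ (t.re - 1) := by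
    unfold betaIntegral
    refine (intervalIntegral.norm_integral_le_integral_norm zero_le_one).trans (le_of_eq ?_)
    rw [intervalIntegral.integral_of_le zero_le_one, intervalIntegral.integral_of_le zero_le_one,
      integral_Ioc_eq_integral_Ioo, integral_Ioc_eq_integral_Ioo]
    refine setIntegral_congr_fun measurableSet_Ioo fun x hx => ?_
    rw [norm_mul, Complex.norm_cpow_eq_rpow_re_of_pos hx.1, ← ofReal_one, ← ofReal_sub,
      Complex.norm_cpow_eq_rpow_re_of_pos (by linarith [hx.2])]
    simp
  rw [← key, ← ofReal_add, Complex.Gamma_ofReal, Complex.Gamma_ofReal, Complex.Gamma_ofReal] at h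
  have h' : Real.Gamma s.re * Real.Gamma t.re = Real.Gamma (s.re + t.re) * 
    ∫ x in (0:ℝ)..1, x ^ (s.re - 1) * (1 - x) ^ (t.re - 1) := by exact_mod_cast h
  rw [h', mul_comm]
  have := (Real.Gamma_pos_of_pos (add_pos hs ht)).le
  gcongr


lemma integrable_of_bound {f : ℝ → ℂ} (hf : Continuous f) {C : ℝ}
    (h : ∀ u : ℝ, 1 ≤ |u| → ‖f u‖ ≤ C * (1 + u ^ 2)⁻¹) : Integrable f := by
  refine hf.locallyIntegrable.integrable_of_isBigO_cocompact (g := fun u : ℝ => (1 + u ^ 2)⁻¹) ?_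
    (integrable_inv_one_add_sq.integrableAtFilter _)
  refine Asymptotics.IsBigO.of_bound C ?_
  have : ∀ᶠ u : ℝ in cocompact ℝ, 1 ≤ ‖u‖ := (tendsto_norm_cocompact_atTop).eventually_ge_atTop 1
  filter_upwards [this] with u hu
  refine (h u hu).trans (le_of_eq ?_)
  rw [Real.norm_of_nonneg (by positivity)]

lemma strip_shift {G : ℂ → ℂ} {a b C : ℝ} (hab : a ≤ b)
    (hG : ∀ s : ℂ, s.re ∈ Set.Icc a b → DifferentiableAt ℂ G s)
    (hC : ∀ σ ∈ Set.Icc a b, ∀ u : ℝ, 1 ≤ |u| → ‖G (σ + u * I)‖ ≤ C * (1 + u ^ 2)⁻¹) :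
    ∀ σ ∈ Set.Icc a b, Integrable (fun u : ℝ => G (σ + u * I)) := by
  intro σ hσ
  refine integrable_of_bound ?_ (hC σ hσ)
  rw [continuous_iff_continuousAt]
  intro u
  have h1 : ContinuousAt G (σ + u * I) := (hG _ (by simpa using hσ)).continuousAt
  exact ContinuousAt.comp (g := G) (f := fun u : ℝ => (σ : ℂ) + u * I) h1 (by fun_prop)

lemma strip_shift_eq {G : ℂ → ℂ} {a b C : ℝ} (hab : a ≤ b)
    (hG : ∀ s : ℂ, s.re ∈ Set.Icc a b → DifferentiableAt ℂ G s)
    (hC : ∀ σ ∈ Set.Icc a b, ∀ u : ℝ, 1 ≤ |u| → ‖G (σ + u * I)‖ ≤ C * (1 + u ^ 2)⁻¹) :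
    ∫ u : ℝ, G (a + u * I) = ∫ u : ℝ, G (b + u * I) := by
  have ia := strip_shift hab hG hC a ⟨le_rfl, hab⟩
  have ib := strip_shift hab hG hC b ⟨hab, le_rfl⟩
  have ta := intervalIntegral_tendsto_integral ia tendsto_neg_atTop_atBot tendsto_id
  have tb := intervalIntegral_tendsto_integral ib tendsto_neg_atTop_atBot tendsto_id
  have hrect : ∀ T : ℝ, (∫ y in (-T)..T, G (b + y * I)) - (∫ y in (-T)..T, G (a + y * I)) =
      I * ((∫ x in a..b, G (x + (-T : ℝ) * I)) - ∫ x in a..b, G (x + T * I)) := by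
    intro T
    have h := Complex.integral_boundary_rect_eq_zero_of_differentiableOn G (a + (-T : ℝ) * I) (b + T * I) (by
      intro s hs
      refine (hG s ?_).differentiableWithinAt
      have := hs.1
      simpa [Set.uIcc_of_le hab] using this)
    simp only [add_re, add_im, mul_re, mul_im, I_re, I_im, ofReal_re, ofReal_im, mul_zero, mul_one,
      sub_zero, zero_add, add_zero, smul_eq_mul] at h
    linear_combination (-I) * h + ((∫ y in (-T)..T, G (b + y * I)) - (∫ y in (-T)..T, G (a + y * I))) * Complex.I_sq
  have hbd : ∀ T : ℝ, 1 ≤ |T| → ‖∫ x in a..b, G (x + T * I)‖ ≤ C * (1 + T ^ 2)⁻¹ * |b - a| := by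
    intro T hT
    refine intervalIntegral.norm_integral_le_of_norm_le_const fun x hx => ?_
    rw [Set.uIoc_of_le hab] at hx
    exact hC x ⟨hx.1.le, hx.2⟩ T hT
  have t0 : Tendsto (fun T : ℝ => C * (1 + T ^ 2)⁻¹ * |b - a| + C * (1 + T ^ 2)⁻¹ * |b - a|) atTop (𝓝 0) := by
    have h1 : Tendsto (fun T : ℝ => (1 + T ^ 2)⁻¹) atTop (𝓝 0) :=
      tendsto_inv_atTop_zero.comp (tendsto_atTop_add_const_left _ _ (tendsto_pow_atTop two_ne_zero))
    have h2 : Tendsto (fun T : ℝ => C * (1 + T ^ 2)⁻¹ * |b - a|) atTop (𝓝 0) := by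
      simpa using (h1.const_mul C).mul_const |b - a|
    simpa using h2.add h2
  have t1 := tb.sub ta
  have t2 : Tendsto (fun T : ℝ => (∫ y in (-T)..T, G (b + y * I)) - (∫ y in (-T)..T, G (a + y * I))) atTop (𝓝 0) := by
    refine squeeze_zero_norm' ?_ t0
    filter_upwards [eventually_ge_atTop (1:ℝ)] with T hT
    rw [hrect T, norm_mul, norm_I, one_mul]
    refine (norm_sub_le _ _).trans ?_
    have hT' : 1 ≤ |T| := hT.trans (le_abs_self T)
    refine add_le_add ?_ (hbd T hT')
    have := hbd (-T) (by rwa [abs_neg])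
    simpa using this
  have := tendsto_nhds_unique t1 t2
  exact (sub_eq_zero.mp this).symm

noncomputable def EE (β x : ℝ) (s : ℂ) : ℂ := (x : ℂ) ^ s * (Gamma (1 + s))⁻¹ * (Gamma (1 - β * s))⁻¹
noncomputable def FF (β x : ℝ) (s : ℂ) : ℂ := Gamma (-s) * (Gamma (1 - β * s))⁻¹ * (x : ℂ) ^ s
noncomputable def KK (s : ℂ) : ℂ := -Real.pi / sin (Real.pi * s)

lemma FF_eq (β x : ℝ) {s : ℂ} (hs : sin (Real.pi * s) ≠ 0) : FF β x s = KK s * EE β x s := by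
  have h := Complex.Gamma_mul_Gamma_one_sub (-s)
  rw [sub_neg_eq_add, mul_neg, Complex.sin_neg] at h
  have hpi : (Real.pi : ℂ) ≠ 0 := by exact_mod_cast Real.pi_ne_zero
  have hG : Gamma (1 + s) ≠ 0 := by
    intro h0
    rw [h0, mul_zero] at h
    exact (div_ne_zero hpi (neg_ne_zero.mpr hs)) h.symm
  have : Gamma (-s) = KK s * (Gamma (1 + s))⁻¹ := by
    rw [eq_mul_inv_iff_mul_eq₀ hG, h, KK, div_neg, neg_div]
  rw [FF, EE, this]; ring

lemma EE_diff {β x : ℝ} (hx : 0 < x) : Differentiable ℂ (EE β x) := by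
  have hx' : (x : ℂ) ≠ 0 := by exact_mod_cast hx.ne'
  have h1 : Differentiable ℂ (fun s : ℂ => (x : ℂ) ^ s) := fun s =>
    (differentiableAt_id).const_cpow (Or.inl hx')
  have h2 : Differentiable ℂ (fun s : ℂ => (Gamma (1 + s))⁻¹) :=
    Complex.differentiable_one_div_Gamma.comp (f := fun s : ℂ => 1 + s) (by fun_prop)
  have h3 : Differentiable ℂ (fun s : ℂ => (Gamma (1 - β * s))⁻¹) :=
    Complex.differentiable_one_div_Gamma.comp (f := fun s : ℂ => 1 - β * s) (by fun_prop)
  exact (h1.mul h2).mul h3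

lemma FF_diff {β x : ℝ} (hx : 0 < x) {s : ℂ} (hs : s.re < 0) : DifferentiableAt ℂ (FF β x) s := by
  have hx' : (x : ℂ) ≠ 0 := by exact_mod_cast hx.ne'
  have h1 : DifferentiableAt ℂ (fun s : ℂ => (x : ℂ) ^ s) s := (differentiableAt_id).const_cpow (Or.inl hx')
  have h3 : Differentiable ℂ (fun s : ℂ => (Gamma (1 - β * s))⁻¹) :=
    Complex.differentiable_one_div_Gamma.comp (f := fun s : ℂ => 1 - β * s) (by fun_prop)
  have h2 : DifferentiableAt ℂ (fun s : ℂ => Gamma (-s)) s := by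
    refine DifferentiableAt.comp (g := Gamma) (f := fun s : ℂ => -s) s ?_ (by fun_prop)
    refine Complex.differentiableAt_Gamma _ fun m h => ?_
    have := congrArg re h
    simp at this
    have hm : (0:ℝ) ≤ m := Nat.cast_nonneg m
    linarith
  exact (h2.mul (h3 s)).mul h1

lemma pi_im (σ u : ℝ) : ((Real.pi : ℂ) * (σ + u * I)).im = Real.pi * u := by simp
lemma one_le_pi_abs {u : ℝ} (hu : 1 ≤ |u|) : 1 ≤ |Real.pi * u| := by
  rw [abs_mul, abs_of_pos Real.pi_pos]; nlinarith [Real.pi_gt_three]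

lemma sin_ne_zero_of {σ u : ℝ} (hu : 1 ≤ |u|) : sin ((Real.pi : ℂ) * (σ + u * I)) ≠ 0 := by
  have h := norm_sin_ge (z := (Real.pi : ℂ) * (σ + u * I)) (by rw [pi_im]; exact one_le_pi_abs hu)
  rw [← norm_pos_iff]
  exact lt_of_lt_of_le (by positivity) h

lemma KK_bound (σ u : ℝ) (hu : 1 ≤ |u|) : ‖KK (σ + u * I)‖ ≤ 4 * Real.pi * Real.exp (-(Real.pi * |u|)) := by
  have h := norm_sin_ge (z := (Real.pi : ℂ) * (σ + u * I)) (by rw [pi_im]; exact one_le_pi_abs hu)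
  have hpos := norm_pos_iff.mpr (sin_ne_zero_of (σ := σ) hu)
  rw [pi_im, abs_mul, abs_of_pos Real.pi_pos] at h
  rw [KK, norm_div, norm_neg, Complex.norm_real, Real.norm_of_nonneg Real.pi_pos.le, Real.exp_neg,
    ← div_eq_mul_inv, div_le_div_iff₀ hpos (by positivity)]
  nlinarith [Real.pi_pos]

lemma EE_bound {β x : ℝ} (hx : 0 < x) (h0 : 0 < β) (h1 : β < 1) (a b : ℝ) :
    ∃ C : ℝ, ∃ M : ℕ, 0 ≤ C ∧ ∀ σ ∈ Set.Icc a b, ∀ u : ℝ,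
      ‖EE β x (σ + u * I)‖ ≤ C * (1 + |u|) ^ M * Real.exp (Real.pi * (1 + β) * |u| / 2) := by
  obtain ⟨C1, M1, hC1, H1⟩ := inv_Gamma_bound (1 + a) (1 + b)
  obtain ⟨C2, M2, hC2, H2⟩ := inv_Gamma_bound (1 - β * b) (1 - β * a)
  have hcont : ContinuousOn (fun σ : ℝ => x ^ σ) (Set.Icc a b) :=
    (Real.continuous_const_rpow hx.ne').continuousOn
  obtain ⟨C3, H3⟩ := isCompact_Icc.exists_bound_of_continuousOn hcont
  refine ⟨max C3 0 * C1 * C2, M1 + M2, by positivity, fun σ hσ u => ?_⟩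
  have e1 : (1 : ℂ) + (σ + u * I) = ((1 + σ : ℝ) : ℂ) + u * I := by push_cast; ring
  have e2 : (1 : ℂ) - β * (σ + u * I) = ((1 - β * σ : ℝ) : ℂ) + (-(β * u) : ℝ) * I := by push_cast; ring
  have k1 := H1 (1 + σ) ⟨by linarith [hσ.1], by linarith [hσ.2]⟩ u
  have k2 := H2 (1 - β * σ) ⟨by nlinarith [hσ.2], by nlinarith [hσ.1]⟩ (-(β * u))
  have k3 : ‖(x : ℂ) ^ ((σ : ℂ) + u * I)‖ ≤ max C3 0 := by
    rw [Complex.norm_cpow_eq_rpow_re_of_pos hx]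
    refine le_trans ?_ ((H3 σ hσ).trans (le_max_left _ _))
    simpa using Real.le_norm_self _
  rw [abs_neg, abs_mul, abs_of_pos h0] at k2
  have k2' : ‖(Gamma (((1 - β * σ : ℝ) : ℂ) + (-(β * u) : ℝ) * I))⁻¹‖ ≤
      C2 * (1 + |u|) ^ M2 * Real.exp (Real.pi * (β * |u|) / 2) := by
    refine k2.trans ?_
    have : β * |u| ≤ |u| := by nlinarith [abs_nonneg u]
    gcongr
  rw [EE, norm_mul, norm_mul, e1, e2]
  calc _ ≤ max C3 0 * (C1 * (1 + |u|) ^ M1 * Real.exp (Real.pi * |u| / 2)) *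
        (C2 * (1 + |u|) ^ M2 * Real.exp (Real.pi * (β * |u|) / 2)) := by gcongr
    _ = max C3 0 * C1 * C2 * (1 + |u|) ^ (M1 + M2) *
        (Real.exp (Real.pi * |u| / 2) * Real.exp (Real.pi * (β * |u|) / 2)) := by ring
    _ = _ := by rw [← Real.exp_add]; congr 2; ring

lemma KE_bound {β x : ℝ} (hx : 0 < x) (h0 : 0 < β) (h1 : β < 1) (a b : ℝ) (e : ℂ) :
    ∃ C : ℝ, ∀ σ ∈ Set.Icc a b, ∀ u : ℝ, 1 ≤ |u| →
      ‖KK (σ + u * I) * (EE β x (σ + u * I) - e)‖ ≤ C * (1 + u ^ 2)⁻¹ := by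
  obtain ⟨C, M, hC, H⟩ := EE_bound hx h0 h1 a b
  obtain ⟨D, hD, HD⟩ := poly_exp_bound M (δ := Real.pi * (1 - β) / 2)
    (by have := Real.pi_pos; have : 0 < 1 - β := by linarith
        positivity)
  refine ⟨4 * Real.pi * (C + ‖e‖) * D, fun σ hσ u hu => ?_⟩
  rw [norm_mul]
  have hE : ‖EE β x (σ + u * I) - e‖ ≤ (C + ‖e‖) * (1 + |u|) ^ M * Real.exp (Real.pi * (1 + β) * |u| / 2) := by
    refine (norm_sub_le _ _).trans ?_
    have : ‖e‖ ≤ ‖e‖ * ((1 + |u|) ^ M * Real.exp (Real.pi * (1 + β) * |u| / 2)) := by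
      refine le_mul_of_one_le_right (norm_nonneg _) ?_
      refine one_le_mul_of_one_le_of_one_le (one_le_pow₀ (by linarith)) (Real.one_le_exp ?_)
      have := Real.pi_pos
      positivity
    linarith [H σ hσ u]
  have hpi := Real.pi_pos
  calc _ ≤ (4 * Real.pi * Real.exp (-(Real.pi * |u|))) *
        ((C + ‖e‖) * (1 + |u|) ^ M * Real.exp (Real.pi * (1 + β) * |u| / 2)) := by
          gcongr
          exact KK_bound σ u hu
    _ = 4 * Real.pi * (C + ‖e‖) * ((1 + |u|) ^ M *
        (Real.exp (-(Real.pi * |u|)) * Real.exp (Real.pi * (1 + β) * |u| / 2))) := by ring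
    _ = 4 * Real.pi * (C + ‖e‖) * ((1 + |u|) ^ M * Real.exp (-(Real.pi * (1 - β) / 2 * |u|))) := by
        rw [← Real.exp_add]; congr 4; ring
    _ ≤ 4 * Real.pi * (C + ‖e‖) * (D * (1 + u ^ 2)⁻¹) := mul_le_mul_of_nonneg_left (HD u) (by positivity)
    _ = _ := by ring

/-- to the left of `0` -/
lemma left_shift {β x : ℝ} (hx : 0 < x) (h0 : 0 < β) (h1 : β < 1) {a b : ℝ} (hab : a ≤ b) (hb : b < 0) :
    Integrable (fun u : ℝ => FF β x (a + u * I)) ∧ 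
    ∫ u : ℝ, FF β x (a + u * I) = ∫ u : ℝ, FF β x (b + u * I) := by
  obtain ⟨C, hC⟩ := KE_bound hx h0 h1 a b 0
  have hC' : ∀ σ ∈ Set.Icc a b, ∀ u : ℝ, 1 ≤ |u| → ‖FF β x (σ + u * I)‖ ≤ C * (1 + u ^ 2)⁻¹ := by
    intro σ hσ u hu
    rw [FF_eq β x (sin_ne_zero_of hu)]
    simpa using hC σ hσ u hu
  have hd : ∀ s : ℂ, s.re ∈ Set.Icc a b → DifferentiableAt ℂ (FF β x) s := fun s hs =>
    FF_diff hx (lt_of_le_of_lt hs.2 hb)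
  exact ⟨strip_shift hab hd hC' a ⟨le_rfl, hab⟩, strip_shift_eq hab hd hC'⟩

lemma sin_shift (n : ℕ) (w : ℂ) : sin (Real.pi * (w + n)) = (-1) ^ n * sin (Real.pi * w) := by
  induction n with
  | zero => simp
  | succ n ih =>
    have : (Real.pi : ℂ) * (w + ((n + 1 : ℕ) : ℂ)) = Real.pi * (w + n) + Real.pi := by push_cast; ring
    rw [this, Complex.sin_add_pi, ih, pow_succ]; ring

lemma sin_line (n : ℕ) (u : ℝ) :
    sin (Real.pi * (((n : ℝ) - 1/2 : ℝ) + u * I)) = -((-1) ^ n * (Real.cosh (Real.pi * u) : ℝ)) := by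
  have e : ((((n : ℝ) - 1/2 : ℝ) : ℂ) + u * I) = (-(1/2) + u * I) + n := by push_cast; ring
  have e2 : (Real.pi : ℂ) * (-(1/2) + u * I) = (Real.pi * u : ℂ) * I - Real.pi / 2 := by ring
  rw [e, sin_shift, e2, Complex.sin_sub_pi_div_two, Complex.cos_mul_I]
  simp

lemma neg_one_pow_ne (n : ℕ) : ((-1 : ℂ) ^ n) ≠ 0 := pow_ne_zero _ (by norm_num)

lemma sin_line_ne (n : ℕ) (u : ℝ) : sin (Real.pi * (((n : ℝ) - 1/2 : ℝ) + u * I)) ≠ 0 := by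
  rw [sin_line]
  have : ((Real.cosh (Real.pi * u) : ℝ) : ℂ) ≠ 0 := by exact_mod_cast (Real.cosh_pos _).ne'
  exact neg_ne_zero.mpr (mul_ne_zero (neg_one_pow_ne n) this)

lemma KK_line (n : ℕ) (u : ℝ) : KK (((n : ℝ) - 1/2 : ℝ) + u * I) =
    (-1) ^ n * ((Real.pi / Real.cosh (Real.pi * u) : ℝ) : ℂ) := by
  have : ((Real.cosh (Real.pi * u) : ℝ) : ℂ) ≠ 0 := by exact_mod_cast (Real.cosh_pos _).ne'
  have h1 : ((-1 : ℂ) ^ n) * (-1) ^ n = 1 := by rw [← mul_pow]; simp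
  have h2 := neg_one_pow_ne n
  rw [KK, sin_line, neg_div_neg_eq, ofReal_div, div_eq_iff (mul_ne_zero h2 this)]
  field_simp
  rw [sq, h1]

lemma sech_integrable : Integrable (fun u : ℝ => Real.pi / Real.cosh (Real.pi * u)) := by
  obtain ⟨D, hD, HD⟩ := poly_exp_bound 0 (δ := Real.pi) Real.pi_pos
  refine Integrable.mono' (integrable_inv_one_add_sq.const_mul (2 * Real.pi * D)) ?_ ?_
  · refine Continuous.aestronglyMeasurable ?_
    exact continuous_const.div (by fun_prop) fun u => (Real.cosh_pos _).ne'
  · refine Eventually.of_forall fun u => ?_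
    have hpi := Real.pi_pos
    have hc := Real.cosh_pos (Real.pi * u)
    rw [Real.norm_of_nonneg (by positivity)]
    have h := HD u
    rw [pow_zero, one_mul] at h
    have h2 : Real.exp (Real.pi * |u|) / 2 ≤ Real.cosh (Real.pi * u) := by
      rw [← Real.cosh_abs, abs_mul, abs_of_pos Real.pi_pos, Real.cosh_eq]
      linarith [Real.exp_pos (-(Real.pi * |u|))]
    calc Real.pi / Real.cosh (Real.pi * u) ≤ Real.pi / (Real.exp (Real.pi * |u|) / 2) := by gcongr
      _ = 2 * Real.pi * Real.exp (-(Real.pi * |u|)) := by rw [Real.exp_neg]; field_simp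
      _ ≤ 2 * Real.pi * (D * (1 + u ^ 2)⁻¹) := by gcongr
      _ = _ := by ring

lemma sech_integral : ∫ u : ℝ, Real.pi / Real.cosh (Real.pi * u) = Real.pi := by
  have hd : ∀ u : ℝ, HasDerivAt (fun u => Real.arctan (Real.sinh (Real.pi * u)))
      (Real.pi / Real.cosh (Real.pi * u)) u := by
    intro u
    have h1 : HasDerivAt (fun u : ℝ => Real.pi * u) Real.pi u := by
      simpa using (hasDerivAt_id u).const_mul Real.pi
    have h := (h1.sinh).arctan
    convert h using 1
    have hc := Real.cosh_pos (Real.pi * u)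
    rw [add_comm, ← Real.cosh_sq]
    field_simp
  have hs : Tendsto (fun u : ℝ => Real.sinh (Real.pi * u)) atTop atTop := by
    refine tendsto_atTop_mono' _ ?_ (tendsto_id.const_mul_atTop Real.pi_pos)
    filter_upwards [eventually_ge_atTop 0] with u hu
    exact Real.self_le_sinh_iff.mpr (by have := Real.pi_pos; simp only [id]; positivity)
  have hs' : Tendsto (fun u : ℝ => Real.sinh (Real.pi * u)) atBot atBot := by
    have := tendsto_neg_atTop_atBot.comp (hs.comp tendsto_neg_atBot_atTop)
    refine this.congr fun u => ?_
    simp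
  have t1 : Tendsto (fun u => Real.arctan (Real.sinh (Real.pi * u))) atTop (𝓝 (Real.pi / 2)) :=
    (Real.tendsto_arctan_atTop.mono_right nhdsWithin_le_nhds).comp hs
  have t2 : Tendsto (fun u => Real.arctan (Real.sinh (Real.pi * u))) atBot (𝓝 (-(Real.pi / 2))) :=
    (Real.tendsto_arctan_atBot.mono_right nhdsWithin_le_nhds).comp hs'
  rw [integral_of_hasDerivAt_of_tendsto hd sech_integrable t2 t1]; ring

lemma KK_integrable (n : ℕ) : Integrable (fun u : ℝ => KK (((n : ℝ) - 1/2 : ℝ) + u * I)) := by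
  simp_rw [KK_line]
  exact (sech_integrable.ofReal).const_mul _

lemma KK_integral (n : ℕ) : ∫ u : ℝ, KK (((n : ℝ) - 1/2 : ℝ) + u * I) = (-1) ^ n * Real.pi := by
  simp_rw [KK_line]
  rw [integral_const_mul, integral_complex_ofReal, sech_integral]

lemma pole_step {β x : ℝ} (hx : 0 < x) (h0 : 0 < β) (h1 : β < 1) (n : ℕ) :
    (∫ u : ℝ, FF β x (((n : ℝ) - 1/2 : ℝ) + u * I)) -
      (∫ u : ℝ, FF β x ((((n + 1 : ℕ) : ℝ) - 1/2 : ℝ) + u * I)) = 2 * Real.pi * ((-1) ^ n * EE β x n) := by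
  set G : ℂ → ℂ := fun s => dslope (EE β x) n s * (-((-1) ^ n * (Gamma (1 + (s - n)) * Gamma (1 - (s - n))))) with hGdef
  have hpi : (Real.pi : ℂ) ≠ 0 := by exact_mod_cast Real.pi_ne_zero
  have hG : ∀ s : ℂ, sin (Real.pi * s) ≠ 0 → G s = KK s * (EE β x s - EE β x n) := by
    intro s hs
    have hsin : sin (Real.pi * s) = (-1) ^ n * sin (Real.pi * (s - n)) := by
      rw [← sin_shift]; congr 2; ring
    have hw : s - n ≠ 0 := by
      intro h
      rw [h, mul_zero, sin_zero, mul_zero] at hsin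
      exact hs hsin
    have hsw : sin (Real.pi * (s - n)) ≠ 0 := by
      intro h; rw [h, mul_zero] at hsin; exact hs hsin
    have hsn : s ≠ n := sub_ne_zero.mp hw
    have hrefl : Gamma (1 + (s - n)) * Gamma (1 - (s - n)) = (s - n) * (Real.pi / sin (Real.pi * (s - n))) := by
      rw [← Complex.Gamma_mul_Gamma_one_sub, add_comm, Complex.Gamma_add_one _ hw]; ring
    have h1 : ((-1 : ℂ) ^ n) * (-1) ^ n = 1 := by rw [← mul_pow]; simp
    have h2 := neg_one_pow_ne n
    rw [hGdef]
    simp only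
    rw [dslope_of_ne _ hsn, slope_def_field, hrefl, KK, hsin]
    field_simp
    rw [sq, h1]; ring
  have hd : ∀ s : ℂ, s.re ∈ Set.Icc ((n : ℝ) - 1/2) (((n + 1 : ℕ) : ℝ) - 1/2) → DifferentiableAt ℂ G s := by
    intro s hs
    push_cast at hs
    have d1 : DifferentiableAt ℂ (dslope (EE β x) n) s :=
      ((Complex.differentiableOn_dslope (s := Set.univ) Filter.univ_mem).mpr
        (EE_diff hx).differentiableOn).differentiableAt Filter.univ_mem
    have d2 : DifferentiableAt ℂ (fun s : ℂ => Gamma (1 + (s - n))) s := by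
      refine DifferentiableAt.comp (g := Gamma) (f := fun s : ℂ => 1 + (s - n)) s ?_ (by fun_prop)
      refine Complex.differentiableAt_Gamma _ fun m h => ?_
      have := congrArg re h
      simp at this
      have hm : (0:ℝ) ≤ m := Nat.cast_nonneg m
      linarith [hs.1]
    have d3 : DifferentiableAt ℂ (fun s : ℂ => Gamma (1 - (s - n))) s := by
      refine DifferentiableAt.comp (g := Gamma) (f := fun s : ℂ => 1 - (s - n)) s ?_ (by fun_prop)
      refine Complex.differentiableAt_Gamma _ fun m h => ?_
      have := congrArg re h
      simp at this
      have hm : (0:ℝ) ≤ m := Nat.cast_nonneg m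
      linarith [hs.2]
    exact d1.mul ((d2.mul d3).const_mul _).neg
  have hab : (n : ℝ) - 1/2 ≤ ((n + 1 : ℕ) : ℝ) - 1/2 := by push_cast; linarith
  obtain ⟨C, hC⟩ := KE_bound hx h0 h1 ((n : ℝ) - 1/2) (((n + 1 : ℕ) : ℝ) - 1/2) (EE β x n)
  have hC' : ∀ σ ∈ Set.Icc ((n : ℝ) - 1/2) (((n + 1 : ℕ) : ℝ) - 1/2), ∀ u : ℝ, 1 ≤ |u| →
      ‖G (σ + u * I)‖ ≤ C * (1 + u ^ 2)⁻¹ := by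
    intro σ hσ u hu
    rw [hG _ (sin_ne_zero_of hu)]
    exact hC σ hσ u hu
  have hInt := strip_shift hab hd hC'
  have heq := strip_shift_eq hab hd hC'
  have hF : ∀ m : ℕ, ((m : ℝ) - 1/2) ∈ Set.Icc ((n : ℝ) - 1/2) (((n + 1 : ℕ) : ℝ) - 1/2) →
      ∫ u : ℝ, FF β x (((m : ℝ) - 1/2 : ℝ) + u * I) =
        (∫ u : ℝ, G (((m : ℝ) - 1/2 : ℝ) + u * I)) + (-1) ^ m * Real.pi * EE β x n := by
    intro m hm
    rw [← KK_integral m, ← integral_mul_const, ← integral_add (hInt _ hm) ((KK_integrable m).mul_const _)]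
    refine integral_congr_ae (Eventually.of_forall fun u => ?_)
    simp only
    rw [hG _ (sin_line_ne m u), FF_eq β x (sin_line_ne m u)]; ring
  rw [hF n ⟨le_rfl, hab⟩, hF (n + 1) ⟨hab, le_rfl⟩, heq, pow_succ]
  ring

lemma inv_Gamma_refl {z : ℂ} (hz : 0 < z.re) :
    (Gamma (1 - z))⁻¹ = Gamma z * sin (Real.pi * z) / Real.pi := by
  have h := Complex.Gamma_mul_Gamma_one_sub z
  have hpi : (Real.pi : ℂ) ≠ 0 := by exact_mod_cast Real.pi_ne_zero
  have hz0 := Complex.Gamma_ne_zero_of_re_pos hz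
  by_cases hs : sin (Real.pi * z) = 0
  · rw [hs, div_zero] at h
    rcases mul_eq_zero.mp h with h | h
    · exact absurd h hz0
    · rw [h, hs]; simp
  · have : Gamma (1 - z) ≠ 0 := by
      intro h'
      rw [h', mul_zero] at h
      exact div_ne_zero hpi hs h.symm
    rw [inv_eq_iff_eq_inv, inv_div, eq_div_iff (mul_ne_zero hz0 hs)]
    rw [eq_div_iff hs] at h
    linear_combination h

noncomputable def aa (β x σ : ℝ) : ℝ := Real.Gamma (β * σ) / Real.Gamma (1 + σ) * x ^ σ

lemma aa_pos {β x σ : ℝ} (hx : 0 < x) (h0 : 0 < β) (hσ : 0 < σ) : 0 < aa β x σ := by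
  have := Real.Gamma_pos_of_pos (mul_pos h0 hσ)
  have := Real.Gamma_pos_of_pos (show 0 < 1 + σ by linarith)
  unfold aa; positivity

lemma aa_step {β x σ : ℝ} (hx : 0 < x) (h0 : 0 < β) (h1 : β < 1) (hσ : 0 < σ) :
    aa β x (σ + 1) ≤ x * (1 + σ) ^ (-(1 - β)) * aa β x σ := by
  have g1 := Real.Gamma_pos_of_pos (mul_pos h0 hσ)
  have g2 := Real.Gamma_pos_of_pos (show 0 < 1 + σ by linarith)
  have hy : 0 < β * σ := mul_pos h0 hσ
  have hG : Real.Gamma (β * (σ + 1)) ≤ Real.Gamma (β * σ) * (1 + σ) ^ β := by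
    have h := Real.Gamma_mul_add_mul_le_rpow_Gamma_mul_rpow_Gamma (s := β * σ) (t := β * σ + 1)
      (a := 1 - β) (b := β) hy (by linarith) (by linarith) h0 (by ring)
    have e : (1 - β) * (β * σ) + β * (β * σ + 1) = β * (σ + 1) := by ring
    rw [e, Real.Gamma_add_one hy.ne', Real.mul_rpow hy.le g1.le] at h
    refine h.trans ?_
    have e2 : Real.Gamma (β * σ) ^ (1 - β) * Real.Gamma (β * σ) ^ β = Real.Gamma (β * σ) := by
      rw [← Real.rpow_add g1]; simp
    calc _ = (Real.Gamma (β * σ) ^ (1 - β) * Real.Gamma (β * σ) ^ β) * (β * σ) ^ β := by ring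
      _ = Real.Gamma (β * σ) * (β * σ) ^ β := by rw [e2]
      _ ≤ _ := by
        gcongr
        nlinarith
  have e3 : Real.Gamma (1 + (σ + 1)) = (1 + σ) * Real.Gamma (1 + σ) := by
    rw [← add_assoc, Real.Gamma_add_one (by linarith)]
  have e4 : (1 + σ) ^ (-(1 - β)) = (1 + σ) ^ β / (1 + σ) := by
    rw [neg_sub, Real.rpow_sub_one (by linarith)]
  unfold aa
  rw [e3, e4, Real.rpow_add_one hx.ne']
  calc _ ≤ Real.Gamma (β * σ) * (1 + σ) ^ β / ((1 + σ) * Real.Gamma (1 + σ)) * (x ^ σ * x) := by gcongr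
    _ = _ := by field_simp

lemma aa_summable {β x τ : ℝ} (hx : 0 < x) (h0 : 0 < β) (h1 : β < 1) (hτ : 0 < τ) :
    Summable (fun n : ℕ => aa β x (n + τ)) := by
  refine summable_of_ratio_norm_eventually_le (r := 1/2) (by norm_num) ?_
  have t : Tendsto (fun n : ℕ => x * (1 + ((n:ℝ) + τ)) ^ (-(1 - β))) atTop (𝓝 0) := by
    have ht : Tendsto (fun n : ℕ => 1 + ((n:ℝ) + τ)) atTop atTop :=
      tendsto_atTop_add_const_left _ _ (tendsto_atTop_add_const_right _ _ tendsto_natCast_atTop_atTop)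
    simpa using ((tendsto_rpow_neg_atTop (y := 1 - β) (by linarith)).comp ht).const_mul x
  filter_upwards [t.eventually_le_const (show (0:ℝ) < 1/2 by norm_num)] with n hn
  have hn0 : (0:ℝ) ≤ n := Nat.cast_nonneg n
  have hp : 0 < (n:ℝ) + τ := by linarith
  have e : ((n + 1 : ℕ) : ℝ) + τ = (n + τ) + 1 := by push_cast; ring
  rw [e, Real.norm_of_nonneg (aa_pos hx h0 hp).le, Real.norm_of_nonneg (aa_pos hx h0 (by linarith)).le]
  exact (aa_step hx h0 h1 hp).trans (mul_le_mul_of_nonneg_right hn (aa_pos hx h0 hp).le)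

lemma right_bound {β x : ℝ} (hx : 0 < x) (h0 : 0 < β) (h1 : β < 1) {n : ℕ} (hn : 1 ≤ n) (u : ℝ) :
    ‖FF β x (((n : ℝ) - 1/2 : ℝ) + u * I)‖ ≤
      2 * Real.exp (-(Real.pi * (1 - β) / 2 * |u|)) * aa β x ((n:ℝ) - 1/2) := by
  have hn' : (1:ℝ) ≤ n := by exact_mod_cast hn
  have hσ : 0 < (n:ℝ) - 1/2 := by linarith
  rw [FF_eq β x (sin_line_ne n u), EE, KK_line]
  set σ : ℝ := (n:ℝ) - 1/2 with hσdef
  set w : ℂ := (σ : ℂ) + u * I with hw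
  have hwre : w.re = σ := by simp [hw]
  have hwim : w.im = u := by simp [hw]
  have hbw : ((β : ℂ) * w).re = β * σ := by simp [hwre]
  have hbt : (1 + ((1 - β : ℝ) : ℂ) * w).re = 1 + (1 - β) * σ := by simp [hw]
  have hs0 : 0 < β * σ := mul_pos h0 hσ
  have ht0 : 0 < 1 + (1 - β) * σ := by nlinarith
  have hb := norm_beta_le (s := (β : ℂ) * w) (t := 1 + ((1 - β : ℝ) : ℂ) * w) (by rwa [hbw]) (by rwa [hbt])
  have hB := Complex.Gamma_mul_Gamma_eq_betaIntegral (s := (β : ℂ) * w) (t := 1 + ((1 - β : ℝ) : ℂ) * w)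
    (by rwa [hbw]) (by rwa [hbt])
  have e1 : (β : ℂ) * w + (1 + ((1 - β : ℝ) : ℂ) * w) = 1 + w := by push_cast; ring
  rw [hbw, hbt, show β * σ + (1 + (1 - β) * σ) = 1 + σ by ring] at hb
  rw [e1] at hB
  have hB' := congrArg norm hB
  rw [norm_mul, norm_mul] at hB'
  have e2 : 1 + ((1 - β : ℝ) : ℂ) * w = ((1 + (1 - β) * σ : ℝ) : ℂ) + ((1 - β) * u : ℝ) * I := by
    rw [hw]; push_cast; ring
  have hlow := Gamma_lower (σ := 1 + (1 - β) * σ) (by nlinarith) ((1 - β) * u)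
  rw [← e2, abs_mul, abs_of_pos (show 0 < 1 - β by linarith)] at hlow
  set g := ‖Gamma (1 + ((1 - β : ℝ) : ℂ) * w)‖
  set B := ‖betaIntegral (β * w) (1 + ((1 - β : ℝ) : ℂ) * w)‖
  have hg1 : 0 < ‖Gamma (1 + w)‖ := norm_pos_iff.mpr (Complex.Gamma_ne_zero_of_re_pos (by simp [hwre]; linarith))
  have hg2 : 0 < Real.Gamma (1 + σ) := Real.Gamma_pos_of_pos (by linarith)
  have hg3 : 0 < Real.Gamma (1 + (1 - β) * σ) := Real.Gamma_pos_of_pos ht0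
  have hg4 : 0 < Real.Gamma (β * σ) := Real.Gamma_pos_of_pos hs0
  have hratio : ‖Gamma (β * w)‖ / ‖Gamma (1 + w)‖ ≤
      Real.Gamma (β * σ) / Real.Gamma (1 + σ) * Real.exp (Real.pi * ((1 - β) * |u|) / 2) := by
    have hgpos : 0 < g := by
      by_contra hcon
      have : g = 0 := le_antisymm (not_lt.mp hcon) (norm_nonneg _)
      rw [this, zero_mul] at hlow
      linarith
    have e3 : ‖Gamma (β * w)‖ / ‖Gamma (1 + w)‖ = B / g := by
      rw [div_eq_div_iff hg1.ne' hgpos.ne']; linarith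
    rw [e3, div_le_iff₀ hgpos]
    have : B ≤ Real.Gamma (β * σ) * Real.Gamma (1 + (1 - β) * σ) / Real.Gamma (1 + σ) := by
      rwa [le_div_iff₀ hg2]
    refine this.trans ?_
    calc _ = Real.Gamma (β * σ) / Real.Gamma (1 + σ) * Real.Gamma (1 + (1 - β) * σ) := by ring
      _ ≤ Real.Gamma (β * σ) / Real.Gamma (1 + σ) * (g * Real.exp (Real.pi * ((1 - β) * |u|) / 2)) := by
        gcongr
      _ = _ := by ring
  rw [inv_Gamma_refl (by rwa [hbw])]
  have hsin := norm_sin_le (Real.pi * (β * w))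
  have him : ((Real.pi : ℂ) * (β * w)).im = Real.pi * (β * u) := by simp [hw]
  have hpi := Real.pi_pos
  rw [him, abs_mul, abs_mul, abs_of_pos hpi, abs_of_pos h0] at hsin
  have hc := Real.cosh_pos (Real.pi * u)
  have h2 : Real.exp (Real.pi * |u|) / 2 ≤ Real.cosh (Real.pi * u) := by
    rw [← Real.cosh_abs, abs_mul, abs_of_pos Real.pi_pos, Real.cosh_eq]
    linarith [Real.exp_pos (-(Real.pi * |u|))]
  have hcosh : (Real.cosh (Real.pi * u))⁻¹ ≤ 2 * Real.exp (-(Real.pi * |u|)) := by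
    rw [Real.exp_neg, ← one_div, ← div_eq_mul_inv, div_le_div_iff₀ hc (by positivity)]
    linarith
  simp only [norm_mul, norm_div, norm_pow, norm_neg, norm_one, one_pow, one_mul, norm_inv, Complex.norm_real,
    Real.norm_of_nonneg hpi.le, Real.norm_of_nonneg hc.le]
  rw [Complex.norm_cpow_eq_rpow_re_of_pos hx, hwre]
  calc _ = (Real.cosh (Real.pi * u))⁻¹ * ‖sin (Real.pi * (β * w))‖ *
        (‖Gamma (β * w)‖ / ‖Gamma (1 + w)‖) * x ^ σ := by
        field_simp
    _ ≤ (2 * Real.exp (-(Real.pi * |u|))) * Real.exp (Real.pi * (β * |u|)) *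
        (Real.Gamma (β * σ) / Real.Gamma (1 + σ) * Real.exp (Real.pi * ((1 - β) * |u|) / 2)) * x ^ σ := by
        gcongr
    _ = 2 * (Real.exp (-(Real.pi * |u|)) * Real.exp (Real.pi * (β * |u|)) *
        Real.exp (Real.pi * ((1 - β) * |u|) / 2)) * (Real.Gamma (β * σ) / Real.Gamma (1 + σ) * x ^ σ) := by ring
    _ = _ := by
        rw [← Real.exp_add, ← Real.exp_add, aa]; congr 3; ring

lemma line_tendsto {β x : ℝ} (hx : 0 < x) (h0 : 0 < β) (h1 : β < 1) :
    Tendsto (fun n : ℕ => ∫ u : ℝ, FF β x (((n : ℝ) - 1/2 : ℝ) + u * I)) atTop (𝓝 0) := by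
  obtain ⟨D, hD, HD⟩ := poly_exp_bound 0 (δ := Real.pi * (1 - β) / 2)
    (by have := Real.pi_pos; have : 0 < 1 - β := by linarith
        positivity)
  have hs := (aa_summable (τ := 1/2) hx h0 h1 (by norm_num)).tendsto_atTop_zero
  rw [← tendsto_add_atTop_iff_nat 1]
  have ht : Tendsto (fun n : ℕ => (∫ u : ℝ, 2 * D * (1 + u ^ 2)⁻¹) * aa β x (n + 1/2)) atTop (𝓝 0) := by
    simpa using hs.const_mul (∫ u : ℝ, 2 * D * (1 + u ^ 2)⁻¹)
  refine squeeze_zero_norm (fun n => ?_) ht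
  rw [← integral_mul_const]
  refine norm_integral_le_of_norm_le ((integrable_inv_one_add_sq.const_mul _).mul_const _)
    (Eventually.of_forall fun u => ?_)
  have h := right_bound hx h0 h1 (n := n + 1) (by omega) u
  have hn0 : (0:ℝ) ≤ n := Nat.cast_nonneg n
  have e : ((n + 1 : ℕ) : ℝ) - 1/2 = n + 1/2 := by push_cast; ring
  rw [e] at h ⊢
  refine h.trans ?_
  have hd := HD u
  rw [pow_zero, one_mul] at hd
  have := (aa_pos (β := β) hx h0 (show 0 < (n:ℝ) + 1/2 by linarith)).le
  rw [mul_assoc 2 D]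
  gcongr

lemma term_summable {β x : ℝ} (hx : 0 < x) (h0 : 0 < β) (h1 : β < 1) :
    Summable (fun n : ℕ => ‖(-1) ^ n * EE β x n‖) := by
  rw [← summable_nat_add_iff 1]
  refine Summable.of_nonneg_of_le (fun n => norm_nonneg _) (fun n => ?_) (aa_summable (τ := 1) hx h0 h1 one_pos)
  have hn0 : (0:ℝ) ≤ n := Nat.cast_nonneg n
  have e : (((n + 1 : ℕ) : ℂ)) = (((n:ℝ) + 1 : ℝ) : ℂ) := by push_cast; ring
  set y : ℝ := (n:ℝ) + 1 with hy
  have hy0 : 0 < y := by linarith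
  rw [norm_mul, norm_pow, norm_neg, norm_one, one_pow, one_mul, e, EE,
    inv_Gamma_refl (by simp; positivity)]
  have hpi := Real.pi_pos
  have hsin : ‖sin (Real.pi * ((β:ℂ) * y))‖ ≤ 1 := by
    have := norm_sin_le (Real.pi * ((β:ℂ) * y))
    simpa using this
  have e1 : (1 : ℂ) + (y : ℂ) = ((1 + y : ℝ) : ℂ) := by push_cast; ring
  have e2 : (β : ℂ) * (y : ℂ) = ((β * y : ℝ) : ℂ) := by push_cast; ring
  have g1 : 0 < Real.Gamma (β * y) := Real.Gamma_pos_of_pos (mul_pos h0 hy0)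
  have g2 : 0 < Real.Gamma (1 + y) := Real.Gamma_pos_of_pos (by linarith)
  rw [norm_mul, norm_mul, norm_div, norm_mul, norm_inv, Complex.norm_cpow_eq_rpow_re_of_pos hx, e1]
  rw [e2] at hsin ⊢
  rw [Complex.Gamma_ofReal, Complex.Gamma_ofReal, Complex.norm_real, Complex.norm_real, Complex.norm_real,
    Real.norm_of_nonneg g1.le, Real.norm_of_nonneg g2.le, Real.norm_of_nonneg hpi.le, ofReal_re]
  calc _ ≤ x ^ y * (Real.Gamma (1 + y))⁻¹ * (Real.Gamma (β * y) * 1 / 1) := by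
        gcongr
        linarith [Real.pi_gt_three]
    _ = _ := by rw [aa]; ring

lemma main_hasSum {β x : ℝ} (hx : 0 < x) (h0 : 0 < β) (h1 : β < 1) :
    ∫ u : ℝ, FF β x ((-(1/2) : ℝ) + u * I) = 2 * Real.pi * ∑' n : ℕ, (-1) ^ n * EE β x n := by
  have hs : Summable (fun n : ℕ => (-1) ^ n * EE β x n) := (term_summable hx h0 h1).of_norm
  have t1 := (hs.hasSum.tendsto_sum_nat).const_mul (2 * Real.pi : ℂ)
  have hpart : ∀ n : ℕ, 2 * Real.pi * ∑ i ∈ Finset.range n, (-1) ^ i * EE β x i =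
      (∫ u : ℝ, FF β x ((((0:ℕ) : ℝ) - 1/2 : ℝ) + u * I)) - ∫ u : ℝ, FF β x (((n : ℝ) - 1/2 : ℝ) + u * I) := by
    intro n
    induction n with
    | zero => simp
    | succ n ih =>
      rw [Finset.sum_range_succ, mul_add, ih, ← pole_step hx h0 h1 n]; ring
  simp_rw [hpart] at t1
  have t2 := (line_tendsto hx h0 h1).const_sub (∫ u : ℝ, FF β x ((((0:ℕ) : ℝ) - 1/2 : ℝ) + u * I))
  have := tendsto_nhds_unique t1 t2
  rw [sub_zero] at this
  rw [this]
  norm_num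

lemma cpow_combine {α L b : ℝ} (hα : 0 < α) (hL : 0 < L) (hb : 0 < b) (s : ℂ) :
    (L : ℂ) ^ s * (b : ℂ) ^ (-s / (α : ℂ)) = ((L * b ^ (-(1 / α)) : ℝ) : ℂ) ^ s := by
  have hr : 0 < b ^ (-(1 / α)) := Real.rpow_pos_of_pos hb _
  rw [ofReal_mul, Complex.mul_cpow_ofReal_nonneg hL.le hr.le]
  congr 1
  have hb' : (b : ℂ) ≠ 0 := by exact_mod_cast hb.ne'
  rw [Complex.cpow_def_of_ne_zero hb', Complex.cpow_def_of_ne_zero (by exact_mod_cast hr.ne'),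
    ← Complex.ofReal_log hb.le, ← Complex.ofReal_log hr.le, Real.log_rpow hb]
  congr 1
  push_cast
  ring

end MB

/-- Residue evaluation of the `V⁽²⁾` Mellin–Barnes integral by closing the
contour to the right: for `α ∈ (1,2]`, `L, b > 0`, `c₁ < 0`, with `s = c₁ + iu`,
the integrand `u ↦ Γ(-s)/Γ(1-s/α) · L^s · b^(-s/α)` is integrable on `ℝ`, the series
`∑ₙ ((-1)ⁿ/(n! Γ(1-n/α))) Lⁿ b^(-n/α)` converges absolutely, and
`(1/(2π)) ∫_ℝ Γ(-s)/Γ(1-s/α) L^s b^(-s/α) du = ∑ₙ ((-1)ⁿ/(n! Γ(1-n/α))) Lⁿ b^(-n/α)`. -/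
theorem stmt_5 (α L b c₁ : ℝ) (hα : α ∈ Set.Ioc (1 : ℝ) 2) (hL : 0 < L) (hb : 0 < b)
    (hc₁ : c₁ < 0) :
    Integrable (fun u : ℝ =>
      Complex.Gamma (-((c₁ : ℂ) + u * Complex.I)) /
          Complex.Gamma (1 - ((c₁ : ℂ) + u * Complex.I) / (α : ℂ)) *
        (L : ℂ) ^ ((c₁ : ℂ) + u * Complex.I) *
        (b : ℂ) ^ (-((c₁ : ℂ) + u * Complex.I) / (α : ℂ))) ∧
    Summable (fun n : ℕ =>
      ‖((-1 : ℂ) ^ n / ((n.factorial : ℂ) * Complex.Gamma (1 - (n : ℂ) / (α : ℂ)))) *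
        (L : ℂ) ^ n * (b : ℂ) ^ (-(n : ℂ) / (α : ℂ))‖) ∧
    (1 / (2 * (Real.pi : ℂ))) *
        ∫ u : ℝ,
          Complex.Gamma (-((c₁ : ℂ) + u * Complex.I)) /
              Complex.Gamma (1 - ((c₁ : ℂ) + u * Complex.I) / (α : ℂ)) *
            (L : ℂ) ^ ((c₁ : ℂ) + u * Complex.I) *
            (b : ℂ) ^ (-((c₁ : ℂ) + u * Complex.I) / (α : ℂ)) =
      ∑' n : ℕ,
        ((-1 : ℂ) ^ n / ((n.factorial : ℂ) * Complex.Gamma (1 - (n : ℂ) / (α : ℂ)))) *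
          (L : ℂ) ^ n * (b : ℂ) ^ (-(n : ℂ) / (α : ℂ)) := by
  obtain ⟨hα1, hα2⟩ := hα
  have hα0 : 0 < α := by linarith
  have h0 : 0 < 1 / α := by positivity
  have h1 : 1 / α < 1 := by rw [div_lt_one hα0]; exact hα1
  have hx : 0 < L * b ^ (-(1 / α)) := mul_pos hL (Real.rpow_pos_of_pos hb _)
  have hF : (fun u : ℝ =>
      Complex.Gamma (-((c₁ : ℂ) + u * Complex.I)) /
          Complex.Gamma (1 - ((c₁ : ℂ) + u * Complex.I) / (α : ℂ)) *
        (L : ℂ) ^ ((c₁ : ℂ) + u * Complex.I) *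
        (b : ℂ) ^ (-((c₁ : ℂ) + u * Complex.I) / (α : ℂ))) =
      fun u : ℝ => MB.FF (1 / α) (L * b ^ (-(1 / α))) (c₁ + u * Complex.I) := by
    funext u
    rw [mul_assoc, MB.cpow_combine hα0 hL hb, MB.FF, div_eq_mul_inv]
    congr 4
    push_cast
    ring
  have hT : (fun n : ℕ =>
      ((-1 : ℂ) ^ n / ((n.factorial : ℂ) * Complex.Gamma (1 - (n : ℂ) / (α : ℂ)))) *
        (L : ℂ) ^ n * (b : ℂ) ^ (-(n : ℂ) / (α : ℂ))) =
      fun n : ℕ => (-1) ^ n * MB.EE (1 / α) (L * b ^ (-(1 / α))) n := by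
    funext n
    rw [mul_assoc, ← Complex.cpow_natCast (L : ℂ) n, MB.cpow_combine hα0 hL hb, MB.EE, add_comm (1 : ℂ) n,
      Complex.Gamma_nat_eq_factorial]
    have e : (1 : ℂ) - ((1 / α : ℝ) : ℂ) * n = 1 - n / α := by push_cast; ring
    rw [e, div_eq_mul_inv, mul_inv]
    ring
  have hT' := MB.term_summable hx h0 h1
  have hInt : Integrable (fun u : ℝ => MB.FF (1 / α) (L * b ^ (-(1 / α))) (c₁ + u * Complex.I)) :=
    (MB.left_shift hx h0 h1 le_rfl hc₁).1
  have hval : ∫ u : ℝ, MB.FF (1 / α) (L * b ^ (-(1 / α))) (c₁ + u * Complex.I) =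
      ∫ u : ℝ, MB.FF (1 / α) (L * b ^ (-(1 / α))) ((-(1/2) : ℝ) + u * Complex.I) := by
    rcases le_total c₁ (-(1/2)) with h | h
    · exact (MB.left_shift hx h0 h1 h (by norm_num)).2
    · exact (MB.left_shift hx h0 h1 h hc₁).2.symm
  refine ⟨?_, ?_, ?_⟩
  · rw [hF]; exact hInt
  · have e := congrArg (fun f : ℕ → ℂ => fun n => ‖f n‖) hT
    rw [e]; exact hT'
  · rw [hF, hT, hval, MB.main_hasSum hx h0 h1]
    have hpi : (Real.pi : ℂ) ≠ 0 := by exact_mod_cast Real.pi_ne_zero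
    field_simp
end

section
/- For every α ∈ (1, 2], every real A and every real b > 0, the double-indexed family (n, m) ↦ ((−1)ⁿ / (n! · Γ(1 − (n − m)/α))) · Aⁿ · b^{(m−n)/α}, indexed by n ∈ ℕ and integers m ≥ 1, is absolutely summable; i.e. ∑_{n≥0, m≥1} (|A|ⁿ / n!) · |1/Γ(1 − (n − m)/α)| · b^{(m−n)/α} < ∞. (Absolute convergence of the Lévy-stable call price series.) -/
lemma inv_Gamma_step (s : ℝ) : (Real.Gamma s)⁻¹ = s * (Real.Gamma (s + 1))⁻¹ := by
  rcases eq_or_ne s 0 with rfl | h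
  · simp [Real.Gamma_zero]
  · rw [Real.Gamma_add_one h, mul_inv, ← mul_assoc, mul_inv_cancel₀ h, one_mul]

lemma inv_Gamma_shift (x : ℝ) (L : ℕ) (hx : 0 ≤ x) (hL : x ≤ L + 1) (N : ℕ) :
    |(Real.Gamma (x - N))⁻¹| * ((L + 1).factorial : ℝ)
      ≤ ((L + 1 + N).factorial : ℝ) * |(Real.Gamma x)⁻¹| := by
  induction N with
  | zero => simp [mul_comm]
  | succ N ih =>
    have h1 : x - ((N + 1 : ℕ) : ℝ) + 1 = x - N := by push_cast; ring
    rw [inv_Gamma_step, h1, abs_mul]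
    have h2 : |x - ((N + 1 : ℕ) : ℝ)| ≤ (L + 1 + N + 1 : ℝ) := by
      have : (0 : ℝ) ≤ N := N.cast_nonneg
      have : (0 : ℝ) ≤ L := L.cast_nonneg
      push_cast
      rw [abs_le]; constructor <;> linarith
    have h3 : ((L + 1 + (N + 1)).factorial : ℝ) = (L + 1 + N + 1) * ((L + 1 + N).factorial : ℝ) := by
      rw [← add_assoc, Nat.factorial_succ]; push_cast; ring
    rw [h3, mul_assoc, mul_assoc]
    exact mul_le_mul h2 ih (by positivity) (by positivity)

lemma inv_Gamma_le (x : ℝ) (hx : 1 ≤ x) :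
    |(Real.Gamma x)⁻¹| * ((⌊x⌋₊).factorial : ℝ) ≤ ⌊x⌋₊ + 1 := by
  have h0 : 0 < Real.Gamma x := Real.Gamma_pos_of_pos (by linarith)
  have hL : (1 : ℕ) ≤ ⌊x⌋₊ := Nat.le_floor (by simpa using hx)
  have hL' : (1 : ℝ) ≤ (⌊x⌋₊ : ℝ) := by exact_mod_cast hL
  have hle : (⌊x⌋₊ : ℝ) ≤ x := Nat.floor_le (by linarith)
  have hm : Real.Gamma ((⌊x⌋₊ : ℝ) + 1) ≤ Real.Gamma (x + 1) :=
    Real.Gamma_strictMonoOn_Ici.monotoneOn (by simp only [Set.mem_Ici]; linarith)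
      (by simp only [Set.mem_Ici]; linarith) (by linarith)
  rw [Real.Gamma_nat_eq_factorial, Real.Gamma_add_one (by linarith)] at hm
  rw [abs_of_pos (inv_pos.mpr h0)]
  have hx2 := (Nat.lt_floor_add_one x).le
  calc (Real.Gamma x)⁻¹ * ((⌊x⌋₊).factorial : ℝ) ≤ (Real.Gamma x)⁻¹ * (x * Real.Gamma x) := by gcongr
    _ = x := by field_simp
    _ ≤ _ := hx2

lemma inv_Gamma_bound (x : ℝ) (hx : 1 ≤ x) (N : ℕ) :
    |(Real.Gamma (x - N))⁻¹| * ((⌊x⌋₊).factorial : ℝ)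
      ≤ 4 * (N.factorial : ℝ) * 2 ^ N * 4 ^ ⌊x⌋₊ := by
  have h1 := inv_Gamma_shift x ⌊x⌋₊ (by linarith) (Nat.lt_floor_add_one x).le N
  have h2 := inv_Gamma_le x hx
  generalize ⌊x⌋₊ = L at *
  have h3 : ((L + 1 + N).factorial : ℝ) ≤ 2 ^ (L + 1 + N) * ((L+1).factorial * N.factorial) := by
    rw [← Nat.add_choose_mul_factorial_mul_factorial (L + 1) N]
    have : ((L + 1 + N).choose N : ℝ) ≤ 2 ^ (L + 1 + N) := by
      exact_mod_cast Nat.choose_le_two_pow _ _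
    push_cast
    rw [mul_assoc]
    gcongr
  have h4 : (L + 1 : ℝ) ≤ 2 ^ (L + 1) := by
    exact_mod_cast (Nat.lt_two_pow_self (n := L + 1)).le
  have hp : (0 : ℝ) < (L + 1).factorial := by positivity
  have h5 : |(Real.Gamma (x - N))⁻¹| ≤ 2 ^ (L + 1 + N) * N.factorial * |(Real.Gamma x)⁻¹| := by
    refine le_of_mul_le_mul_right (h1.trans ?_) hp
    calc _ ≤ 2 ^ (L + 1 + N) * ((L+1).factorial * N.factorial) * |(Real.Gamma x)⁻¹| := by gcongr
      _ = _ := by ring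
  calc _ ≤ 2 ^ (L + 1 + N) * N.factorial * |(Real.Gamma x)⁻¹| * (L.factorial : ℝ) := by gcongr
    _ = 2 ^ (L + 1 + N) * N.factorial * (|(Real.Gamma x)⁻¹| * (L.factorial : ℝ)) := by ring
    _ ≤ 2 ^ (L + 1 + N) * N.factorial * 2 ^ (L + 1) := by gcongr; exact h2.trans h4
    _ = _ := by
      rw [show (4 : ℝ) ^ L = 2 ^ L * 2 ^ L by rw [← mul_pow]; norm_num]; ring

lemma summable_floor (c δ : ℝ) (hc : 0 ≤ c) (hδ : 0 < δ) :
    Summable (fun n : ℕ => c ^ n / ((⌊(n : ℝ) * δ⌋₊).factorial : ℝ)) := by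
  set y : ℝ := (2 * c + 1) ^ (1 / δ) with hy
  have hy1 : 1 ≤ y := Real.one_le_rpow (by linarith) (by positivity)
  have hyd : y ^ δ = 2 * c + 1 := by
    rw [hy, ← Real.rpow_mul (by linarith), one_div_mul_cancel hδ.ne', Real.rpow_one]
  have hg : Summable (fun n : ℕ => Real.exp y * y * (1 / 2 : ℝ) ^ n) :=
    (summable_geometric_of_lt_one (by norm_num) (by norm_num)).mul_left _
  refine Summable.of_nonneg_of_le (fun n => by positivity) (fun n => ?_) hg
  have hq := Real.pow_div_factorial_le_exp y (by linarith) ⌊(n : ℝ) * δ⌋₊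
  have hfl := (Nat.lt_floor_add_one ((n : ℝ) * δ)).le
  generalize ⌊(n : ℝ) * δ⌋₊ = q at *
  have h1 : (2 * c + 1) ^ n ≤ y ^ q * y := by
    rw [← hyd, ← Real.rpow_natCast, ← Real.rpow_mul (by linarith), ← pow_succ, ← Real.rpow_natCast]
    apply Real.rpow_le_rpow_of_exponent_le hy1
    push_cast; linarith
  have h2 : c ^ n ≤ (1 / 2 : ℝ) ^ n * (y ^ q * y) := by
    calc c ^ n ≤ ((1 / 2) * (2 * c + 1)) ^ n := by gcongr; linarith
      _ = (1 / 2 : ℝ) ^ n * (2 * c + 1) ^ n := mul_pow _ _ _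
      _ ≤ _ := by gcongr
  calc _ ≤ (1 / 2 : ℝ) ^ n * (y ^ q * y) / (q.factorial : ℝ) := by gcongr
    _ = (y ^ q / (q.factorial : ℝ)) * y * (1 / 2 : ℝ) ^ n := by ring
    _ ≤ _ := by gcongr

/-- Absolute convergence of the Lévy-stable call price series: for
`α ∈ (1,2]`, `A ∈ ℝ`, `b > 0`, the family
`(n,m) ↦ (|A|ⁿ/n!) · |1/Γ(1-(n-m)/α)| · b^((m-n)/α)`, indexed by `n ∈ ℕ` and
integers `m ≥ 1` (written `m = p.2 + 1`), is summable. -/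
theorem stmt_7 (α A b : ℝ) (hα : α ∈ Set.Ioc (1 : ℝ) 2) (hb : 0 < b) :
    Summable (fun p : ℕ × ℕ =>
      (|A| ^ p.1 / (p.1.factorial : ℝ)) *
        ‖(Complex.Gamma (1 - ((p.1 : ℂ) - ((p.2 : ℂ) + 1)) / (α : ℂ)))⁻¹‖ *
        b ^ (((((p.2 : ℝ) + 1) - (p.1 : ℝ)) / α)) ) := by
  obtain ⟨h1, h2⟩ := hα
  have hα0 : 0 < α := by linarith
  set δ : ℝ := 1 - 1 / α with hδdef
  have hinv : 1 / α < 1 := by rw [div_lt_one hα0]; exact h1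
  have hinv0 : 0 < 1 / α := by positivity
  have hδ : 0 < δ := by linarith
  set β : ℝ := b ^ (1 / α) with hβ
  have hβ0 : 0 < β := Real.rpow_pos_of_pos hb _
  have S1 := summable_floor (2 * |A| * β⁻¹) δ (by positivity) hδ
  have S2 := summable_floor (4 * β) (1 / α) (by positivity) hinv0
  have S2' := (summable_nat_add_iff 1).mpr S2
  have S := (S1.mul_of_nonneg S2' (fun n => by positivity) (fun n => by positivity)).mul_left 64
  refine Summable.of_nonneg_of_le (fun p => by positivity) (fun p => ?_) S
  obtain ⟨n, m⟩ := p
  dsimp only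
  have hG : (Complex.Gamma (1 - ((n : ℂ) - ((m : ℂ) + 1)) / (α : ℂ)))
      = ((Real.Gamma (1 - ((n : ℝ) - ((m : ℝ) + 1)) / α) : ℝ) : ℂ) := by
    rw [← Complex.Gamma_ofReal]; push_cast; rfl
  have hbp : b ^ (((((m : ℝ) + 1) - (n : ℝ)) / α)) = β ^ (m + 1) * β⁻¹ ^ n := by
    rw [inv_pow, ← Real.rpow_natCast β, ← Real.rpow_natCast β, ← Real.rpow_neg hβ0.le,
      ← Real.rpow_add hβ0, hβ, ← Real.rpow_mul hb.le]
    congr 1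
    push_cast
    ring
  rw [hG, ← Complex.ofReal_inv, Complex.norm_real, Real.norm_eq_abs, hbp]
  have hn0 : (0 : ℝ) ≤ n := n.cast_nonneg
  have hQle := Nat.floor_le (mul_nonneg hn0 hδ.le)
  have hQlt := Nat.lt_floor_add_one ((n : ℝ) * δ)
  have hs0 : 0 ≤ ((m + 1 : ℕ) : ℝ) * (1 / α) := by positivity
  have hPle := Nat.floor_le hs0
  have hPlt := Nat.lt_floor_add_one (((m + 1 : ℕ) : ℝ) * (1 / α))
  have hPm : ⌊((m + 1 : ℕ) : ℝ) * (1 / α)⌋₊ ≤ m + 1 := by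
    have : ((⌊((m + 1 : ℕ) : ℝ) * (1 / α)⌋₊ : ℕ) : ℝ) ≤ ((m + 1 : ℕ) : ℝ) :=
      hPle.trans (mul_le_of_le_one_right (by positivity) hinv.le)
    exact_mod_cast this
  generalize ⌊(n : ℝ) * δ⌋₊ = Q at *
  generalize ⌊((m + 1 : ℕ) : ℝ) * (1 / α)⌋₊ = P at *
  have hQn : Q ≤ n := by
    have : (Q : ℝ) ≤ n := hQle.trans (mul_le_of_le_one_right hn0 (by linarith))
    exact_mod_cast this
  obtain ⟨N, rfl⟩ := Nat.exists_eq_add_of_le hQn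
  set x : ℝ := 1 - (((Q + N : ℕ) : ℝ) - ((m : ℝ) + 1)) / α + N with hx
  have hxe : x = 1 + ((m + 1 : ℕ) : ℝ) * (1 / α) + (((Q + N : ℕ) : ℝ) * δ - Q) := by
    rw [hx, hδdef]; push_cast; ring
  have hx1 : 1 ≤ x := by linarith
  have hB := inv_Gamma_bound x hx1 N
  have hxN : x - N = 1 - (((Q + N : ℕ) : ℝ) - ((m : ℝ) + 1)) / α := by rw [hx]; ring
  rw [hxN] at hB
  have hL1 : P ≤ ⌊x⌋₊ := Nat.le_floor (by linarith)
  have hL2 : ⌊x⌋₊ ≤ P + 2 := by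
    have : ⌊x⌋₊ < P + 3 := (Nat.floor_lt (by linarith)).mpr (by push_cast; linarith)
    omega
  generalize ⌊x⌋₊ = L at *
  set R := |(Real.Gamma (1 - (((Q + N : ℕ) : ℝ) - ((m : ℝ) + 1)) / α))⁻¹|
  have hR0 : 0 ≤ R := abs_nonneg _
  have hPL : (P.factorial : ℝ) ≤ L.factorial := by exact_mod_cast Nat.factorial_le hL1
  have hP0 : (0 : ℝ) < P.factorial := by positivity
  have hR : R ≤ 64 * N.factorial * 2 ^ (Q + N) * 4 ^ (m + 1) / P.factorial := by
    rw [le_div_iff₀ hP0]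
    calc R * P.factorial ≤ R * L.factorial := by gcongr
      _ ≤ 4 * (N.factorial : ℝ) * 2 ^ N * 4 ^ L := hB
      _ ≤ 4 * (N.factorial : ℝ) * 2 ^ (Q + N) * 4 ^ (m + 1 + 2) := by
        gcongr
        · norm_num
        · omega
        · norm_num
        · omega
      _ = _ := by ring
  have hfac : (N.factorial : ℝ) / (Q + N).factorial ≤ 1 / Q.factorial := by
    rw [div_le_div_iff₀ (by positivity) (by positivity), one_mul, mul_comm]
    exact_mod_cast Nat.le_of_dvd (Nat.factorial_pos _) (Nat.factorial_mul_factorial_dvd_factorial_add Q N)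
  calc _ ≤ |A| ^ (Q + N) / ((Q + N).factorial : ℝ) *
        (64 * N.factorial * 2 ^ (Q + N) * 4 ^ (m + 1) / P.factorial) *
        (β ^ (m + 1) * β⁻¹ ^ (Q + N)) := by gcongr
    _ = 64 * (((N.factorial : ℝ) / (Q + N).factorial) * (2 * |A| * β⁻¹) ^ (Q + N) *
        ((4 * β) ^ (m + 1) / P.factorial)) := by
      simp only [mul_pow]; ring
    _ ≤ 64 * ((1 / Q.factorial) * (2 * |A| * β⁻¹) ^ (Q + N) *
        ((4 * β) ^ (m + 1) / P.factorial)) := by gcongr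
    _ = _ := by ring
end

section
/- Let α ∈ (1, 2], let S, K, σ, τ > 0 and r ∈ ℝ, set μ := (σ/√2)^α / cos(πα/2) and [log] := log(S/K) + rτ, and assume [log] + μτ < 0. Fix c ∈ (0, 1) and for X ≠ 0 define the Green function g(X) := (1/α) · (1/(2π)) ∫_ℝ G(c + iu, X) du, where for s = c + iu one sets G(s, X) = (Γ(1 − s)/Γ(1 − s/α)) · X^{s−1} if X > 0, and G(s, X) = (Γ(s/α) Γ(1 − s) / (Γ(((α−1)/α)s) Γ(1 − ((α−1)/α)s))) · |X|^{s−1} if X < 0. Then the function y ↦ max(S e^{(r+μ)τ + y} − K, 0) · g(y/(−μτ)^{1/α}) is Lebesgue integrable on ℝ, and the call price V := (e^{−rτ}/(−μτ)^{1/α}) ∫_ℝ max(S e^{(r+μ)τ + y} − K, 0) · g(y/(−μτ)^{1/α}) dy satisfies the closed pricing formula V = (K e^{−rτ}/α) · ∑_{n≥0, m≥1} ((−1)ⁿ / (n! · Γ(1 − (n − m)/α))) · (−[log] − μτ)ⁿ · (−μτ)^{(m−n)/α}, the double series converging absolutely. -/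
open MeasureTheory

namespace FMLS

/-- The vertical line `a + i v`. -/
noncomputable def W (a v : ℝ) : ℂ := (a : ℂ) + v * Complex.I

lemma W_re (a v : ℝ) : (W a v).re = a := by simp [W]
lemma W_im (a v : ℝ) : (W a v).im = v := by simp [W]
lemma W_slit {a : ℝ} (ha : 0 < a) (v : ℝ) : W a v ∈ Complex.slitPlane := by
  left; rw [W_re]; exact ha
lemma W_ne {a : ℝ} (ha : 0 < a) (v : ℝ) : W a v ≠ 0 := Complex.slitPlane_ne_zero (W_slit ha v)
lemma le_norm_W (a v : ℝ) : a ≤ ‖W a v‖ := by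
  have := Complex.re_le_norm (W a v); rwa [W_re] at this
lemma abs_le_norm_W (a v : ℝ) : |v| ≤ ‖W a v‖ := by
  have := Complex.abs_im_le_norm (W a v); rwa [W_im] at this
lemma norm_W_le {a : ℝ} (ha : 0 < a) (v : ℝ) : ‖W a v‖ ≤ a + |v| := by
  have := Complex.norm_le_abs_re_add_abs_im (W a v)
  rwa [W_re, W_im, abs_of_pos ha] at this
lemma W_cont (a : ℝ) : Continuous (W a) := by unfold W; fun_prop
lemma W_deriv (a v : ℝ) : HasDerivAt (W a) Complex.I v := by
  unfold W
  have := ((Complex.ofRealCLM.hasDerivAt (x := v)).mul_const Complex.I).const_add (a : ℂ)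
  simpa using this
lemma abs_arg_W {a : ℝ} (ha : 0 < a) (v : ℝ) : |(W a v).arg| ≤ Real.pi / 2 := by
  rw [Complex.abs_arg_le_pi_div_two_iff, W_re]; exact ha.le

lemma W_cpow_cont {a : ℝ} (ha : 0 < a) (s : ℂ) : Continuous (fun v => W a v ^ s) :=
  (W_cont a).cpow continuous_const (fun v => W_slit ha v)

lemma W_cpow_deriv {a : ℝ} (ha : 0 < a) (s : ℂ) (v : ℝ) :
    HasDerivAt (fun v => W a v ^ s) (s * W a v ^ (s - 1) * Complex.I) v := by
  have h := (HasDerivAt.cpow_const (c := s) (hasDerivAt_id (W a v)) (W_slit ha v)).comp v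
    (W_deriv a v)
  simp only [id, mul_one] at h
  exact h

lemma norm_W_cpow_le {a : ℝ} (ha : 1 ≤ a) (s : ℂ) (v : ℝ) :
    ‖W a v ^ s‖ ≤ ‖W a v‖ ^ s.re * Real.exp (Real.pi / 2 * |s.im|) := by
  have h0 : 0 < a := by linarith
  rw [Complex.norm_cpow_of_ne_zero (W_ne h0 v), div_eq_mul_inv, ← Real.exp_neg]
  gcongr
  calc -((W a v).arg * s.im) ≤ |(W a v).arg * s.im| := neg_le_abs _
    _ = |(W a v).arg| * |s.im| := abs_mul _ _
    _ ≤ _ := by gcongr; exact abs_arg_W h0 v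

lemma rpow_le_exp {x : ℝ} (hx : 1 ≤ x) (p : ℝ) : x ^ p ≤ Real.exp (|p| * x) := by
  rw [Real.rpow_def_of_pos (by linarith)]
  apply Real.exp_le_exp.2
  have h1 : 0 ≤ Real.log x := Real.log_nonneg hx
  have h2 : Real.log x ≤ x := by linarith [Real.log_le_sub_one_of_pos (show 0 < x by linarith)]
  have := le_abs_self p
  calc Real.log x * p ≤ Real.log x * |p| := by gcongr
    _ ≤ x * |p| := by gcongr
    _ = _ := mul_comm _ _

lemma norm_W_cpow_le_exp {a : ℝ} (ha : 1 ≤ a) (s : ℂ) (v : ℝ) :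
    ‖W a v ^ s‖ ≤ Real.exp (Real.pi / 2 * |s.im|) * Real.exp (|s.re| * ‖W a v‖) := by
  refine (norm_W_cpow_le ha s v).trans ?_
  rw [mul_comm]
  gcongr
  exact rpow_le_exp (ha.trans (le_norm_W a v)) _

lemma W_neg (a v : ℝ) : W a (-v) = (starRingEnd ℂ) (W a v) := by
  simp [W]

lemma re_W_cpow_neg {a : ℝ} (ha : 0 < a) (α v : ℝ) :
    (W a (-v) ^ (α : ℂ)).re = (W a v ^ (α : ℂ)).re := by
  rw [W_neg]
  have h := Complex.cpow_conj (W a v) (α : ℂ) (Complex.mem_slitPlane_iff_arg.1 (W_slit ha v)).1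
  rw [Complex.conj_ofReal] at h
  rw [h]; simp

lemma cos_neg_of {α : ℝ} (hα : α ∈ Set.Ioc (1 : ℝ) 2) : Real.cos (Real.pi * α / 2) < 0 := by
  have := Real.pi_pos
  apply Real.cos_neg_of_pi_div_two_lt_of_lt
  · nlinarith [hα.1]
  · nlinarith [hα.2]

lemma eventually_re {α : ℝ} (hα : α ∈ Set.Ioc (1 : ℝ) 2) (a M : ℝ) :
    ∀ᶠ v : ℝ in Filter.atTop, (W a v ^ (α : ℂ)).re ≤ -(M * v) := by
  have h1 : Filter.Tendsto (fun v : ℝ => (((((a / v : ℝ)) : ℂ) + Complex.I) ^ (α : ℂ)).re)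
      Filter.atTop (nhds (Real.cos (Real.pi * α / 2))) := by
    have e : Real.cos (Real.pi * α / 2) = (((0 : ℝ) + Complex.I : ℂ) ^ (α : ℂ)).re := by
      rw [Complex.ofReal_zero, zero_add, Complex.cpow_def_of_ne_zero Complex.I_ne_zero,
        Complex.log_I, Complex.exp_re]
      simp [mul_comm, mul_div_assoc]
    rw [e]
    apply (Complex.continuous_re.tendsto _).comp
    have h2 : Filter.Tendsto (fun v : ℝ => a / v) Filter.atTop (nhds 0) :=
      tendsto_const_nhds.div_atTop Filter.tendsto_id
    have h3 := ((Complex.continuous_ofReal.tendsto 0).comp h2).add_const Complex.I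
    refine Filter.Tendsto.comp (continuousAt_cpow_const ?_) h3
    right; simp
  have hc := cos_neg_of hα
  have h2 := h1.eventually_lt_const (show Real.cos (Real.pi * α / 2) <
    Real.cos (Real.pi * α / 2) / 2 by linarith)
  have h3 : Filter.Tendsto (fun v : ℝ => v ^ (α - 1) * (-(Real.cos (Real.pi * α / 2) / 2)))
      Filter.atTop Filter.atTop :=
    (tendsto_rpow_atTop (by linarith [hα.1])).atTop_mul_const (by linarith)
  filter_upwards [h2, h3.eventually_ge_atTop M, Filter.eventually_gt_atTop 0] with v h2 h3 hv
  have e : W a v = (v : ℂ) * (((a / v : ℝ) : ℂ) + Complex.I) := by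
    have : (v : ℂ) ≠ 0 := by exact_mod_cast hv.ne'
    rw [W]; push_cast; field_simp
  have hz : (((a / v : ℝ) : ℂ) + Complex.I) ≠ 0 := by
    intro h; have := congrArg Complex.im h; simp at this
  have e2 : W a v ^ (α : ℂ) = ((v ^ α : ℝ) : ℂ) * (((a / v : ℝ) : ℂ) + Complex.I) ^ (α : ℂ) := by
    rw [e, Complex.ofReal_cpow hv.le]
    rw [Complex.cpow_def_of_ne_zero (mul_ne_zero (by exact_mod_cast hv.ne') hz),
      Complex.cpow_def_of_ne_zero hz, Complex.cpow_def_of_ne_zero (by exact_mod_cast hv.ne'),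
      Complex.log_ofReal_mul hv hz, ← Complex.exp_add, Complex.ofReal_log hv.le, add_mul]
  rw [e2, Complex.re_ofReal_mul]
  have e3 : v ^ α = v ^ (α - 1) * v := by
    rw [← Real.rpow_add_one hv.ne']; ring_nf
  have hp : 0 < v ^ (α - 1) := Real.rpow_pos_of_pos hv _
  calc _ ≤ v ^ α * (Real.cos (Real.pi * α / 2) / 2) := by
        gcongr
    _ = -(v ^ (α - 1) * (-(Real.cos (Real.pi * α / 2) / 2)) * v) := by rw [e3]; ring
    _ ≤ _ := by gcongr

/-- the kernel `exp ((a+iv)^α)` -/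
noncomputable def E (α a v : ℝ) : ℂ := Complex.exp (W a v ^ (α : ℂ))

lemma E_cont {a : ℝ} (ha : 0 < a) (α : ℝ) : Continuous (E α a) :=
  Complex.continuous_exp.comp (W_cpow_cont ha _)

lemma E_int {α : ℝ} (hα : α ∈ Set.Ioc (1 : ℝ) 2) {a : ℝ} (ha : 0 < a) (M : ℝ) :
    Integrable (fun v => ‖E α a v‖ * Real.exp (M * ‖W a v‖)) := by
  have hcont : Continuous (fun v => ‖E α a v‖ * Real.exp (M * ‖W a v‖)) := by
    have := E_cont ha α
    have := W_cont a
    fun_prop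
  have heven : ∀ v, ‖E α a (-v)‖ * Real.exp (M * ‖W a (-v)‖) =
      ‖E α a v‖ * Real.exp (M * ‖W a v‖) := by
    intro v
    rw [E, E, Complex.norm_exp, Complex.norm_exp, re_W_cpow_neg ha, W_neg, Complex.norm_conj]
  have h1 : IntegrableOn (fun v => ‖E α a v‖ * Real.exp (M * ‖W a v‖)) (Set.Ioi 0) := by
    refine integrable_of_isBigO_exp_neg (b := 1) one_pos hcont.continuousOn ?_
    refine Asymptotics.IsBigO.of_bound (Real.exp (|M| * a)) ?_
    filter_upwards [eventually_re hα a (|M| + 1), Filter.eventually_gt_atTop 0] with v hv hv0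
    rw [E, Complex.norm_exp, ← Real.exp_add, Real.norm_eq_abs, Real.abs_exp, Real.norm_eq_abs,
      Real.abs_exp, ← Real.exp_add]
    apply Real.exp_le_exp.2
    have h1 := norm_W_le ha v
    rw [abs_of_pos hv0] at h1
    have h2 : M * ‖W a v‖ ≤ |M| * (a + v) :=
      mul_le_mul (le_abs_self M) h1 (norm_nonneg _) (abs_nonneg _)
    linarith
  have h2 : IntegrableOn (fun v => ‖E α a v‖ * Real.exp (M * ‖W a v‖)) (Set.Iic 0) := by
    rw [integrableOn_Iic_iff_integrableOn_Iio]
    have h3 := (show IntegrableOn (fun v => ‖E α a v‖ * Real.exp (M * ‖W a v‖)) (Set.Ioi (-0))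
      by simpa using h1).comp_neg_Iio
    simpa only [heven] using h3
  rw [← integrableOn_univ, ← Set.Iic_union_Ioi (a := (0:ℝ))]
  exact h2.union h1

end FMLS
namespace FMLS

lemma re_W_cpow_le {a : ℝ} (ha : 1 ≤ a) {β : ℝ} (hβ : β ∈ Set.Icc (1 : ℝ) 2) (v : ℝ) :
    (W a v ^ (β : ℂ)).re ≤ a ^ 2 := by
  have h0 : 0 < a := by linarith
  have hd : ∀ v : ℝ, HasDerivAt (fun v => (W a v ^ (β : ℂ)).re)
      ((β * W a v ^ ((β : ℂ) - 1) * Complex.I).re) v := fun v =>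
    (Complex.reCLM.hasFDerivAt.comp_hasDerivAt v (W_cpow_deriv h0 (β : ℂ) v))
  have hanti : AntitoneOn (fun v => (W a v ^ (β : ℂ)).re) (Set.Ici 0) := by
    apply antitoneOn_of_deriv_nonpos (convex_Ici 0)
    · exact (Complex.continuous_re.comp (W_cpow_cont h0 _)).continuousOn
    · intro v _; exact (hd v).differentiableAt.differentiableWithinAt
    · intro v hv
      rw [interior_Ici] at hv
      rw [(hd v).deriv, mul_assoc, Complex.re_ofReal_mul, Complex.mul_I_re,
        Complex.cpow_def_of_ne_zero (W_ne h0 v), Complex.exp_im]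
      have h1 : (Complex.log (W a v) * ((β : ℂ) - 1)).im = (W a v).arg * (β - 1) := by
        have : ((β : ℂ) - 1) = ((β - 1 : ℝ) : ℂ) := by push_cast; ring
        rw [this, Complex.im_mul_ofReal, Complex.log_im]
      rw [h1]
      have h2 : 0 ≤ (W a v).arg := by
        rw [Complex.arg_nonneg_iff, W_im]; exact le_of_lt hv
      have h3 : (W a v).arg ≤ Real.pi / 2 := (le_abs_self _).trans (abs_arg_W h0 v)
      have h4 : 0 ≤ Real.sin ((W a v).arg * (β - 1)) := by
        apply Real.sin_nonneg_of_nonneg_of_le_pi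
        · exact mul_nonneg h2 (by linarith [hβ.1])
        · have := Real.pi_pos
          nlinarith [hβ.1, hβ.2]
      have h5 := Real.exp_pos (Complex.log (W a v) * ((β : ℂ) - 1)).re
      have : 0 ≤ β := by linarith [hβ.1]
      have := mul_nonneg this (mul_nonneg h5.le h4)
      linarith
  have hz : (W a 0 ^ (β : ℂ)).re ≤ a ^ 2 := by
    have : W a 0 = (a : ℂ) := by simp [W]
    rw [this, ← Complex.ofReal_cpow h0.le, Complex.ofReal_re]
    calc a ^ β ≤ a ^ (2 : ℝ) := Real.rpow_le_rpow_of_exponent_le ha hβ.2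
      _ = a ^ 2 := by norm_cast
  rcases le_total 0 v with hv | hv
  · exact (hanti (Set.mem_Ici.2 le_rfl) hv hv).trans hz
  · rw [← re_W_cpow_neg h0]
    have hv' : 0 ≤ -v := by linarith
    exact (hanti (Set.mem_Ici.2 le_rfl) hv' hv').trans hz

lemma int_inv_sq {a : ℝ} (ha : 1 ≤ a) : Integrable (fun v => (‖W a v‖ ^ 2)⁻¹) := by
  have h0 : 0 < a := by linarith
  refine integrable_inv_one_add_sq.mono' ?_ ?_
  · have := W_cont a
    refine Continuous.aestronglyMeasurable (Continuous.inv₀ (by fun_prop) ?_)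
    intro v; have := W_ne h0 v; positivity
  · refine Filter.Eventually.of_forall fun v => ?_
    rw [Real.norm_of_nonneg (by positivity)]
    gcongr
    rw [Complex.sq_norm, Complex.normSq_apply, W_re, W_im]
    nlinarith

/-- logarithm of `W` -/
noncomputable def L (a v : ℝ) : ℂ := Complex.log (W a v)

lemma L_cont {a : ℝ} (ha : 0 < a) : Continuous (L a) :=
  (W_cont a).clog (fun v => W_slit ha v)

lemma L_deriv {a : ℝ} (ha : 0 < a) (v : ℝ) : HasDerivAt (L a) (Complex.I / W a v) v := by
  have := (W_deriv a v).clog_real (W_slit ha v)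
  exact this

lemma norm_L_le {a : ℝ} (ha : 1 ≤ a) (v : ℝ) : ‖L a v‖ ≤ ‖W a v‖ + Real.pi := by
  have h0 : 0 < a := by linarith
  have h1 := Complex.norm_le_abs_re_add_abs_im (L a v)
  rw [L, Complex.log_re, Complex.log_im] at h1
  have hN := ha.trans (le_norm_W a v)
  rw [abs_of_nonneg (Real.log_nonneg hN)] at h1
  have := Real.log_le_sub_one_of_pos (show 0 < ‖W a v‖ by linarith)
  have := Complex.abs_arg_le_pi (W a v)
  rw [L]
  linarith

noncomputable def Phi (q : ℂ) (a β v : ℝ) : ℂ :=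
  Complex.exp (Complex.exp (β * L a v) + q * β * L a v)

lemma exp_L {a : ℝ} (ha : 0 < a) (s : ℂ) (v : ℝ) : Complex.exp (s * L a v) = W a v ^ s := by
  rw [L, Complex.cpow_def_of_ne_zero (W_ne ha v), mul_comm]

lemma norm_Phi_le {a : ℝ} (ha : 1 ≤ a) {q : ℂ} (hq : q.re ≤ -6) {β : ℝ}
    (hβ : β ∈ Set.Icc (1 : ℝ) 2) (v : ℝ) :
    ‖Phi q a β v‖ ≤ Real.exp (a ^ 2) * Real.exp (Real.pi * |q.im|) * (‖W a v‖ ^ 6)⁻¹ := by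
  have h0 : 0 < a := by linarith
  have hN := ha.trans (le_norm_W a v)
  rw [Phi, Complex.exp_add, norm_mul, exp_L h0, exp_L h0, Complex.norm_exp, mul_assoc]
  gcongr
  · exact re_W_cpow_le ha hβ v
  · refine (norm_W_cpow_le ha _ v).trans ?_
    rw [mul_comm]
    have h1 : (q * (β : ℂ)).im = q.im * β := Complex.im_mul_ofReal _ _
    have h2 : (q * (β : ℂ)).re = q.re * β := Complex.re_mul_ofReal _ _
    rw [h1, h2, abs_mul, abs_of_nonneg (show 0 ≤ β by linarith [hβ.1])]
    gcongr ?_ * ?_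
    · apply Real.exp_le_exp.2
      have := mul_nonneg Real.pi_pos.le (abs_nonneg q.im)
      nlinarith [hβ.2]
    · have : (‖W a v‖ ^ 6)⁻¹ = ‖W a v‖ ^ (-6 : ℝ) := by
        rw [Real.rpow_neg (norm_nonneg _)]; norm_cast
      rw [this]
      apply Real.rpow_le_rpow_of_exponent_le hN
      nlinarith [hβ.1]

noncomputable def Dd (q : ℂ) (a β v : ℝ) : ℂ :=
  (W a v)⁻¹ * Phi q a β v * (1 + β * L a v * (Complex.exp (β * L a v) + q))

lemma Phi_cont {a : ℝ} (ha : 0 < a) (q : ℂ) :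
    Continuous (fun p : ℝ × ℝ => Phi q a p.1 p.2) := by
  unfold Phi
  have := L_cont ha
  fun_prop

lemma Dd_cont {a : ℝ} (ha : 0 < a) (q : ℂ) :
    Continuous (fun p : ℝ × ℝ => Dd q a p.1 p.2) := by
  unfold Dd
  have h1 := L_cont ha
  have h2 := Phi_cont ha q
  have h3 := W_cont a
  have h4 : Continuous (fun p : ℝ × ℝ => (W a p.2)⁻¹) :=
    Continuous.inv₀ (by fun_prop) (fun p => W_ne ha _)
  fun_prop

lemma aux_ineq {N l e P Q : ℝ} (hN : 1 ≤ N) (hP : 0 ≤ P) (hQ : 0 ≤ Q) (he0 : 0 ≤ e)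
    (hl : l ≤ N + P) (he : e ≤ N ^ 2) :
    1 + 2 * l * (e + Q) ≤ N ^ 4 * (1 + 2 * (1 + P) * (1 + Q)) := by
  have h1 : l ≤ N * (1 + P) := by nlinarith
  have h2 : e + Q ≤ N ^ 2 * (1 + Q) := by nlinarith [one_le_pow₀ hN (n := 2)]
  have h3 : l * (e + Q) ≤ (N * (1 + P)) * (N ^ 2 * (1 + Q)) := by gcongr
  have h4 : N ^ 3 ≤ N ^ 4 := pow_le_pow_right₀ hN (by norm_num)
  have h5 : 1 ≤ N ^ 4 := one_le_pow₀ hN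
  have h6 : 0 ≤ (1 + P) * (1 + Q) := by positivity
  nlinarith [mul_le_mul_of_nonneg_right h4 h6]

lemma norm_Dd_le {a : ℝ} (ha : 1 ≤ a) {q : ℂ} (hq : q.re ≤ -6) :
    ∃ C : ℝ, ∀ β ∈ Set.Icc (1 : ℝ) 2, ∀ v, ‖Dd q a β v‖ ≤ C * (‖W a v‖ ^ 2)⁻¹ := by
  have h0 : 0 < a := by linarith
  refine ⟨Real.exp (a ^ 2) * Real.exp (Real.pi * |q.im|) *
    (1 + 2 * (1 + Real.pi) * (1 + ‖q‖)), fun β hβ v => ?_⟩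
  have hN := ha.trans (le_norm_W a v)
  have hβ0 : 0 ≤ β := by linarith [hβ.1]
  have h1 : ‖1 + β * L a v * (Complex.exp (β * L a v) + q)‖ ≤
      ‖W a v‖ ^ 4 * (1 + 2 * (1 + Real.pi) * (1 + ‖q‖)) := by
    refine le_trans ?_ (aux_ineq hN Real.pi_pos.le (norm_nonneg q)
      (norm_nonneg (Complex.exp (β * L a v))) (norm_L_le ha v) ?_)
    · refine (norm_add_le _ _).trans ?_
      rw [norm_one, norm_mul, norm_mul, Complex.norm_of_nonneg hβ0]
      gcongr
      · exact hβ.2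
      · exact norm_add_le _ _
    · rw [exp_L h0]
      refine (norm_W_cpow_le ha _ v).trans ?_
      simp only [Complex.ofReal_im, abs_zero, mul_zero, Real.exp_zero, mul_one, Complex.ofReal_re]
      calc ‖W a v‖ ^ β ≤ ‖W a v‖ ^ (2 : ℝ) := Real.rpow_le_rpow_of_exponent_le hN hβ.2
        _ = _ := by norm_cast
  rw [Dd, norm_mul, norm_mul, norm_inv]
  have h2 : ‖W a v‖⁻¹ ≤ 1 := inv_le_one_of_one_le₀ hN
  calc _ ≤ 1 * (Real.exp (a ^ 2) * Real.exp (Real.pi * |q.im|) * (‖W a v‖ ^ 6)⁻¹) *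
        (‖W a v‖ ^ 4 * (1 + 2 * (1 + Real.pi) * (1 + ‖q‖))) := by
        gcongr
        exact norm_Phi_le ha hq hβ v
    _ = _ := by
      have : ‖W a v‖ ≠ 0 := by linarith
      field_simp

lemma Dd_int {a : ℝ} (ha : 1 ≤ a) {q : ℂ} (hq : q.re ≤ -6) {β : ℝ}
    (hβ : β ∈ Set.Icc (1 : ℝ) 2) : Integrable (Dd q a β) := by
  obtain ⟨C, hC⟩ := norm_Dd_le ha hq
  refine ((int_inv_sq ha).const_mul C).mono' ?_ (Filter.Eventually.of_forall (hC β hβ))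
  exact ((Dd_cont (by linarith) q).comp (by fun_prop : Continuous fun v : ℝ => (β, v))).aestronglyMeasurable

lemma WPhi_int {a : ℝ} (ha : 1 ≤ a) {q : ℂ} (hq : q.re ≤ -6) {β : ℝ}
    (hβ : β ∈ Set.Icc (1 : ℝ) 2) : Integrable (fun v => β * (W a v)⁻¹ * Phi q a β v) := by
  have h0 : 0 < a := by linarith
  refine ((int_inv_sq ha).const_mul (2 * (Real.exp (a ^ 2) * Real.exp (Real.pi * |q.im|)))).mono' ?_
    (Filter.Eventually.of_forall fun v => ?_)
  · have h2 := (Phi_cont h0 q).comp (by fun_prop : Continuous fun v : ℝ => (β, v))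
    have h3 := W_cont a
    have h4 : Continuous (fun v : ℝ => (W a v)⁻¹) := h3.inv₀ (fun p => W_ne h0 _)
    exact ((continuous_const.mul h4).mul h2).aestronglyMeasurable
  · have hN := ha.trans (le_norm_W a v)
    rw [norm_mul, norm_mul, norm_inv, Complex.norm_of_nonneg (by linarith [hβ.1])]
    have h2 : ‖W a v‖⁻¹ ≤ 1 := inv_le_one_of_one_le₀ hN
    calc β * ‖W a v‖⁻¹ * ‖Phi q a β v‖ ≤ 2 * 1 * (Real.exp (a ^ 2) * Real.exp (Real.pi * |q.im|) * (‖W a v‖ ^ 6)⁻¹) := by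
          gcongr
          · exact hβ.2
          · exact norm_Phi_le ha hq hβ v
      _ ≤ 2 * 1 * (Real.exp (a ^ 2) * Real.exp (Real.pi * |q.im|) * (‖W a v‖ ^ 2)⁻¹) := by
          gcongr
          norm_num
      _ = _ := by ring

lemma LPhi_int {a : ℝ} (ha : 1 ≤ a) {q : ℂ} (hq : q.re ≤ -6) {β : ℝ}
    (hβ : β ∈ Set.Icc (1 : ℝ) 2) : Integrable (fun v => L a v * Phi q a β v) := by
  have h0 : 0 < a := by linarith
  refine ((int_inv_sq ha).const_mul ((1 + Real.pi) * (Real.exp (a ^ 2) * Real.exp (Real.pi * |q.im|)))).mono' ?_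
    (Filter.Eventually.of_forall fun v => ?_)
  · have h2 := (Phi_cont h0 q).comp (by fun_prop : Continuous fun v : ℝ => (β, v))
    exact ((L_cont h0).mul h2).aestronglyMeasurable
  · have hN := ha.trans (le_norm_W a v)
    rw [norm_mul]
    have hp := Real.pi_pos
    have hl : ‖L a v‖ ≤ ‖W a v‖ ^ 4 * (1 + Real.pi) := by
      refine (norm_L_le ha v).trans ?_
      have h1 : ‖W a v‖ ≤ ‖W a v‖ ^ 4 := le_self_pow₀ hN (by norm_num)
      nlinarith
    calc ‖L a v‖ * ‖Phi q a β v‖ ≤ (‖W a v‖ ^ 4 * (1 + Real.pi)) * (Real.exp (a ^ 2) * Real.exp (Real.pi * |q.im|) * (‖W a v‖ ^ 6)⁻¹) := by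
          gcongr
          exact norm_Phi_le ha hq hβ v
      _ = _ := by
          have : ‖W a v‖ ≠ 0 := by linarith
          field_simp

lemma Dd_integral {a : ℝ} (ha : 1 ≤ a) {q : ℂ} (hq : q.re ≤ -6) {β : ℝ}
    (hβ : β ∈ Set.Icc (1 : ℝ) 2) : ∫ v, Dd q a β v = 0 := by
  have h0 : 0 < a := by linarith
  have hd : ∀ v, HasDerivAt (fun v => L a v * Phi q a β v) (Complex.I * Dd q a β v) v := by
    intro v
    have h1 := L_deriv h0 v
    have h2 : HasDerivAt (fun v => Phi q a β v) _ v :=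
      (((h1.const_mul (β : ℂ)).cexp).add (h1.const_mul (q * β))).cexp
    have h3 := h1.mul h2
    refine h3.congr_deriv ?_
    simp only [Dd, Phi, Pi.add_apply]
    have := W_ne h0 v
    field_simp
  have := integral_eq_zero_of_hasDerivAt_of_integrable hd ((Dd_int ha hq hβ).const_mul _)
    (LPhi_int ha hq hβ)
  rw [integral_const_mul] at this
  simpa using this

lemma homotopy {a : ℝ} (ha : 1 ≤ a) {q : ℂ} (hq : q.re ≤ -6) {α : ℝ}
    (hα : α ∈ Set.Ioc (1 : ℝ) 2) :
    ∫ v, α * (W a v)⁻¹ * Phi q a α v = ∫ v, ((1 : ℝ) : ℂ) * (W a v)⁻¹ * Phi q a 1 v := by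
  have h0 : 0 < a := by linarith
  obtain ⟨C, hC⟩ := norm_Dd_le ha hq
  rw [← sub_eq_zero, ← integral_sub (WPhi_int ha hq ⟨hα.1.le, hα.2⟩) (WPhi_int ha hq ⟨le_rfl, by norm_num⟩)]
  have hd : ∀ v, ∫ β in (1 : ℝ)..α, Dd q a β v =
      α * (W a v)⁻¹ * Phi q a α v - ((1 : ℝ) : ℂ) * (W a v)⁻¹ * Phi q a 1 v := by
    intro v
    refine intervalIntegral.integral_eq_sub_of_hasDerivAt
      (f := fun β : ℝ => β * (W a v)⁻¹ * Phi q a β v) (fun β _ => ?_) ?_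
    · have h1 : HasDerivAt (fun β : ℝ => (β : ℂ)) 1 β := by
        simpa using (hasDerivAt_id β).ofReal_comp
      have h2 : HasDerivAt (fun β => Phi q a β v) _ β :=
        (((h1.mul_const (L a v)).cexp).add ((h1.const_mul q).mul_const (L a v))).cexp
      have h3 := (h1.mul_const (W a v)⁻¹).mul h2
      refine h3.congr_deriv ?_
      simp only [Dd, Phi, Pi.add_apply]
      ring
    · exact ((Dd_cont h0 q).comp (by fun_prop : Continuous fun β : ℝ => (β, v))).intervalIntegrable _ _
  simp_rw [← hd]
  rw [← intervalIntegral_integral_swap]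
  · rw [intervalIntegral.integral_congr (g := fun _ => 0), intervalIntegral.integral_zero]
    intro β hβ
    rw [Set.uIcc_of_le hα.1.le] at hβ
    exact Dd_integral ha hq ⟨hβ.1, hβ.2.trans hα.2⟩
  · rw [Set.uIoc_of_le hα.1.le]
    have hi : Integrable (fun p : ℝ × ℝ => (1 : ℝ) * (C * (‖W a p.2‖ ^ 2)⁻¹))
        ((volume.restrict (Set.Ioc 1 α)).prod volume) :=
      Integrable.mul_prod (f := fun _ => (1 : ℝ)) (g := fun v => C * (‖W a v‖ ^ 2)⁻¹)
        (integrable_const _) ((int_inv_sq ha).const_mul C)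
    refine hi.mono' (Dd_cont h0 q).aestronglyMeasurable ?_
    have : ((volume.restrict (Set.Ioc 1 α)).prod (volume : Measure ℝ)) =
        (volume.prod volume).restrict (Set.Ioc 1 α ×ˢ Set.univ) := by
      rw [← Measure.prod_restrict, Measure.restrict_univ]
    rw [this]
    refine (ae_restrict_iff' (measurableSet_Ioc.prod MeasurableSet.univ)).2
      (Filter.Eventually.of_forall fun p hp => ?_)
    rw [one_mul]
    exact hC p.1 ⟨hp.1.1.le, hp.1.2.trans hα.2⟩ p.2

end FMLS
namespace FMLS

/-- Laplace kernel of the Gamma integral. -/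
noncomputable def kG (z : ℂ) (a v t : ℝ) : ℂ := (t : ℂ) ^ (z - 1) * Complex.exp (-(W a v * t))

lemma norm_kG (z : ℂ) (a v : ℝ) {t : ℝ} (ht : 0 < t) :
    ‖kG z a v t‖ = t ^ (z.re - 1) * Real.exp (-(a * t)) := by
  rw [kG, norm_mul, Complex.norm_cpow_eq_rpow_re_of_pos ht, Complex.norm_exp]
  simp [W_re]

lemma real_int {a : ℝ} (ha : 0 < a) {x : ℝ} (hx : 0 < x) :
    IntegrableOn (fun t : ℝ => t ^ (x - 1) * Real.exp (-(a * t))) (Set.Ioi 0) := by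
  have := integrableOn_rpow_mul_exp_neg_mul_rpow (p := 1) (s := x - 1) (b := a) (by linarith)
    one_pos ha
  simpa using this

lemma ofReal_cpow_contOn (z : ℂ) : ContinuousOn (fun t : ℝ => (t : ℂ) ^ z) (Set.Ioi 0) := by
  intro t ht
  apply ContinuousAt.continuousWithinAt
  exact ContinuousAt.comp (f := fun t : ℝ => (t : ℂ)) (g := fun x : ℂ => x ^ z)
    (continuousAt_cpow_const (Complex.ofReal_mem_slitPlane.2 ht)) Complex.continuous_ofReal.continuousAt

lemma kG_contOn (z : ℂ) (a v : ℝ) : ContinuousOn (kG z a v) (Set.Ioi 0) := by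
  unfold kG
  exact (ofReal_cpow_contOn _).mul (by fun_prop)

lemma kG_int {a : ℝ} (ha : 0 < a) {z : ℂ} (hz : 0 < z.re) (v : ℝ) :
    IntegrableOn (kG z a v) (Set.Ioi 0) := by
  refine (real_int ha hz).mono' ((kG_contOn z a v).aestronglyMeasurable measurableSet_Ioi) ?_
  refine (ae_restrict_iff' measurableSet_Ioi).2 (Filter.Eventually.of_forall fun t ht => ?_)
  rw [norm_kG z a v ht]

lemma kG_parts {a : ℝ} (ha : 0 < a) {z : ℂ} (hz : 0 < z.re) (v : ℝ) :
    W a v * ∫ t in Set.Ioi 0, kG (z + 1) a v t = z * ∫ t in Set.Ioi 0, kG z a v t := by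
  have hz1 : 0 < (z + 1).re := by simp; linarith
  have h1 : ∫ t in Set.Ioi 0, (z * kG z a v t - W a v * kG (z + 1) a v t) =
      0 - (((0 : ℝ) : ℂ) ^ z * Complex.exp (-(W a v * (0 : ℝ)))) := by
    refine integral_Ioi_of_hasDerivAt_of_tendsto
      (f := fun t : ℝ => (t : ℂ) ^ z * Complex.exp (-(W a v * t))) ?_ ?_ ?_ ?_
    · apply ContinuousAt.continuousWithinAt
      apply ContinuousAt.mul _ (by fun_prop)
      exact Complex.continuousAt_ofReal_cpow_const 0 z (Or.inl hz)
    · intro t ht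
      have ho : HasDerivAt (fun t : ℝ => (t : ℂ)) 1 t := by
        simpa using (hasDerivAt_id t).ofReal_comp
      have h2 := (HasDerivAt.cpow_const (c := z) (hasDerivAt_id (t : ℂ))
        (Complex.ofReal_mem_slitPlane.2 ht)).comp t ho
      have h3 := ((ho.const_mul (W a v)).neg).cexp
      refine (h2.mul h3).congr_deriv ?_
      simp only [kG, id, Pi.neg_apply, Function.comp]
      rw [add_sub_cancel_right]
      ring
    · exact ((kG_int ha hz v).const_mul z).sub ((kG_int ha hz1 v).const_mul _)
    · rw [tendsto_zero_iff_norm_tendsto_zero]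
      refine (tendsto_rpow_mul_exp_neg_mul_atTop_nhds_zero z.re a ha).congr' ?_
      filter_upwards [Filter.eventually_gt_atTop 0] with t ht
      have := norm_kG (z + 1) a v ht
      rw [kG, add_sub_cancel_right] at this
      rw [this]; simp
  rw [integral_sub ((kG_int ha hz v).const_mul z) ((kG_int ha hz1 v).const_mul _),
    integral_const_mul, integral_const_mul, Complex.ofReal_zero,
    Complex.zero_cpow (by rintro rfl; simp at hz)] at h1
  rw [zero_mul, sub_zero, sub_eq_zero] at h1
  exact h1.symm

lemma gammaW {a : ℝ} (ha : 0 < a) {z : ℂ} (hz : 0 < z.re) (v : ℝ) :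
    ∫ t in Set.Ioi 0, kG z a v t = Complex.Gamma z * W a v ^ (-z) := by
  have hz1 : 0 < (z + 1).re := by simp; linarith
  have hd : ∀ v, HasDerivAt (fun v => ∫ t in Set.Ioi 0, kG z a v t)
      (∫ t in Set.Ioi 0, -Complex.I * kG (z + 1) a v t) v := by
    intro v
    refine (hasDerivAt_integral_of_dominated_loc_of_deriv_le
      (F := fun v t => kG z a v t) (F' := fun v t => -Complex.I * kG (z + 1) a v t)
      (bound := fun t : ℝ => t ^ ((z + 1).re - 1) * Real.exp (-(a * t))) (s := Set.univ)
      Filter.univ_mem ?_ (kG_int ha hz v) ?_ ?_ (real_int ha hz1) ?_).2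
    · exact Filter.Eventually.of_forall fun v => (kG_int ha hz v).aestronglyMeasurable
    · exact ((kG_int ha hz1 v).const_mul _).aestronglyMeasurable
    · refine (ae_restrict_iff' measurableSet_Ioi).2 (Filter.Eventually.of_forall fun t ht v _ => ?_)
      rw [norm_mul, norm_kG _ a v ht]; simp
    · refine (ae_restrict_iff' measurableSet_Ioi).2 (Filter.Eventually.of_forall fun t ht v _ => ?_)
      have ht0 : (t : ℂ) ≠ 0 := by exact_mod_cast (ne_of_gt ht)
      have h1 := ((((W_deriv a v).mul_const (t : ℂ)).neg).cexp).const_mul ((t : ℂ) ^ (z - 1))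
      refine h1.congr_deriv ?_
      simp only [kG, Pi.neg_apply]
      rw [add_sub_cancel_right]
      rw [Complex.cpow_sub _ _ ht0, Complex.cpow_one]
      field_simp
  have hd2 : ∀ v, HasDerivAt (fun v => W a v ^ z * ∫ t in Set.Ioi 0, kG z a v t) 0 v := by
    intro v
    refine ((W_cpow_deriv ha z v).mul (hd v)).congr_deriv ?_
    rw [integral_const_mul, Complex.cpow_sub _ _ (W_ne ha v), Complex.cpow_one]
    have hp := kG_parts ha hz v
    have hw := W_ne ha v
    field_simp
    linear_combination (-(W a v ^ z * Complex.I)) * hp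
  have hc := is_const_of_deriv_eq_zero (fun v => (hd2 v).differentiableAt) (fun v => (hd2 v).deriv) v 0
  have h0 : ∫ t in Set.Ioi 0, kG z a 0 t = (1 / (a : ℂ)) ^ z * Complex.Gamma z := by
    rw [← Complex.integral_cpow_mul_exp_neg_mul_Ioi hz ha]
    simp [kG, W]
  rw [h0] at hc
  have hw0 : W a 0 = (a : ℂ) := by simp [W]
  rw [hw0, one_div, Complex.inv_cpow _ _ (by rw [Complex.arg_ofReal_of_nonneg ha.le]; exact Real.pi_pos.ne)] at hc
  have ha0 : (a : ℂ) ^ z ≠ 0 := by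
    rw [Complex.cpow_ne_zero_iff]; left; exact_mod_cast ha.ne'
  have hwz : W a v ^ z ≠ 0 := by
    rw [Complex.cpow_ne_zero_iff]; left; exact W_ne ha v
  rw [mul_inv_cancel_left₀ ha0] at hc
  rw [Complex.cpow_neg, ← hc]
  field_simp

open FourierTransform in
lemma laplace_inv {a : ℝ} (ha : 1 ≤ a) {q : ℂ} (hq : q.re ≤ -6) :
    ∫ v, Complex.exp (W a v) * W a v ^ (q - 1) = 2 * Real.pi / Complex.Gamma (1 - q) := by
  have h0 : 0 < a := by linarith
  have hz : 0 < (1 - q).re := by simp; linarith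
  have hG : Complex.Gamma (1 - q) ≠ 0 := Complex.Gamma_ne_zero_of_re_pos hz
  set f : ℝ → ℂ := (Set.Ioi 0).indicator (kG (1 - q) a 0) with hf
  have hfi : Integrable f := (integrable_indicator_iff measurableSet_Ioi).2 (kG_int h0 hz 0)
  have hF : 𝓕 f = fun ξ => Complex.Gamma (1 - q) * W a (2 * Real.pi * ξ) ^ (q - 1) := by
    ext ξ
    rw [Real.fourier_real_eq_integral_exp_smul]
    have : ∀ x : ℝ, Complex.exp (↑(-2 * Real.pi * x * ξ) * Complex.I) • f x =
        (Set.Ioi 0).indicator (kG (1 - q) a (2 * Real.pi * ξ)) x := by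
      intro x
      by_cases hx : x ∈ Set.Ioi (0 : ℝ)
      · rw [hf, Set.indicator_of_mem hx, Set.indicator_of_mem hx, kG, kG, smul_eq_mul,
          mul_left_comm, ← Complex.exp_add]
        congr 2
        simp only [W]; push_cast; ring
      · rw [hf, Set.indicator_of_notMem hx, Set.indicator_of_notMem hx, smul_zero]
    simp_rw [this]
    rw [integral_indicator measurableSet_Ioi, gammaW h0 hz, neg_sub]
  have hFi : Integrable (𝓕 f) := by
    rw [hF]
    refine Integrable.const_mul ?_ _
    have hi : Integrable (fun v => W a v ^ (q - 1)) := by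
      refine ((int_inv_sq ha).const_mul (Real.exp (Real.pi / 2 * |(q - 1).im|))).mono'
        (W_cpow_cont h0 _).aestronglyMeasurable (Filter.Eventually.of_forall fun v => ?_)
      refine (norm_W_cpow_le ha _ v).trans ?_
      rw [mul_comm]
      gcongr
      have hN := ha.trans (le_norm_W a v)
      have : (‖W a v‖ ^ 2)⁻¹ = ‖W a v‖ ^ (-2 : ℝ) := by
        rw [Real.rpow_neg (norm_nonneg _)]; norm_cast
      rw [this]
      apply Real.rpow_le_rpow_of_exponent_le hN
      simp; linarith
    exact hi.comp_mul_left' (R := 2 * Real.pi) (by positivity)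
  have hc : ContinuousAt f 1 := by
    have : kG (1 - q) a 0 =ᶠ[nhds 1] f := by
      filter_upwards [Ioi_mem_nhds (show (0 : ℝ) < 1 by norm_num)] with x hx
      rw [hf, Set.indicator_of_mem hx]
    refine ContinuousAt.congr ?_ this
    exact (kG_contOn _ _ _).continuousAt (Ioi_mem_nhds (by norm_num))
  have hinv := hfi.fourierInv_fourier_eq hFi hc
  rw [Real.fourierInv_eq', hF] at hinv
  have hf1 : f 1 = Complex.exp (-a) := by
    rw [hf, Set.indicator_of_mem (by simp), kG]; simp [W]
  rw [hf1] at hinv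
  have e : ∀ ξ : ℝ, Complex.exp (↑(2 * Real.pi * inner ℝ ξ (1 : ℝ)) * Complex.I) •
      (Complex.Gamma (1 - q) * W a (2 * Real.pi * ξ) ^ (q - 1)) =
      (Complex.exp (-a) * Complex.Gamma (1 - q)) * (fun v => Complex.exp (W a v) * W a v ^ (q - 1)) (2 * Real.pi * ξ) := by
    intro ξ
    have : Complex.exp (↑(2 * Real.pi * inner ℝ ξ (1 : ℝ)) * Complex.I) =
      Complex.exp (-a) * Complex.exp (W a (2 * Real.pi * ξ)) := by
      rw [← Complex.exp_add]; congr 1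
      simp [W]
    rw [this, smul_eq_mul]; ring
  simp_rw [e] at hinv
  rw [integral_const_mul, Measure.integral_comp_mul_left
    (fun v => Complex.exp (W a v) * W a v ^ (q - 1)) (2 * Real.pi), abs_of_pos (by positivity)] at hinv
  have he := Complex.exp_ne_zero (-(a : ℂ))
  rw [Complex.real_smul] at hinv
  rw [mul_assoc] at hinv
  have h3 := mul_left_cancel₀ he (hinv.trans (mul_one _).symm)
  push_cast at h3
  have hpi : (Real.pi : ℂ) ≠ 0 := by exact_mod_cast Real.pi_ne_zero
  field_simp at h3 ⊢
  linear_combination h3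

end FMLS
namespace FMLS

lemma E_int0 {α : ℝ} (hα : α ∈ Set.Ioc (1 : ℝ) 2) {a : ℝ} (ha : 0 < a) :
    Integrable (fun v => ‖E α a v‖) := by
  simpa using E_int hα ha 0

lemma EW_int {α : ℝ} (hα : α ∈ Set.Ioc (1 : ℝ) 2) {a : ℝ} (ha : 1 ≤ a) (s : ℂ) :
    Integrable (fun v => E α a v * W a v ^ s) := by
  have h0 : 0 < a := by linarith
  refine ((E_int hα h0 |s.re|).const_mul (Real.exp (Real.pi / 2 * |s.im|))).mono'
    ((E_cont h0 α).mul (W_cpow_cont h0 s)).aestronglyMeasurable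
    (Filter.Eventually.of_forall fun v => ?_)
  rw [norm_mul]
  calc _ ≤ ‖E α a v‖ * (Real.exp (Real.pi / 2 * |s.im|) * Real.exp (|s.re| * ‖W a v‖)) := by
        gcongr; exact norm_W_cpow_le_exp ha s v
    _ = _ := by ring

noncomputable def H (α a : ℝ) (s : ℂ) : ℂ := ∫ v, E α a v * W a v ^ (s - 1)

lemma H_base {α : ℝ} (hα : α ∈ Set.Ioc (1 : ℝ) 2) {a : ℝ} (ha : 1 ≤ a) {s : ℂ}
    (hs : s.re ≤ -12) :
    H α a s = 2 * Real.pi / α * (Complex.Gamma (1 - s / α))⁻¹ := by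
  have h0 : 0 < a := by linarith
  have hα0 : 0 < α := by linarith [hα.1]
  have hαc : (α : ℂ) ≠ 0 := by exact_mod_cast hα0.ne'
  have hq : (s / α).re ≤ -6 := by
    rw [Complex.div_ofReal_re, div_le_iff₀ hα0]; linarith [hα.2]
  have h1 := homotopy ha hq hα
  have h2 := laplace_inv ha hq
  have e1 : ∀ v, α * (W a v)⁻¹ * Phi (s / α) a α v = α * (E α a v * W a v ^ (s - 1)) := by
    intro v
    have : Complex.exp (s / α * α * L a v) = W a v ^ s := by
      rw [exp_L h0, div_mul_cancel₀ _ hαc]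
    rw [Phi, Complex.exp_add, exp_L h0, this, E, Complex.cpow_sub _ _ (W_ne h0 v), Complex.cpow_one]
    ring
  have e2 : ∀ v, ((1 : ℝ) : ℂ) * (W a v)⁻¹ * Phi (s / α) a 1 v =
      Complex.exp (W a v) * W a v ^ (s / α - 1) := by
    intro v
    rw [Phi, Complex.exp_add, exp_L h0, exp_L h0, Complex.cpow_sub _ _ (W_ne h0 v)]
    simp only [Complex.ofReal_one, Complex.cpow_one, mul_one, one_mul]
    ring
  simp_rw [e1, e2] at h1
  rw [h2, integral_const_mul] at h1
  rw [H, div_mul_eq_mul_div, eq_div_iff hαc, mul_comm, h1]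
  ring

lemma H_rec {α : ℝ} (hα : α ∈ Set.Ioc (1 : ℝ) 2) {a : ℝ} (ha : 1 ≤ a) (s : ℂ) :
    α * H α a (s + α) = -(s * H α a s) := by
  have h0 : 0 < a := by linarith
  have hi1 := (EW_int hα ha (s + α - 1)).const_mul (Complex.I * α)
  have hi2 := (EW_int hα ha (s - 1)).const_mul (Complex.I * s)
  have hd : ∀ v, HasDerivAt (fun v => E α a v * W a v ^ s)
      (Complex.I * α * (E α a v * W a v ^ (s + α - 1)) +
        Complex.I * s * (E α a v * W a v ^ (s - 1))) v := by
    intro v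
    have h1 := (W_cpow_deriv h0 (α : ℂ) v).cexp
    refine (h1.mul (W_cpow_deriv h0 s v)).congr_deriv ?_
    have : W a v ^ (s + α - 1) = W a v ^ s * W a v ^ ((α : ℂ) - 1) := by
      rw [← Complex.cpow_add _ _ (W_ne h0 v)]; congr 1; ring
    rw [this, E]
    ring
  have := integral_eq_zero_of_hasDerivAt_of_integrable hd (hi1.add hi2) (EW_int hα ha s)
  rw [integral_add hi1 hi2, integral_const_mul, integral_const_mul] at this
  have h2 : Complex.I * (α * H α a (s + α) + s * H α a s) = 0 := by
    rw [H, H]; linear_combination this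
  have h3 := (mul_eq_zero.1 h2).resolve_left Complex.I_ne_zero
  linear_combination h3

lemma H_eq {α : ℝ} (hα : α ∈ Set.Ioc (1 : ℝ) 2) {a : ℝ} (ha : 1 ≤ a) (s : ℂ) :
    H α a s = 2 * Real.pi / α * (Complex.Gamma (1 - s / α))⁻¹ := by
  have hα0 : 0 < α := by linarith [hα.1]
  have hαc : (α : ℂ) ≠ 0 := by exact_mod_cast hα0.ne'
  have key : ∀ n : ℕ, ∀ s : ℂ, s.re ≤ -12 + n →
      H α a s = 2 * Real.pi / α * (Complex.Gamma (1 - s / α))⁻¹ := by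
    intro n
    induction n with
    | zero => intro s hs; exact H_base hα ha (by simpa using hs)
    | succ n ih =>
      intro s hs
      have h1 := ih (s - α) (by
        push_cast at hs; rw [Complex.sub_re, Complex.ofReal_re]; linarith [hα.1])
      have h2 := H_rec hα ha (s - α)
      rw [sub_add_cancel, h1] at h2
      have h3 := Complex.one_div_Gamma_eq_self_mul_one_div_Gamma_add_one (1 - s / α)
      have h4 : 1 - (s - α) / α = 1 - s / α + 1 := by field_simp; ring
      rw [h4] at h2
      rw [h3]
      apply mul_left_cancel₀ hαc
      rw [h2]
      field_simp
      ring
  obtain ⟨n, hn⟩ := exists_nat_ge (s.re + 12)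
  exact key n s (by linarith)

noncomputable def h (α a X : ℝ) : ℂ := ∫ v, E α a v * Complex.exp (-(W a v * X))

lemma ae_prod_Ioi {c : ℝ} {P : ℝ × ℝ → Prop} (hP : ∀ x v, c < x → P (x, v)) :
    ∀ᵐ p ∂((volume.restrict (Set.Ioi c)).prod (volume : Measure ℝ)), P p := by
  have : ((volume.restrict (Set.Ioi c)).prod (volume : Measure ℝ)) =
      (volume.prod volume).restrict (Set.Ioi c ×ˢ Set.univ) := by
    rw [← Measure.prod_restrict, Measure.restrict_univ]
  rw [this]
  exact (ae_restrict_iff' (measurableSet_Ioi.prod MeasurableSet.univ)).2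
    (Filter.Eventually.of_forall fun p hp => hP p.1 p.2 hp.1)

lemma prod_int {α : ℝ} (hα : α ∈ Set.Ioc (1 : ℝ) 2) {a : ℝ} (ha : 1 ≤ a) {z : ℂ}
    (hz : 0 < z.re) :
    Integrable (Function.uncurry fun t v => E α a v * kG z a v t)
      ((volume.restrict (Set.Ioi 0)).prod (volume : Measure ℝ)) := by
  have h0 : 0 < a := by linarith
  have hi := Integrable.mul_prod (real_int h0 hz) (E_int0 hα h0)
  refine hi.mono' ?_ (ae_prod_Ioi fun t v ht => ?_)
  · have hm : AEStronglyMeasurable (fun t : ℝ => (t : ℂ) ^ (z - 1)) (volume.restrict (Set.Ioi 0)) :=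
      (ofReal_cpow_contOn _).aestronglyMeasurable measurableSet_Ioi
    have h1 := hm.comp_fst (ν := (volume : Measure ℝ))
    have h2 : Continuous (fun p : ℝ × ℝ => E α a p.2 * Complex.exp (-(W a p.2 * p.1))) := by
      have := E_cont h0 α
      have := W_cont a
      fun_prop
    refine (h1.mul h2.aestronglyMeasurable).congr (Filter.Eventually.of_forall fun p => ?_)
    simp only [Function.uncurry, kG, Pi.mul_apply]
    ring
  · simp only [Function.uncurry]
    rw [norm_mul, norm_kG z a v ht, mul_comm]

lemma h_mellin_conv {α : ℝ} (hα : α ∈ Set.Ioc (1 : ℝ) 2) {a : ℝ} (ha : 1 ≤ a) {z : ℂ}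
    (hz : 0 < z.re) : MellinConvergent (h α a) z := by
  have := (prod_int hα ha hz).integral_prod_left
  refine this.congr (Filter.Eventually.of_forall fun t => ?_)
  simp only [Function.uncurry, kG, h, smul_eq_mul]
  rw [← integral_const_mul]
  congr 1; ext v; ring

lemma h_mellin {α : ℝ} (hα : α ∈ Set.Ioc (1 : ℝ) 2) {a : ℝ} (ha : 1 ≤ a) {z : ℂ}
    (hz : 0 < z.re) : mellin (h α a) z = Complex.Gamma z * H α a (1 - z) := by
  have h0 : 0 < a := by linarith
  have hs := integral_integral_swap (prod_int hα ha hz)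
  have e1 : mellin (h α a) z = ∫ t in Set.Ioi 0, ∫ v, E α a v * kG z a v t := by
    rw [mellin]
    congr 1; ext t
    simp only [kG, h, smul_eq_mul]
    rw [← integral_const_mul]
    congr 1; ext v; ring
  rw [e1, hs, H, ← integral_const_mul]
  congr 1; ext v
  rw [integral_const_mul, gammaW h0 hz, sub_sub_cancel_left]
  ring

lemma mellin_bound {α : ℝ} (hα : α ∈ Set.Ioc (1 : ℝ) 2) {a : ℝ} (ha : 1 ≤ a) {x : ℝ}
    (hx : 0 < x) : ∃ C : ℝ, ∀ z : ℂ, z.re = x →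
      ‖Complex.Gamma (z + 2) * H α a (1 - z)‖ ≤ C := by
  have h0 : 0 < a := by linarith
  refine ⟨∫ v, ‖E α a v * W a v ^ (2 : ℂ)‖ *
    (∫ t in Set.Ioi 0, t ^ (x + 2 - 1) * Real.exp (-(a * t))), fun z hz => ?_⟩
  have hz2 : (z + 2).re = x + 2 := by simp [hz]
  have hz2' : 0 < (z + 2).re := by rw [hz2]; linarith
  have e : Complex.Gamma (z + 2) * H α a (1 - z) =
      ∫ v, (E α a v * W a v ^ (2 : ℂ)) * ∫ t in Set.Ioi 0, kG (z + 2) a v t := by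
    rw [H, ← integral_const_mul]
    congr 1; ext v
    rw [gammaW h0 hz2', sub_sub_cancel_left]
    have : W a v ^ (-z) = W a v ^ (2 : ℂ) * W a v ^ (-(z + 2)) := by
      rw [← Complex.cpow_add _ _ (W_ne h0 v)]; congr 1; ring
    rw [this]; ring
  rw [e]
  refine norm_integral_le_of_norm_le ((EW_int hα ha 2).norm.mul_const _)
    (Filter.Eventually.of_forall fun v => ?_)
  rw [norm_mul]
  gcongr
  refine norm_integral_le_of_norm_le (by
    have := real_int h0 hz2'; rw [hz2] at this; exact this) ?_
  refine (ae_restrict_iff' measurableSet_Ioi).2 (Filter.Eventually.of_forall fun t ht => ?_)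
  rw [norm_kG _ a v ht, hz2]

lemma h_vert {α : ℝ} (hα : α ∈ Set.Ioc (1 : ℝ) 2) {a : ℝ} (ha : 1 ≤ a) {x : ℝ}
    (hx : x ∈ Set.Ioo (0 : ℝ) 1) : Complex.VerticalIntegrable (mellin (h α a)) x := by
  obtain ⟨C, hC⟩ := mellin_bound hα ha hx.1
  have hre : ∀ u : ℝ, ((x : ℂ) + u * Complex.I).re = x := by intro u; simp
  have hfun : (fun u : ℝ => mellin (h α a) (x + u * Complex.I)) = fun u : ℝ =>
      Complex.Gamma (x + u * Complex.I) *
        (2 * Real.pi / α * (Complex.Gamma (1 - (1 - (x + u * Complex.I)) / α))⁻¹) := by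
    ext u
    rw [h_mellin hα ha (by rw [hre]; exact hx.1), H_eq hα ha]
  refine (integrable_inv_one_add_sq.const_mul (C * (x ^ 2)⁻¹)).mono' ?_
    (Filter.Eventually.of_forall fun u => ?_)
  · rw [hfun]
    apply Continuous.aestronglyMeasurable
    apply Continuous.mul
    · rw [continuous_iff_continuousAt]
      intro u
      refine ContinuousAt.comp (f := fun u : ℝ => (x : ℂ) + u * Complex.I) (g := Complex.Gamma) ?_
        (by fun_prop)
      refine (Complex.differentiableAt_Gamma _ fun m hm => ?_).continuousAt
      have := congrArg Complex.re hm
      rw [hre] at this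
      simp at this
      have h1 := hx.1
      have : (0 : ℝ) ≤ m := Nat.cast_nonneg m
      linarith
    · refine continuous_const.mul ?_
      exact Complex.differentiable_one_div_Gamma.continuous.comp
        (f := fun u : ℝ => 1 - (1 - ((x : ℂ) + u * Complex.I)) / α) (by fun_prop)
  · set z : ℂ := (x : ℂ) + u * Complex.I with hz
    have hzre : z.re = x := hre u
    have hz0 : z ≠ 0 := by intro h; rw [h] at hzre; simp at hzre; linarith [hx.1]
    have hz1 : z + 1 ≠ 0 := by
      intro h; have := congrArg Complex.re h; simp [hzre] at this; linarith [hx.1]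
    have hb := hC z hzre
    have hG : Complex.Gamma (z + 2) = (z + 1) * (z * Complex.Gamma z) := by
      rw [← Complex.Gamma_add_one z hz0, ← Complex.Gamma_add_one _ hz1]; ring_nf
    rw [h_mellin hα ha (by rw [hzre]; exact hx.1)]
    rw [hG] at hb
    have e : (z + 1) * (z * Complex.Gamma z) * H α a (1 - z) =
      ((z + 1) * z) * (Complex.Gamma z * H α a (1 - z)) := by ring
    rw [e, norm_mul] at hb
    have hn : x ^ 2 * (1 + u ^ 2) ≤ ‖(z + 1) * z‖ := by
      have h1 : ‖z‖ ≤ ‖z + 1‖ := by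
        rw [← sq_le_sq₀ (norm_nonneg _) (norm_nonneg _), Complex.sq_norm, Complex.sq_norm,
          Complex.normSq_apply, Complex.normSq_apply]
        simp [hzre]; nlinarith [hx.1]
      have h2 : ‖z‖ ^ 2 = x ^ 2 + u ^ 2 := by
        rw [Complex.sq_norm, Complex.normSq_apply, hzre, hz]; simp; ring
      rw [norm_mul]
      calc x ^ 2 * (1 + u ^ 2) ≤ x ^ 2 + u ^ 2 := by nlinarith [hx.1, hx.2, sq_nonneg u, mul_nonneg (sq_nonneg u) (show 0 ≤ 1 - x ^ 2 by nlinarith [hx.1, hx.2])]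
        _ = ‖z‖ * ‖z‖ := by rw [← h2]; ring
        _ ≤ _ := by gcongr
    have hxp := hx.1
    have hb2 : x ^ 2 * (1 + u ^ 2) * ‖Complex.Gamma z * H α a (1 - z)‖ ≤ C :=
      le_trans (by gcongr) hb
    have : C * (x ^ 2)⁻¹ * (1 + u ^ 2)⁻¹ = C / (x ^ 2 * (1 + u ^ 2)) := by
      field_simp
    rw [this, le_div_iff₀ (by positivity)]
    linarith

lemma h_cont {α : ℝ} (hα : α ∈ Set.Ioc (1 : ℝ) 2) {a : ℝ} (ha : 1 ≤ a) {X : ℝ}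
    (hX : 0 < X) : ContinuousAt (h α a) X := by
  have h0 : 0 < a := by linarith
  refine continuousAt_of_dominated (F := fun X v => E α a v * Complex.exp (-(W a v * (X : ℝ))))
    (bound := fun v => ‖E α a v‖) ?_ ?_ (E_int0 hα h0) ?_
  · refine Filter.Eventually.of_forall fun x => Continuous.aestronglyMeasurable ?_
    have := E_cont h0 α
    have := W_cont a
    fun_prop
  · filter_upwards [Ioi_mem_nhds hX] with x hx
    refine Filter.Eventually.of_forall fun v => ?_
    rw [norm_mul, Complex.norm_exp]
    refine mul_le_of_le_one_right (norm_nonneg _) (Real.exp_le_one_iff.2 ?_)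
    simp [W_re]
    exact (mul_pos h0 hx).le
  · refine Filter.Eventually.of_forall fun v => ?_
    fun_prop

lemma g_form {α : ℝ} (hα : α ∈ Set.Ioc (1 : ℝ) 2) {a : ℝ} (ha : 1 ≤ a) {c : ℝ}
    (hc : c ∈ Set.Ioo (0 : ℝ) 1) {X : ℝ} (hX : 0 < X) :
    (1 / (α : ℂ)) * (1 / (2 * (Real.pi : ℂ))) *
        ∫ u : ℝ, Complex.Gamma (1 - ((c : ℂ) + u * Complex.I)) /
                Complex.Gamma (1 - ((c : ℂ) + u * Complex.I) / (α : ℂ)) *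
              (X : ℂ) ^ (((c : ℂ) + u * Complex.I) - 1) =
      1 / (2 * (Real.pi : ℂ)) * h α a X := by
  have hα0 : 0 < α := by linarith [hα.1]
  have hαc : (α : ℂ) ≠ 0 := by exact_mod_cast hα0.ne'
  have hpi : (Real.pi : ℂ) ≠ 0 := by exact_mod_cast Real.pi_ne_zero
  have hc' : 1 - c ∈ Set.Ioo (0 : ℝ) 1 := ⟨by linarith [hc.2], by linarith [hc.1]⟩
  have hinv := mellinInv_mellin_eq (1 - c) (h α a) hX
    (h_mellin_conv hα ha (by simpa using hc'.1)) (h_vert hα ha hc') (h_cont hα ha hX)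
  rw [← hinv, mellinInv, ← integral_neg_eq_self, ← integral_const_mul, Complex.real_smul,
    ← integral_const_mul, ← integral_const_mul]
  congr 1; ext u
  have e1 : ((1 - c : ℝ) : ℂ) + (u : ℂ) * Complex.I =
      1 - ((c : ℂ) + ((-u : ℝ) : ℂ) * Complex.I) := by
    push_cast; ring
  rw [e1, h_mellin hα ha (by simpa using hc.2), H_eq hα ha, sub_sub_cancel, neg_sub, smul_eq_mul]
  push_cast
  field_simp

end FMLS
namespace FMLS

lemma kint {α : ℝ} (hα : α ∈ Set.Ioc (1 : ℝ) 2) {a T l : ℝ} (ha : 1 ≤ a) (hT : 0 < T)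
    (haT : T < a) (hl : 0 < l) :
    Integrable (Function.uncurry fun (y v : ℝ) => ((Real.exp (y - l) - 1 : ℝ) : ℂ) *
      (E α a v * Complex.exp (-(W a v * ((y / T : ℝ) : ℂ)))))
      ((volume.restrict (Set.Ioi l)).prod (volume : Measure ℝ)) := by
  have h0 : 0 < a := by linarith
  have hneg : 1 - a / T < 0 := by
    have : 1 < a / T := by rwa [lt_div_iff₀ hT, one_mul]
    linarith
  have hi := Integrable.mul_prod (integrableOn_exp_mul_Ioi hneg l) (E_int0 hα h0)
  refine hi.mono' ?_ (ae_prod_Ioi fun y v hy => ?_)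
  · have := E_cont h0 α
    have := W_cont a
    apply Continuous.aestronglyMeasurable
    change Continuous (fun p : ℝ × ℝ => ((Real.exp (p.1 - l) - 1 : ℝ) : ℂ) *
      (E α a p.2 * Complex.exp (-(W a p.2 * ((p.1 / T : ℝ) : ℂ)))))
    fun_prop
  · simp only [Function.uncurry]
    have h1 : 0 ≤ Real.exp (y - l) - 1 := by
      have := Real.one_le_exp (show 0 ≤ y - l by linarith)
      linarith
    have h2 : Real.exp (y - l) - 1 ≤ Real.exp y := by
      have := Real.exp_le_exp.2 (show y - l ≤ y by linarith)
      linarith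
    rw [norm_mul, norm_mul, Complex.norm_exp, Complex.norm_real, Real.norm_of_nonneg h1]
    have h3 : (-(W a v * ((y / T : ℝ) : ℂ))).re = -(a * (y / T)) := by
      rw [Complex.neg_re, Complex.re_mul_ofReal, W_re]
    rw [h3]
    calc _ ≤ Real.exp y * (‖E α a v‖ * Real.exp (-(a * (y / T)))) := by gcongr
      _ = (Real.exp y * Real.exp (-(a * (y / T)))) * ‖E α a v‖ := by ring
      _ = _ := by
        rw [← Real.exp_add]; congr 2; ring

lemma inner_int {T l : ℝ} (hT : 0 < T) {w : ℂ} (hw : T < w.re) :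
    ∫ y in Set.Ioi l, ((Real.exp (y - l) - 1 : ℝ) : ℂ) *
      Complex.exp (-(w * ((y / T : ℝ) : ℂ))) =
    Complex.exp (-(w * ((l / T : ℝ) : ℂ))) * ((T : ℂ) ^ 2 / (w * (w - T))) := by
  have hTc : (T : ℂ) ≠ 0 := by exact_mod_cast hT.ne'
  have hw0 : w ≠ 0 := by rintro rfl; simp at hw; linarith
  have hwT : w - T ≠ 0 := by
    intro h; have := congrArg Complex.re h; simp at this; linarith
  have r1 : (1 - w / T).re < 0 := by
    rw [Complex.sub_re, Complex.div_ofReal_re, Complex.one_re]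
    have : 1 < w.re / T := by rwa [lt_div_iff₀ hT, one_mul]
    linarith
  have r2 : (-w / T).re < 0 := by
    rw [Complex.div_ofReal_re, Complex.neg_re]
    exact div_neg_of_neg_of_pos (by linarith) hT
  have e : ∀ y : ℝ, ((Real.exp (y - l) - 1 : ℝ) : ℂ) *
      Complex.exp (-(w * ((y / T : ℝ) : ℂ))) =
      Complex.exp (-l) * Complex.exp ((1 - w / T) * y) - Complex.exp ((-w / T) * y) := by
    intro y
    rw [← Complex.exp_add]
    push_cast
    rw [sub_mul, one_mul, ← Complex.exp_add]
    congr 2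
    · ring
    · ring
  simp_rw [e]
  rw [integral_sub ((integrableOn_exp_mul_complex_Ioi r1 l).const_mul _)
    (integrableOn_exp_mul_complex_Ioi r2 l), integral_const_mul,
    integral_exp_mul_complex_Ioi r1, integral_exp_mul_complex_Ioi r2]
  have e1 : Complex.exp ((1 - w / T) * l) = Complex.exp l * Complex.exp (-(w * ((l / T : ℝ) : ℂ))) := by
    rw [← Complex.exp_add]; congr 1; push_cast; ring
  have e2 : Complex.exp ((-w / T) * l) = Complex.exp (-(w * ((l / T : ℝ) : ℂ))) := by
    congr 1; push_cast; ring
  have e3 : Complex.exp (-(l : ℂ)) * Complex.exp l = 1 := by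
    rw [← Complex.exp_add]; simp
  have d1 : (1 - w / T) = -(w - T) / T := by field_simp; ring
  rw [e1, e2, d1]
  generalize Complex.exp (-(w * ((l / T : ℝ) : ℂ))) = Z at *
  rw [show Complex.exp (-(l : ℂ)) * (-(Complex.exp l * Z) / (-(w - T) / T)) =
    (Complex.exp (-(l : ℂ)) * Complex.exp l) * (-Z / (-(w - T) / T)) by ring, e3]
  field_simp
  ring

noncomputable def F (α a T l : ℝ) (p : ℕ × ℕ) (v : ℝ) : ℂ :=
  ((-1 : ℂ) ^ p.1 / (p.1.factorial : ℂ) * ((l / T : ℝ) : ℂ) ^ p.1 * (T : ℂ) ^ (p.2 + 1)) *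
    (E α a v * W a v ^ (((p.1 : ℂ) - ((p.2 : ℂ) + 1)) - 1))

lemma F_eq {α a T l : ℝ} (ha : 0 < a) (p : ℕ × ℕ) (v : ℝ) :
    F α a T l p v = E α a v * ((-(W a v * ((l / T : ℝ) : ℂ))) ^ p.1 / (p.1.factorial : ℂ)) *
      (((T : ℂ) / W a v) ^ (p.2 + 1) * (W a v)⁻¹) := by
  have hw := W_ne ha v
  have : W a v ^ (((p.1 : ℂ) - ((p.2 : ℂ) + 1)) - 1) =
      W a v ^ p.1 / W a v ^ (p.2 + 1) / W a v := by
    rw [Complex.cpow_sub _ _ hw, Complex.cpow_one, Complex.cpow_sub _ _ hw, Complex.cpow_natCast]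
    congr 2
    rw [← Complex.cpow_natCast]; push_cast; rfl
  rw [F, this, neg_pow (W a v * _), mul_pow, div_pow]
  ring

lemma F_norm {α a T l : ℝ} (ha : 1 ≤ a) (hT : 0 < T) (hl : 0 < l) (p : ℕ × ℕ) (v : ℝ) :
    ‖F α a T l p v‖ ≤ (‖E α a v‖ * ((l / T * ‖W a v‖) ^ p.1 / (p.1.factorial : ℝ))) *
      (T / a) ^ (p.2 + 1) := by
  have h0 : 0 < a := by linarith
  have hW := le_norm_W a v
  have hM : 0 < l / T := div_pos hl hT
  rw [F_eq h0]
  rw [norm_mul, norm_mul, norm_div, norm_pow, norm_neg, norm_mul, norm_mul, norm_pow, norm_div,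
    norm_inv, Complex.norm_real, Complex.norm_real, Real.norm_of_nonneg hM.le,
    Real.norm_of_nonneg hT.le, Complex.norm_natCast, mul_comm ‖W a v‖ (l / T)]
  gcongr
  calc _ ≤ (T / ‖W a v‖) ^ (p.2 + 1) * 1 := by
        gcongr
        exact inv_le_one_of_one_le₀ (by linarith)
    _ ≤ _ := by rw [mul_one]; gcongr

lemma F_hasSum {α a T l : ℝ} (hT : 0 < T) (haT : T < a) (v : ℝ) :
    HasSum (fun p => F α a T l p v) (E α a v * Complex.exp (-(W a v * ((l / T : ℝ) : ℂ))) *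
      ((T : ℂ) / (W a v * (W a v - T)))) := by
  have h0 : 0 < a := by linarith
  have hw := W_ne h0 v
  have hW := le_norm_W a v
  have hwT : W a v - T ≠ 0 := by
    intro h; have := congrArg Complex.re h; simp [W_re] at this; linarith
  set x := -(W a v * ((l / T : ℝ) : ℂ)) with hx
  have hq : ‖(T : ℂ) / W a v‖ < 1 := by
    rw [norm_div, Complex.norm_real, Real.norm_of_nonneg hT.le, div_lt_one (by linarith)]
    linarith
  have s1 : HasSum (fun n : ℕ => E α a v * (x ^ n / (n.factorial : ℂ))) (E α a v * Complex.exp x) := by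
    rw [Complex.exp_eq_exp_ℂ]
    exact (NormedSpace.expSeries_div_hasSum_exp x).mul_left _
  have n1 : Summable (fun n : ℕ => ‖E α a v * (x ^ n / (n.factorial : ℂ))‖) := by
    simp_rw [norm_mul]
    exact (NormedSpace.norm_expSeries_div_summable x).mul_left _
  have s2 : HasSum (fun m : ℕ => ((T : ℂ) / W a v) ^ (m + 1) * (W a v)⁻¹)
      ((T : ℂ) / (W a v * (W a v - T))) := by
    have := (hasSum_geometric_of_norm_lt_one hq).mul_left ((T : ℂ) / W a v * (W a v)⁻¹)
    have h1 : 1 - (T : ℂ) / W a v ≠ 0 := by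
      rw [one_sub_div hw]; exact div_ne_zero hwT hw
    have e : (T : ℂ) / W a v * (W a v)⁻¹ * (1 - (T : ℂ) / W a v)⁻¹ =
        (T : ℂ) / (W a v * (W a v - T)) := by
      field_simp
    rw [e] at this
    have e' : (fun m : ℕ => ((T : ℂ) / W a v) ^ (m + 1) * (W a v)⁻¹) =
        fun m : ℕ => (T : ℂ) / W a v * (W a v)⁻¹ * ((T : ℂ) / W a v) ^ m := by
      ext m; rw [pow_succ]; ring
    rw [e']
    exact this
  have n2 : Summable (fun m : ℕ => ‖((T : ℂ) / W a v) ^ (m + 1) * (W a v)⁻¹‖) := s2.summable.norm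
  have n3 := summable_mul_of_summable_norm n1 n2
  have := s1.mul s2 n3
  have e : (fun p => F α a T l p v) = fun p : ℕ × ℕ => E α a v * (x ^ p.1 / (p.1.factorial : ℂ)) *
      (((T : ℂ) / W a v) ^ (p.2 + 1) * (W a v)⁻¹) := by
    ext p; exact F_eq h0 p v
  rw [e]
  exact this

lemma A_int {α : ℝ} (hα : α ∈ Set.Ioc (1 : ℝ) 2) {a M : ℝ} (ha : 1 ≤ a) (hM : 0 < M) (n : ℕ) :
    Integrable (fun v => ‖E α a v‖ * ((M * ‖W a v‖) ^ n / (n.factorial : ℝ))) := by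
  have h0 : 0 < a := by linarith
  refine (E_int hα h0 M).mono' ?_ (Filter.Eventually.of_forall fun v => ?_)
  · have := E_cont h0 α
    have := W_cont a
    apply Continuous.aestronglyMeasurable
    fun_prop
  · rw [Real.norm_of_nonneg (by positivity)]
    gcongr
    exact Real.pow_div_factorial_le_exp _ (by positivity) n

lemma A_sum {α : ℝ} (hα : α ∈ Set.Ioc (1 : ℝ) 2) {a M : ℝ} (ha : 1 ≤ a) (hM : 0 < M) :
    Summable (fun n : ℕ => ∫ v, ‖E α a v‖ * ((M * ‖W a v‖) ^ n / (n.factorial : ℝ))) := by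
  have h0 : 0 < a := by linarith
  refine summable_of_sum_range_le (c := ∫ v, ‖E α a v‖ * Real.exp (M * ‖W a v‖))
    (fun n => integral_nonneg fun v => by positivity) fun n => ?_
  rw [← integral_finsetSum _ fun i _ => A_int hα ha hM i]
  refine integral_mono (integrable_finsetSum _ fun i _ => A_int hα ha hM i) (E_int hα h0 M)
    fun v => ?_
  simp only
  rw [← Finset.mul_sum]
  gcongr
  exact Real.sum_le_exp_of_nonneg (by positivity) n

lemma F_int {α : ℝ} (hα : α ∈ Set.Ioc (1 : ℝ) 2) {a T l : ℝ} (ha : 1 ≤ a) (p : ℕ × ℕ) :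
    Integrable (F α a T l p) := (EW_int hα ha _).const_mul _

lemma F_sum {α : ℝ} (hα : α ∈ Set.Ioc (1 : ℝ) 2) {a T l : ℝ} (ha : 1 ≤ a) (hT : 0 < T)
    (haT : T < a) (hl : 0 < l) : Summable (fun p => ∫ v, ‖F α a T l p v‖) := by
  have h0 : 0 < a := by linarith
  have hM : 0 < l / T := div_pos hl hT
  have sB : Summable (fun m : ℕ => (T / a) ^ (m + 1)) :=
    (summable_nat_add_iff 1).2 (summable_geometric_of_lt_one (by positivity) ((div_lt_one h0).2 haT))
  have := (A_sum hα ha hM).mul_of_nonneg sB (fun n => integral_nonneg fun v => by positivity)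
    (fun m => by positivity)
  refine Summable.of_nonneg_of_le (fun p => integral_nonneg fun v => norm_nonneg _) (fun p => ?_) this
  rw [← integral_mul_const]
  exact integral_mono (F_int hα ha p).norm ((A_int hα ha hM p.1).mul_const _)
    fun v => F_norm ha hT hl p v

lemma F_integral {α : ℝ} (hα : α ∈ Set.Ioc (1 : ℝ) 2) {a T l : ℝ} (ha : 1 ≤ a) (p : ℕ × ℕ) :
    ∫ v, F α a T l p v =
      ((-1 : ℂ) ^ p.1 / (p.1.factorial : ℂ) * ((l / T : ℝ) : ℂ) ^ p.1 * (T : ℂ) ^ (p.2 + 1)) *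
      (2 * Real.pi / α * (Complex.Gamma (1 - ((p.1 : ℂ) - ((p.2 : ℂ) + 1)) / α))⁻¹) := by
  rw [← H_eq hα ha, H, ← integral_const_mul]
  rfl

end FMLS
open MeasureTheory

/-- Closed pricing formula for the Finite Moment Log-Stable call.
Let `α ∈ (1,2]`, `S, K, σ, τ > 0`, `r ∈ ℝ`, `μ = (σ/√2)^α / cos(πα/2)`,
`[log] = log(S/K) + rτ` with `[log] + μτ < 0`. The Green function `g` is given for
`X ≠ 0` by its Mellin–Barnes representation along the line `Re(s) = c ∈ (0,1)`
(maximal negative asymmetry `θ = α - 2`). Then the payoff-times-Green integrand is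
integrable, and the call price
`V = (e^(-rτ)/(-μτ)^(1/α)) ∫_ℝ max(S e^((r+μ)τ+y) - K, 0) g(y/(-μτ)^(1/α)) dy`
equals `(K e^(-rτ)/α) ∑_{n≥0, m≥1} ((-1)ⁿ/(n! Γ(1-(n-m)/α))) (-[log]-μτ)ⁿ (-μτ)^((m-n)/α)`,
the double series converging absolutely. -/
theorem stmt_8 (α S K r σ τ : ℝ) (hα : α ∈ Set.Ioc (1 : ℝ) 2)
    (hS : 0 < S) (hK : 0 < K) (hσ : 0 < σ) (hτ : 0 < τ)
    (μ llog : ℝ)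
    (hμ : μ = (σ / Real.sqrt 2) ^ α / Real.cos (Real.pi * α / 2))
    (hlog : llog = Real.log (S / K) + r * τ)
    (hneg : llog + μ * τ < 0)
    (c : ℝ) (hc : c ∈ Set.Ioo (0 : ℝ) 1)
    (g : ℝ → ℂ)
    (hg : ∀ X : ℝ, X ≠ 0 →
      g X = (1 / (α : ℂ)) * (1 / (2 * (Real.pi : ℂ))) *
        ∫ u : ℝ,
          (if 0 < X then
            Complex.Gamma (1 - ((c : ℂ) + u * Complex.I)) /
                Complex.Gamma (1 - ((c : ℂ) + u * Complex.I) / (α : ℂ)) *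
              (X : ℂ) ^ (((c : ℂ) + u * Complex.I) - 1)
          else
            Complex.Gamma (((c : ℂ) + u * Complex.I) / (α : ℂ)) *
                Complex.Gamma (1 - ((c : ℂ) + u * Complex.I)) /
                (Complex.Gamma ((((α : ℂ) - 1) / (α : ℂ)) * ((c : ℂ) + u * Complex.I)) *
                  Complex.Gamma (1 - (((α : ℂ) - 1) / (α : ℂ)) * ((c : ℂ) + u * Complex.I))) *
              ((|X| : ℝ) : ℂ) ^ (((c : ℂ) + u * Complex.I) - 1))) :
    Integrable (fun y : ℝ =>
      ((max (S * Real.exp ((r + μ) * τ + y) - K) 0 : ℝ) : ℂ) *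
        g (y / (-(μ * τ)) ^ (1 / α))) ∧
    Summable (fun p : ℕ × ℕ =>
      ‖((-1 : ℂ) ^ p.1 /
          ((p.1.factorial : ℂ) *
            Complex.Gamma (1 - ((p.1 : ℂ) - ((p.2 : ℂ) + 1)) / (α : ℂ)))) *
        ((-(llog + μ * τ) : ℝ) : ℂ) ^ p.1 *
        ((-(μ * τ) : ℝ) : ℂ) ^ ((((p.2 : ℂ) + 1) - (p.1 : ℂ)) / (α : ℂ))‖) ∧
    ((Real.exp (-(r * τ)) / (-(μ * τ)) ^ (1 / α) : ℝ) : ℂ) *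
        ∫ y : ℝ, ((max (S * Real.exp ((r + μ) * τ + y) - K) 0 : ℝ) : ℂ) *
          g (y / (-(μ * τ)) ^ (1 / α)) =
      ((K * Real.exp (-(r * τ)) / α : ℝ) : ℂ) *
        ∑' p : ℕ × ℕ,
          ((-1 : ℂ) ^ p.1 /
              ((p.1.factorial : ℂ) *
                Complex.Gamma (1 - ((p.1 : ℂ) - ((p.2 : ℂ) + 1)) / (α : ℂ)))) *
            ((-(llog + μ * τ) : ℝ) : ℂ) ^ p.1 *
            ((-(μ * τ) : ℝ) : ℂ) ^ ((((p.2 : ℂ) + 1) - (p.1 : ℂ)) / (α : ℂ)) := by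
  classical
  have hα0 : 0 < α := by linarith [hα.1]
  have hαc : (α : ℂ) ≠ 0 := by exact_mod_cast hα0.ne'
  have hpi : (Real.pi : ℂ) ≠ 0 := by exact_mod_cast Real.pi_ne_zero
  have hμ0 : μ < 0 := by
    rw [hμ]
    exact div_neg_of_pos_of_neg (by positivity) (FMLS.cos_neg_of hα)
  have hb : 0 < -(μ * τ) := by
    have := mul_neg_of_neg_of_pos hμ0 hτ
    linarith
  have hl : 0 < -(llog + μ * τ) := by linarith
  have hT : 0 < (-(μ * τ)) ^ (1 / α) := Real.rpow_pos_of_pos hb _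
  have hpow : ∀ p : ℕ × ℕ, ((-(μ * τ) : ℝ) : ℂ) ^ ((((p.2 : ℂ) + 1) - (p.1 : ℂ)) / (α : ℂ)) =
      (((-(μ * τ)) ^ (1 / α) : ℝ) : ℂ) ^ (p.2 + 1) / (((-(μ * τ)) ^ (1 / α) : ℝ) : ℂ) ^ p.1 := by
    intro p
    have hbc : ((-(μ * τ) : ℝ) : ℂ) ≠ 0 := by exact_mod_cast hb.ne'
    rw [Complex.ofReal_cpow hb.le, ← Complex.cpow_nat_mul, ← Complex.cpow_nat_mul,
      ← Complex.cpow_sub _ _ hbc]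
    congr 1
    push_cast
    field_simp
  have hpay : ∀ y : ℝ, S * Real.exp ((r + μ) * τ + y) = K * Real.exp (y - -(llog + μ * τ)) := by
    intro y
    have : y - -(llog + μ * τ) = Real.log (S / K) + ((r + μ) * τ + y) := by rw [hlog]; ring
    rw [this, Real.exp_add (Real.log (S / K)), Real.exp_log (by positivity)]
    field_simp
  generalize hTd : (-(μ * τ)) ^ (1 / α) = T at *
  generalize hld : -(llog + μ * τ) = l at *
  set a := T + 1 with had
  have ha : 1 ≤ a := by linarith
  have h0 : 0 < a := by linarith
  have haT : T < a := by linarith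
  have hTc : (T : ℂ) ≠ 0 := by exact_mod_cast hT.ne'
  have hint : (fun y : ℝ => ((max (S * Real.exp ((r + μ) * τ + y) - K) 0 : ℝ) : ℂ) * g (y / T)) =
      (Set.Ioi l).indicator (fun y => (K / (2 * Real.pi) : ℂ) *
        ∫ v, ((Real.exp (y - l) - 1 : ℝ) : ℂ) *
          (FMLS.E α a v * Complex.exp (-(FMLS.W a v * ((y / T : ℝ) : ℂ))))) := by
    ext y
    rw [hpay]
    by_cases hy : l < y
    · rw [Set.indicator_of_mem (Set.mem_Ioi.2 hy)]
      have hX : 0 < y / T := div_pos (by linarith) hT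
      have h1 := Real.one_le_exp (show 0 ≤ y - l by linarith)
      rw [hg _ hX.ne']
      simp only [if_pos hX]
      rw [FMLS.g_form hα ha hc hX, FMLS.h, integral_const_mul,
        max_eq_left (by nlinarith)]
      push_cast
      field_simp
    · rw [Set.indicator_of_notMem (by simpa using hy)]
      have h1 := Real.exp_le_one_iff.2 (show y - l ≤ 0 by linarith)
      rw [max_eq_right (by nlinarith)]
      simp
  have hk := FMLS.kint hα ha hT haT hl
  have hsum := FMLS.F_sum hα ha hT haT hl
  have hterm : ∀ p : ℕ × ℕ, ((-1 : ℂ) ^ p.1 /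
          ((p.1.factorial : ℂ) *
            Complex.Gamma (1 - ((p.1 : ℂ) - ((p.2 : ℂ) + 1)) / (α : ℂ)))) *
        ((l : ℝ) : ℂ) ^ p.1 *
        ((-(μ * τ) : ℝ) : ℂ) ^ ((((p.2 : ℂ) + 1) - (p.1 : ℂ)) / (α : ℂ)) =
      α / (2 * Real.pi) * ∫ v, FMLS.F α a T l p v := by
    intro p
    rw [hpow, FMLS.F_integral hα ha]
    push_cast
    rw [div_pow, div_eq_mul_inv _ ((p.1.factorial : ℂ) * _), mul_inv]
    generalize (Complex.Gamma (1 - ((p.1 : ℂ) - ((p.2 : ℂ) + 1)) / (α : ℂ)))⁻¹ = G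
    field_simp
  refine ⟨?_, ?_, ?_⟩
  · rw [hint, integrable_indicator_iff measurableSet_Ioi]
    exact hk.integral_prod_left.const_mul _
  · simp_rw [hterm, norm_mul]
    refine Summable.mul_left _ ?_
    exact Summable.of_nonneg_of_le (fun p => norm_nonneg _)
      (fun p => norm_integral_le_integral_norm _) hsum
  · simp_rw [hterm]
    rw [tsum_mul_left]
    have hs := hasSum_integral_of_summable_integral_norm (fun p => FMLS.F_int hα ha p) hsum
    have e1 : ∀ v, ∑' p, FMLS.F α a T l p v = _ := fun v => (FMLS.F_hasSum hT haT v).tsum_eq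
    simp_rw [e1] at hs
    rw [hs.tsum_eq, hint, integral_indicator measurableSet_Ioi, integral_const_mul,
      integral_integral_swap hk]
    have e2 : ∀ v, ∫ y in Set.Ioi l, ((Real.exp (y - l) - 1 : ℝ) : ℂ) *
          (FMLS.E α a v * Complex.exp (-(FMLS.W a v * ((y / T : ℝ) : ℂ)))) =
        T * (FMLS.E α a v * Complex.exp (-(FMLS.W a v * ((l / T : ℝ) : ℂ))) *
          ((T : ℂ) / (FMLS.W a v * (FMLS.W a v - T)))) := by
      intro v
      have := FMLS.inner_int (l := l) hT (w := FMLS.W a v) (by rw [FMLS.W_re]; exact haT)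
      simp_rw [mul_left_comm _ (FMLS.E α a v)]
      rw [integral_const_mul, this]
      ring
    simp_rw [e2]
    rw [integral_const_mul]
    generalize (∫ v, FMLS.E α a v * Complex.exp (-(FMLS.W a v * ((l / T : ℝ) : ℂ))) *
          ((T : ℂ) / (FMLS.W a v * (FMLS.W a v - T)))) = J
    push_cast
    field_simp
end

section
/- Let S, K, σ, τ > 0 and r ∈ ℝ, set [log] := log(S/K) + rτ, and assume [log] < σ²τ/2. Then (K e^{−rτ}/2) · ∑_{n≥0, m≥1} ((−1)ⁿ / (n! · Γ(1 − (n − m)/2))) · (σ²τ/2 − [log])ⁿ · (σ²τ/2)^{(m−n)/2} = S · Φ([log]/(σ√τ) + σ√τ/2) − K e^{−rτ} · Φ([log]/(σ√τ) − σ√τ/2); i.e. for α = 2 (where μ = −σ²/2) the double-series pricing formula recovers the Black–Scholes call price. -/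
open MeasureTheory

/-- The standard normal cumulative distribution function
`Φ(x) = (2π)^(-1/2) ∫_{-∞}^x e^(-t²/2) dt`. -/
noncomputable def stdNormalCDF (x : ℝ) : ℝ :=
  (Real.sqrt (2 * Real.pi))⁻¹ * ∫ t in Set.Iic x, Real.exp (-(t ^ 2) / 2)


open Filter Topology

/-- `R k = 1/Γ(1+k/2)`. -/
noncomputable def Rg (k : ℤ) : ℝ := (Real.Gamma (1 + (k : ℝ) / 2))⁻¹

lemma Rg_rec (k : ℤ) : Rg (k - 2) = (k : ℝ) / 2 * Rg k := by
  unfold Rg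
  have e : (1 + ((k - 2 : ℤ) : ℝ) / 2) = (k : ℝ) / 2 := by push_cast; ring
  rw [e]
  by_cases hk : (k : ℝ) / 2 = 0
  · rw [hk]; simp [Real.Gamma_zero]
  · rw [add_comm 1, Real.Gamma_add_one hk, mul_inv, ← mul_assoc, mul_inv_cancel₀ hk, one_mul]

lemma Rg_zero : Rg 0 = 1 := by simp [Rg]

lemma Rg_neg_one : Rg (-1) = (√Real.pi)⁻¹ := by
  unfold Rg
  rw [← Real.Gamma_one_half_eq]; norm_num

lemma Rg_one : Rg 1 = 2 * (√Real.pi)⁻¹ := by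
  have := Rg_rec 1
  norm_num [Rg_neg_one] at this
  linarith

lemma inv_sqrt_pi_le : (√Real.pi)⁻¹ ≤ 1 := by
  apply inv_le_one_of_one_le₀
  rw [Real.one_le_sqrt]; linarith [Real.pi_gt_three]

lemma Rg_neg_bound (n : ℕ) : Rg (-(n : ℤ)) ^ 2 ≤ n.factorial ∧
    Rg (-((n + 1 : ℕ) : ℤ)) ^ 2 ≤ (n + 1).factorial := by
  induction n with
  | zero =>
    have h1 := inv_sqrt_pi_le
    have h2 : 0 ≤ (√Real.pi)⁻¹ := by positivity
    simp only [Nat.cast_zero, neg_zero, Rg_zero, zero_add, Nat.cast_one, Rg_neg_one]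
    norm_num
    have : ((√Real.pi)⁻¹) ^ 2 ≤ 1 := by nlinarith
    simpa using this
  | succ n ih =>
    refine ⟨ih.2, ?_⟩
    have e : (-((n + 1 + 1 : ℕ) : ℤ)) = -(n : ℤ) - 2 := by push_cast; ring
    rw [e, Rg_rec, mul_pow, Nat.factorial_succ, Nat.factorial_succ]
    push_cast
    have h0 : (0:ℝ) ≤ n.factorial := by positivity
    have hn : (0:ℝ) ≤ n := by positivity
    calc (-(n:ℝ) / 2) ^ 2 * Rg (-(n:ℤ)) ^ 2 ≤ (-(n:ℝ) / 2) ^ 2 * n.factorial := by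
          gcongr; exact ih.1
      _ ≤ ((n:ℝ) + 1 + 1) * ((n + 1) * n.factorial) := by
          rw [← mul_assoc]; gcongr; nlinarith

lemma Rg_pos_bound (n : ℕ) : Rg (n : ℤ) ^ 2 ≤ 4 * 4 ^ n / n.factorial ∧
    Rg ((n + 1 : ℕ) : ℤ) ^ 2 ≤ 4 * 4 ^ (n + 1) / (n + 1).factorial := by
  induction n with
  | zero =>
    have h1 := inv_sqrt_pi_le
    have h2 : 0 ≤ (√Real.pi)⁻¹ := by positivity
    simp only [Nat.cast_zero, Rg_zero, zero_add, Nat.cast_one, Rg_one, Nat.factorial]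
    norm_num
    have : ((√Real.pi)⁻¹) ^ 2 ≤ 1 := by nlinarith
    have h3 : (2 * (√Real.pi)⁻¹) ^ 2 ≤ 16 := by nlinarith
    simpa using h3
  | succ n ih =>
    refine ⟨ih.2, ?_⟩
    have e := Rg_rec ((n + 1 + 1 : ℕ) : ℤ)
    have e2 : (((n + 1 + 1 : ℕ) : ℤ) - 2) = n := by push_cast; ring
    rw [e2] at e
    push_cast at e
    have hn : (0:ℝ) ≤ n := by positivity
    have e3 : Rg ((n + 1 + 1 : ℕ) : ℤ) = 2 / ((n:ℝ) + 1 + 1) * Rg n := by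
      rw [e]; push_cast; field_simp
    have h0 : (0:ℝ) < n.factorial := by positivity
    rw [e3, mul_pow, Nat.factorial_succ, Nat.factorial_succ]
    push_cast
    calc (2 / ((n:ℝ) + 1 + 1)) ^ 2 * Rg (n:ℤ) ^ 2
        ≤ (2 / ((n:ℝ) + 1 + 1)) ^ 2 * (4 * 4 ^ n / n.factorial) := by
          gcongr; exact ih.1
      _ ≤ _ := by
          rw [div_pow, div_mul_div_comm, div_le_div_iff₀ (by positivity) (by positivity)]
          have : (0:ℝ) < 4 ^ n * n.factorial := by positivity
          ring_nf
          nlinarith [mul_nonneg this.le hn, mul_nonneg (mul_nonneg this.le hn) hn]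

lemma Rg_neg_abs (n : ℕ) : |Rg (-(n : ℤ))| ≤ √(n.factorial) := by
  rw [← Real.sqrt_sq_eq_abs]; exact Real.sqrt_le_sqrt (Rg_neg_bound n).1

lemma Rg_pos_abs (n : ℕ) : |Rg (n : ℤ)| ≤ 2 * (2 ^ n / √(n.factorial)) := by
  rw [← Real.sqrt_sq_eq_abs]
  refine (Real.sqrt_le_sqrt (Rg_pos_bound n).1).trans (le_of_eq ?_)
  have : (4 * 4 ^ n : ℝ) = (2 * 2 ^ n) ^ 2 := by rw [mul_pow, ← pow_mul, mul_comm n, pow_mul]; norm_num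
  rw [Real.sqrt_div (by positivity), this, Real.sqrt_sq (by positivity), mul_div_assoc]

lemma summable_sqrt (a : ℝ) (ha : 0 ≤ a) : Summable fun n : ℕ => a ^ n / √(n.factorial) := by
  rcases ha.eq_or_lt with rfl | ha
  · refine summable_of_ne_finset_zero (s := {0}) ?_
    intro n hn
    simp at hn
    simp [hn]
  refine summable_of_ratio_test_tendsto_lt_one (l := 0) one_pos
    (Eventually.of_forall fun n => by positivity) ?_
  have h : Tendsto (fun n : ℕ => a / √((n : ℝ) + 1)) atTop (𝓝 0) := by
    refine Tendsto.div_atTop tendsto_const_nhds ?_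
    exact Real.tendsto_sqrt_atTop.comp (tendsto_atTop_add_const_right _ _ tendsto_natCast_atTop_atTop)
  refine h.congr fun n => ?_
  have h0 : (0:ℝ) < n.factorial := by positivity
  rw [Real.norm_of_nonneg (by positivity), Real.norm_of_nonneg (by positivity), Nat.factorial_succ]
  push_cast
  rw [Real.sqrt_mul (by positivity)]
  field_simp
  ring

/-- termwise derivative of an exponential-type series -/
lemma hasDerivAt_egf (c : ℕ → ℝ) (h0 : ∀ R : ℝ, 0 ≤ R → Summable fun n => |c n| * (R ^ n / n.factorial))
    (h1 : ∀ R : ℝ, 0 ≤ R → Summable fun n => |c (n + 1)| * (R ^ n / n.factorial)) (x : ℝ) :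
    HasDerivAt (fun x => ∑' n, c n * (x ^ n / n.factorial))
      (∑' n, c (n + 1) * (x ^ n / n.factorial)) x := by
  have key : ∀ n : ℕ, ∀ y : ℝ, ((n + 1 : ℕ) : ℝ) * y ^ n / (n + 1).factorial = y ^ n / n.factorial := by
    intro n y
    rw [Nat.factorial_succ]; push_cast
    have : (0:ℝ) < n.factorial := by positivity
    field_simp
  set R := |x| + 1 with hR
  have hR0 : 0 ≤ R := by positivity
  have hs : ∀ y : ℝ, Summable fun n => c n * (y ^ n / n.factorial) := by
    intro y
    refine Summable.of_norm ((h0 |y| (abs_nonneg _)).congr fun n => ?_)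
    rw [Real.norm_eq_abs, abs_mul, abs_div, abs_pow, Nat.abs_cast]
  have hs' : ∀ y : ℝ, Summable fun n => c (n + 1) * (y ^ n / n.factorial) := by
    intro y
    refine Summable.of_norm ((h1 |y| (abs_nonneg _)).congr fun n => ?_)
    rw [Real.norm_eq_abs, abs_mul, abs_div, abs_pow, Nat.abs_cast]
  have hu : Summable fun n : ℕ => |c n| * ((n : ℝ) * R ^ (n - 1) / n.factorial) := by
    rw [← summable_nat_add_iff 1]
    refine (h1 R hR0).congr fun n => ?_
    rw [Nat.add_sub_cancel, key]
  have hd := hasDerivAt_tsum_of_isPreconnected (𝕜 := ℝ) (F := ℝ) hu (t := Metric.ball 0 R)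
    Metric.isOpen_ball (convex_ball _ _).isPreconnected
    (g := fun n y => c n * (y ^ n / n.factorial))
    (g' := fun n y => c n * ((n : ℝ) * y ^ (n - 1) / n.factorial)) (y₀ := x) (y := x)
    (fun n y _ => ((hasDerivAt_pow n y).div_const _).const_mul _)
    (fun n y hy => by
      have hy' : |y| ≤ R := by
        have : |y| < R := by simpa using hy
        exact this.le
      rw [Real.norm_eq_abs, abs_mul, abs_div, abs_mul, abs_pow, Nat.abs_cast, Nat.abs_cast]
      gcongr)
    (by simp [hR]) (hs x) (by simp [hR])
  have hss : Summable fun n : ℕ => c n * ((n : ℝ) * x ^ (n - 1) / n.factorial) := by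
    rw [← summable_nat_add_iff 1]
    refine (hs' x).congr fun n => ?_
    rw [Nat.add_sub_cancel, key]
  rw [hss.tsum_eq_zero_add] at hd
  simp only [Nat.add_sub_cancel, key] at hd
  simpa using hd

lemma gauss_int : Integrable fun t : ℝ => Real.exp (-(t ^ 2) / 2) := by
  have := integrable_exp_neg_mul_sq (b := 1 / 2) (by norm_num)
  refine this.congr (Eventually.of_forall fun t => ?_)
  simp only; congr 1; ring

lemma hasDerivAt_cdf (x : ℝ) :
    HasDerivAt stdNormalCDF ((√(2 * Real.pi))⁻¹ * Real.exp (-(x ^ 2) / 2)) x := by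
  have hc : Continuous fun t : ℝ => Real.exp (-(t ^ 2) / 2) := by fun_prop
  have e : stdNormalCDF = fun x => (√(2 * Real.pi))⁻¹ * ((∫ t in Set.Iic 0, Real.exp (-(t ^ 2) / 2)) +
      ∫ t in (0:ℝ)..x, Real.exp (-(t ^ 2) / 2)) := by
    funext y
    rw [stdNormalCDF, ← intervalIntegral.integral_Iic_sub_Iic gauss_int.integrableOn gauss_int.integrableOn]
    ring
  rw [e]
  exact ((hc.integral_hasStrictDerivAt 0 x).hasDerivAt.const_add _).const_mul _

lemma cdf_zero : stdNormalCDF 0 = 1 / 2 := by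
  unfold stdNormalCDF
  have h := integral_comp_neg_Iic (0:ℝ) fun t : ℝ => Real.exp (-(1/2) * t ^ 2)
  rw [neg_zero, integral_gaussian_Ioi] at h
  have e : (fun t : ℝ => Real.exp (-(1/2) * (-t) ^ 2)) = fun t : ℝ => Real.exp (-(t ^ 2) / 2) := by
    funext t; congr 1; ring
  rw [e] at h
  rw [h, show Real.pi / (1/2) = 2 * Real.pi by ring]
  have : 0 < √(2 * Real.pi) := by positivity
  field_simp

/-- growth class -/
def Gr (c : ℕ → ℝ) : Prop := ∃ C E : ℝ, 0 ≤ C ∧ 0 ≤ E ∧ ∀ n : ℕ, |c n| ≤ C * E ^ n * √(n.factorial)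

lemma Gr.shift {c : ℕ → ℝ} (h : Gr c) : Gr fun n => c (n + 1) := by
  obtain ⟨C, E, hC, hE, h⟩ := h
  refine ⟨C * E, E * 2, by positivity, by positivity, fun n => (h (n + 1)).trans ?_⟩
  rw [Nat.factorial_succ]; push_cast
  rw [Real.sqrt_mul (by positivity)]
  have h2 : √((n:ℝ) + 1) ≤ 2 ^ n := by
    rw [Real.sqrt_le_left (by positivity)]
    have h3 : ((n:ℝ) + 1) ≤ 2 ^ n := by exact_mod_cast Nat.lt_two_pow_self
    have h4 : (1:ℝ) ≤ 2 ^ n := one_le_pow₀ (by norm_num)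
    nlinarith
  calc C * E ^ (n + 1) * (√((n:ℝ) + 1) * √(n.factorial))
      ≤ C * E ^ (n + 1) * (2 ^ n * √(n.factorial)) := by gcongr
    _ = _ := by rw [mul_pow]; ring

lemma Gr.summable {c : ℕ → ℝ} (h : Gr c) (R : ℝ) (hR : 0 ≤ R) :
    Summable fun n => |c n| * (R ^ n / n.factorial) := by
  obtain ⟨C, E, hC, hE, h⟩ := h
  refine Summable.of_nonneg_of_le (fun n => by positivity) (fun n => ?_)
    ((summable_sqrt (E * R) (by positivity)).mul_left C)
  have h0 : (0:ℝ) < n.factorial := by positivity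
  have h1 : 0 < √(n.factorial : ℝ) := by positivity
  calc |c n| * (R ^ n / n.factorial) ≤ (C * E ^ n * √(n.factorial)) * (R ^ n / n.factorial) := by
        gcongr; exact h n
    _ = _ := by
        nth_rw 2 [← Real.mul_self_sqrt h0.le]
        rw [mul_pow]; field_simp

lemma Gr.hasDerivAt {c : ℕ → ℝ} (h : Gr c) (x : ℝ) :
    HasDerivAt (fun x => ∑' n, c n * (x ^ n / n.factorial))
      (∑' n, c (n + 1) * (x ^ n / n.factorial)) x :=
  hasDerivAt_egf c h.summable h.shift.summable x

lemma Gr.summable' {c : ℕ → ℝ} (h : Gr c) (x : ℝ) :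
    Summable fun n => c n * (x ^ n / n.factorial) := by
  refine Summable.of_norm ((h.summable |x| (abs_nonneg _)).congr fun n => ?_)
  rw [Real.norm_eq_abs, abs_mul, abs_div, abs_pow, Nat.abs_cast]

lemma egf_zero (c : ℕ → ℝ) : ∑' n, c n * ((0:ℝ) ^ n / n.factorial) = c 0 := by
  rw [tsum_eq_single 0]
  · simp
  · intro n hn; simp [hn]

lemma Gr_Rneg : Gr fun n => Rg (-(n : ℤ)) :=
  ⟨1, 1, by norm_num, by norm_num, fun n => by simpa using Rg_neg_abs n⟩

lemma q_eq (y : ℝ) : ∑' n : ℕ, Rg (-((n + 1 : ℕ) : ℤ)) * (y ^ n / n.factorial) =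
    (√Real.pi)⁻¹ * Real.exp (-(y ^ 2) / 4) := by
  set q : ℝ → ℝ := fun y => ∑' n : ℕ, Rg (-((n + 1 : ℕ) : ℤ)) * (y ^ n / n.factorial) with hq
  have hd : ∀ y, HasDerivAt q (-(y / 2) * q y) y := by
    intro y
    have h1 := Gr_Rneg.shift.hasDerivAt y
    refine (h1).congr_deriv (Eq.symm ?_)
    have e : ∀ n : ℕ, Rg (-((n + 1 + 1 : ℕ) : ℤ)) * (y ^ n / n.factorial) =
        -(n / 2) * Rg (-(n : ℤ)) * (y ^ n / n.factorial) := by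
      intro n
      have e : (-((n + 1 + 1 : ℕ) : ℤ)) = -(n : ℤ) - 2 := by push_cast; ring
      rw [e, Rg_rec]; push_cast; ring
    have hs := Gr_Rneg.shift.shift.summable' y
    simp only [e] at hs ⊢
    rw [hs.tsum_eq_zero_add, hq]
    try beta_reduce
    rw [← tsum_mul_left]
    simp only [Nat.cast_zero, zero_div, neg_zero, zero_mul, zero_add]
    refine tsum_congr fun n => ?_
    rw [Nat.factorial_succ]; push_cast
    have : (0:ℝ) < n.factorial := by positivity
    field_simp
    ring
  have hc : ∀ y, HasDerivAt (fun y => Real.exp (y ^ 2 / 4) * q y) 0 y := by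
    intro y
    have h1 := (((hasDerivAt_pow 2 y).div_const 4).exp).mul (hd y)
    refine (h1).congr_deriv (Eq.symm ?_)
    simp; ring
  have := is_const_of_deriv_eq_zero (fun y => (hc y).differentiableAt) (fun y => (hc y).deriv) y 0
  try beta_reduce at this
  have q0 : q 0 = (√Real.pi)⁻¹ := by
    rw [hq]; try beta_reduce
    rw [egf_zero (fun n : ℕ => Rg (-((n + 1 : ℕ) : ℤ)))]
    simpa using Rg_neg_one
  rw [q0] at this
  have e2 : Real.exp (-(y ^ 2) / 4) * Real.exp (y ^ 2 / 4) = 1 := by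
    rw [← Real.exp_add]; ring_nf; simp
  have : q y = (√Real.pi)⁻¹ * Real.exp (-(y ^ 2) / 4) := by
    norm_num at this
    calc q y = Real.exp (-(y ^ 2) / 4) * Real.exp (y ^ 2 / 4) * q y := by rw [e2, one_mul]
      _ = _ := by rw [mul_assoc, this]; ring
  exact this

lemma sqrt2pi : (√(2 * Real.pi))⁻¹ = (√Real.pi)⁻¹ / √2 := by
  rw [Real.sqrt_mul (by norm_num)]
  field_simp

lemma h_eq (y : ℝ) : ∑' n : ℕ, Rg (-(n : ℤ)) * (y ^ n / n.factorial) =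
    2 * stdNormalCDF (y / √2) := by
  have hd : ∀ y : ℝ, HasDerivAt (fun y : ℝ => (∑' n : ℕ, Rg (-(n : ℤ)) * (y ^ n / n.factorial)) -
      2 * stdNormalCDF (y / √2)) 0 y := by
    intro y
    have h1 := Gr_Rneg.hasDerivAt y
    rw [q_eq] at h1
    have h2 := ((hasDerivAt_cdf (y / √2)).comp y ((hasDerivAt_id y).div_const (√2))).const_mul 2
    refine (h1.sub h2).congr_deriv (Eq.symm ?_)
    rw [sqrt2pi, div_pow, Real.sq_sqrt (by norm_num)]
    have : √2 * √2 = (2:ℝ) := Real.mul_self_sqrt (by norm_num)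
    have e : -(y ^ 2 / 2) / 2 = -(y ^ 2) / 4 := by ring
    rw [e]
    field_simp
    rw [sq, this]; ring
  have := is_const_of_deriv_eq_zero (fun y => (hd y).differentiableAt) (fun y => (hd y).deriv) y 0
  try beta_reduce at this
  rw [egf_zero (fun n : ℕ => Rg (-(n : ℤ))), zero_div, cdf_zero] at this
  simp [Rg_zero] at this
  linarith

lemma summable_pos (w : ℝ) : Summable fun n : ℕ => |w ^ n * Rg (n : ℤ)| := by
  refine Summable.of_nonneg_of_le (fun n => abs_nonneg _) (fun n => ?_)
    ((summable_sqrt (|w| * 2) (by positivity)).mul_left 2)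
  rw [abs_mul, abs_pow, mul_pow]
  calc |w| ^ n * |Rg (n : ℤ)| ≤ |w| ^ n * (2 * (2 ^ n / √(n.factorial))) := by
        gcongr; exact Rg_pos_abs n
    _ = _ := by ring

lemma g_eq (w : ℝ) : ∑' n : ℕ, w ^ n * Rg (n : ℤ) =
    2 * Real.exp (w ^ 2) * stdNormalCDF (√2 * w) := by
  set c : ℕ → ℝ := fun n => n.factorial * Rg (n : ℤ) with hc
  have ec : ∀ (n : ℕ) (y : ℝ), c n * (y ^ n / n.factorial) = y ^ n * Rg (n : ℤ) := by
    intro n y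
    have : (0:ℝ) < n.factorial := by positivity
    simp only [hc]; field_simp
  have ec' : ∀ (n : ℕ) (y : ℝ), c (n + 1) * (y ^ n / n.factorial) = 2 * (y ^ n * Rg ((n : ℤ) - 1)) := by
    intro n y
    have : (0:ℝ) < n.factorial := by positivity
    have e : ((n : ℤ) - 1) = ((n + 1 : ℕ) : ℤ) - 2 := by push_cast; ring
    rw [e, Rg_rec]
    simp only [hc, Nat.factorial_succ]; push_cast; field_simp
  have s1 : ∀ y : ℝ, Summable fun n : ℕ => |y ^ n * Rg ((n : ℤ) - 1)| := by
    intro y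
    rw [← summable_nat_add_iff 1]
    refine ((summable_pos y).mul_left |y|).congr fun n => ?_
    rw [← abs_mul, ← mul_assoc, pow_succ']
    push_cast
    rw [add_sub_cancel_right]
  have hd : ∀ y : ℝ, HasDerivAt (fun y : ℝ => ∑' n : ℕ, y ^ n * Rg (n : ℤ))
      (2 * (√Real.pi)⁻¹ + 2 * y * ∑' n : ℕ, y ^ n * Rg (n : ℤ)) y := by
    intro y
    have h1 := hasDerivAt_egf c (fun R hR => (summable_pos R).congr fun n => by
        rw [← ec, abs_mul, abs_of_nonneg (a := R ^ n / _) (by positivity)])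
      (fun R hR => ((s1 R).mul_left 2).congr fun n => by
        rw [← abs_of_nonneg (a := R ^ n / _) (by positivity), ← abs_mul, ec', abs_mul 2, abs_two]) y
    simp only [ec, ec'] at h1
    rw [tsum_mul_left, (s1 y).of_abs.tsum_eq_zero_add] at h1
    refine (h1).congr_deriv (Eq.symm ?_)
    push_cast
    simp only [add_sub_cancel_right, pow_succ', mul_assoc]
    rw [tsum_mul_left]
    simp [Rg_neg_one]
    ring
  have hz : ∀ y : ℝ, HasDerivAt (fun y : ℝ => Real.exp (-y ^ 2) * (∑' n : ℕ, y ^ n * Rg (n : ℤ)) -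
      2 * stdNormalCDF (√2 * y)) 0 y := by
    intro y
    have h2 := ((hasDerivAt_cdf (√2 * y)).comp y ((hasDerivAt_id y).const_mul (√2))).const_mul 2
    have h3 := (((hasDerivAt_pow 2 y).neg).exp).mul (hd y)
    refine (h3.sub h2).congr_deriv (Eq.symm ?_)
    rw [sqrt2pi, mul_pow, Real.sq_sqrt (by norm_num)]
    have e : -(2 * y ^ 2) / 2 = -y ^ 2 := by ring
    simp only [e, Pi.neg_apply]
    field_simp
    simp
    ring
  have := is_const_of_deriv_eq_zero (fun y => (hz y).differentiableAt) (fun y => (hz y).deriv) w 0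
  try beta_reduce at this
  have g0 : ∑' n : ℕ, (0:ℝ) ^ n * Rg (n : ℤ) = 1 := by
    rw [tsum_eq_single 0]
    · simp [Rg_zero]
    · intro n hn; simp [hn]
  rw [g0, mul_zero, cdf_zero] at this
  norm_num at this
  have e2 : Real.exp (w ^ 2) * Real.exp (-w ^ 2) = 1 := by
    rw [← Real.exp_add]; ring_nf; simp
  calc ∑' n : ℕ, w ^ n * Rg (n : ℤ)
      = Real.exp (w ^ 2) * Real.exp (-w ^ 2) * ∑' n : ℕ, w ^ n * Rg (n : ℤ) := by rw [e2, one_mul]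
    _ = _ := by
      rw [mul_assoc, show Real.exp (-w ^ 2) * ∑' n : ℕ, w ^ n * Rg (n : ℤ) = 2 * stdNormalCDF (√2 * w) by linarith]
      ring

noncomputable def Aw (w : ℝ) (n m : ℕ) : ℝ := w ^ ((m : ℤ) + 1 - n) * Rg ((m : ℤ) + 1 - n)

lemma Aw_succ (w : ℝ) (n m : ℕ) : Aw w (n + 1) (m + 1) = Aw w n m := by
  unfold Aw
  have : (((m + 1 : ℕ) : ℤ) + 1 - (n + 1 : ℕ)) = (m : ℤ) + 1 - n := by push_cast; ring
  rw [this]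

lemma Aw_zero (w : ℝ) (n : ℕ) : Aw w (n + 1) 0 = (w⁻¹) ^ n * Rg (-(n : ℤ)) := by
  unfold Aw
  have : (((0 : ℕ) : ℤ) + 1 - (n + 1 : ℕ)) = -(n : ℤ) := by push_cast; ring
  rw [this, zpow_neg, zpow_natCast, inv_pow]

lemma Aw_zero_left (w : ℝ) (m : ℕ) : Aw w 0 m = w ^ (m + 1) * Rg ((m + 1 : ℕ) : ℤ) := by
  unfold Aw
  have : ((m : ℤ) + 1 - (0 : ℕ)) = (m + 1 : ℕ) := by push_cast; ring
  rw [this, zpow_natCast]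

lemma Aw_summable (w : ℝ) (n : ℕ) : Summable fun m => |Aw w n m| := by
  induction n with
  | zero =>
    simp only [Aw_zero_left]
    exact (summable_nat_add_iff 1).2 (summable_pos w)
  | succ n ih =>
    rw [← summable_nat_add_iff 1]
    simpa only [Aw_succ] using ih

lemma Gr_abs (w : ℝ) : Gr fun n => ∑' m, |Aw w n m| := by
  set D := max 1 |w⁻¹| with hD
  have hD1 : 1 ≤ D := le_max_left _ _
  set C := max 1 (∑' m, |Aw w 0 m|) with hC
  have hC1 : 1 ≤ C := le_max_left _ _
  refine ⟨C, 2 * D, by linarith, by linarith, fun n => ?_⟩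
  rw [abs_of_nonneg (tsum_nonneg fun _ => abs_nonneg _)]
  induction n with
  | zero =>
    have := le_max_right 1 (∑' m, |Aw w 0 m|)
    rw [← hC] at this
    simpa using this
  | succ n ih =>
    beta_reduce at ih ⊢
    rw [(Aw_summable w (n + 1)).tsum_eq_zero_add]
    simp only [Aw_succ, Aw_zero]
    have h1 : |(w⁻¹) ^ n * Rg (-(n : ℤ))| ≤ C * (2 * D) ^ n * √(n.factorial) := by
      rw [abs_mul, abs_pow]
      have : |w⁻¹| ^ n ≤ C * (2 * D) ^ n := by
        calc |w⁻¹| ^ n ≤ D ^ n := by gcongr; exact le_max_right _ _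
          _ ≤ (2 * D) ^ n := by gcongr; linarith
          _ ≤ _ := le_mul_of_one_le_left (by positivity) hC1
      gcongr
      exact Rg_neg_abs n
    have h2 : √(n.factorial : ℝ) ≤ √((n + 1).factorial : ℝ) := by
      apply Real.sqrt_le_sqrt
      exact_mod_cast Nat.factorial_le (Nat.le_succ n)
    calc _ ≤ C * (2 * D) ^ n * √(n.factorial) + C * (2 * D) ^ n * √(n.factorial) := add_le_add h1 ih
      _ = C * (2 * (2 * D) ^ n) * √(n.factorial) := by ring
      _ ≤ C * (2 * (2 * D) ^ n) * √((n + 1).factorial) := by gcongr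
      _ ≤ C * ((2 * D) ^ (n + 1)) * √((n + 1).factorial) := by
        gcongr
        rw [pow_succ']
        gcongr
        linarith

lemma Gr_c (w : ℝ) : Gr fun n => ∑' m, Aw w n m := by
  obtain ⟨C, E, hC, hE, h⟩ := Gr_abs w
  refine ⟨C, E, hC, hE, fun n => le_trans ?_ (h n)⟩
  rw [abs_of_nonneg (a := ∑' m, |Aw w n m|) (tsum_nonneg fun _ => abs_nonneg _)]
  exact norm_tsum_le_tsum_norm (f := Aw w n) (Aw_summable w n)

lemma F_eq (w : ℝ) (hw : 0 < w) (v : ℝ) :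
    ∑' n, (∑' m, Aw w n m) * (v ^ n / n.factorial) =
    2 * (Real.exp (w ^ 2 + v) * stdNormalCDF ((2 * w ^ 2 + v) / (√2 * w)) -
      stdNormalCDF (v / (√2 * w))) := by
  set F : ℝ → ℝ := fun v => ∑' n, (∑' m, Aw w n m) * (v ^ n / n.factorial) with hF
  set T : ℝ → ℝ := fun v => 2 * (Real.exp (w ^ 2 + v) * stdNormalCDF ((2 * w ^ 2 + v) / (√2 * w)) -
      stdNormalCDF (v / (√2 * w))) with hT
  have dF : ∀ v, HasDerivAt F (F v + 2 * stdNormalCDF (v / (√2 * w))) v := by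
    intro v
    have h1 := (Gr_c w).hasDerivAt v
    refine (h1).congr_deriv (Eq.symm ?_)
    have e : ∀ n, ∑' m, Aw w (n + 1) m = Rg (-(n : ℤ)) * (w⁻¹) ^ n + ∑' m, Aw w n m := by
      intro n
      rw [(Aw_summable w (n + 1)).of_abs.tsum_eq_zero_add]
      simp only [Aw_succ, Aw_zero]; ring
    have hh := h_eq (v / w)
    have e3 : v / w / √2 = v / (√2 * w) := by field_simp
    rw [e3] at hh
    rw [← hh, add_comm, hF]
    try beta_reduce
    rw [← (Gr_Rneg.summable' (v / w)).tsum_add ((Gr_c w).summable' v)]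
    refine tsum_congr fun n => ?_
    rw [e, div_pow, inv_pow]
    ring
  have dT : ∀ v, HasDerivAt T (T v + 2 * stdNormalCDF (v / (√2 * w))) v := by
    intro v
    have h1 := (hasDerivAt_cdf ((2 * w ^ 2 + v) / (√2 * w))).comp v
      (((hasDerivAt_id v).const_add (2 * w ^ 2)).div_const (√2 * w))
    have h2 := (hasDerivAt_cdf (v / (√2 * w))).comp v ((hasDerivAt_id v).div_const (√2 * w))
    have h3 := ((hasDerivAt_id v).const_add (w ^ 2)).exp
    have h4 := ((h3.mul h1).sub h2).const_mul 2
    refine (h4).congr_deriv (Eq.symm ?_)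
    have e : Real.exp (w ^ 2 + v) * Real.exp (-((2 * w ^ 2 + v) / (√2 * w)) ^ 2 / 2) =
        Real.exp (-(v / (√2 * w)) ^ 2 / 2) := by
      rw [← Real.exp_add]; congr 1
      rw [div_pow, div_pow, mul_pow, Real.sq_sqrt (by norm_num)]
      field_simp
      ring
    simp only [id, Function.comp, hT]
    linear_combination (-2 * (√(2 * Real.pi))⁻¹ * (1 / (√2 * w))) * e
  have hz : ∀ v, HasDerivAt (fun v => Real.exp (-v) * (F v - T v)) 0 v := by
    intro v
    have := ((hasDerivAt_id v).neg.exp).mul ((dF v).sub (dT v))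
    refine (this).congr_deriv (Eq.symm ?_)
    simp
  have := is_const_of_deriv_eq_zero (fun y => (hz y).differentiableAt) (fun y => (hz y).deriv) v 0
  try beta_reduce at this
  have F0 : F 0 = T 0 := by
    rw [hF, hT]; try beta_reduce
    rw [egf_zero]
    simp only [Aw_zero_left]
    have hg := g_eq w
    rw [(summable_pos w).of_abs.tsum_eq_zero_add] at hg
    simp only [pow_zero, Nat.cast_zero, Rg_zero] at hg
    have e : (2 * w ^ 2 + 0) / (√2 * w) = √2 * w := by
      have : √2 * √2 = (2:ℝ) := Real.mul_self_sqrt (by norm_num)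
      field_simp
      nlinarith
    rw [e, zero_div, cdf_zero, add_zero]
    linarith
  rw [F0, sub_self, mul_zero] at this
  have h5 : F v - T v = 0 := (mul_eq_zero.1 this).resolve_left (Real.exp_ne_zero _)
  linarith

lemma double_eq (w : ℝ) (hw : 0 < w) (v : ℝ) :
    ∑' p : ℕ × ℕ, Aw w p.1 p.2 * (v ^ p.1 / p.1.factorial) =
    2 * (Real.exp (w ^ 2 + v) * stdNormalCDF ((2 * w ^ 2 + v) / (√2 * w)) -
      stdNormalCDF (v / (√2 * w))) := by
  rw [← F_eq w hw v]
  have hs : Summable fun p : ℕ × ℕ => |Aw w p.1 p.2 * (v ^ p.1 / p.1.factorial)| := by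
    rw [summable_prod_of_nonneg (fun p => abs_nonneg _)]
    constructor
    · intro n
      simp only [abs_mul]
      exact (Aw_summable w n).mul_right _
    · simp only [abs_mul, tsum_mul_right]
      refine ((Gr_abs w).summable' |v|).congr fun n => ?_
      simp [abs_div]
  rw [hs.of_abs.tsum_prod]
  refine tsum_congr fun n => ?_
  exact tsum_mul_right (f := fun m => Aw w n m) (a := v ^ n / n.factorial)


lemma term_eq (z v : ℝ) (hz : 0 < z) (n m : ℕ) :
    ((-1 : ℂ) ^ n / ((n.factorial : ℂ) * Complex.Gamma (1 - ((n : ℂ) - ((m : ℂ) + 1)) / 2))) *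
      ((-v : ℝ) : ℂ) ^ n * ((z : ℝ) : ℂ) ^ ((((m : ℂ) + 1) - (n : ℂ)) / 2) =
    ((Aw (√z) n m * (v ^ n / n.factorial) : ℝ) : ℂ) := by
  have e1 : (1 - ((n : ℂ) - ((m : ℂ) + 1)) / 2) =
      ((1 + (((m : ℤ) + 1 - n : ℤ) : ℝ) / 2 : ℝ) : ℂ) := by push_cast; ring
  have e2 : ((((m : ℂ) + 1) - (n : ℂ)) / 2) = (((((m : ℤ) + 1 - n : ℤ) : ℝ) / 2 : ℝ) : ℂ) := by
    push_cast; ring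
  have e3 : z ^ ((((m : ℤ) + 1 - n : ℤ) : ℝ) / 2) = (√z) ^ ((m : ℤ) + 1 - n) := by
    rw [Real.sqrt_eq_rpow, ← Real.rpow_intCast, ← Real.rpow_mul hz.le]
    congr 1; ring
  rw [e1, e2, Complex.Gamma_ofReal, ← Complex.ofReal_cpow hz.le, e3]
  have e4 : (v : ℂ) ^ n = (-1) ^ n * ((-v : ℝ) : ℂ) ^ n := by
    rw [← mul_pow]; push_cast; ring
  unfold Aw Rg
  rw [Complex.ofReal_mul, Complex.ofReal_mul, Complex.ofReal_div, Complex.ofReal_pow v, e4,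
    Complex.ofReal_inv, Complex.ofReal_natCast]
  rw [div_eq_mul_inv, mul_inv]
  ring

/-- For `α = 2` (where `μ = -σ²/2`) the double-series pricing formula
recovers the Black–Scholes call price:
`(K e^(-rτ)/2) ∑_{n≥0,m≥1} ((-1)ⁿ/(n! Γ(1-(n-m)/2))) (σ²τ/2 - [log])ⁿ (σ²τ/2)^((m-n)/2)
 = S Φ([log]/(σ√τ) + σ√τ/2) - K e^(-rτ) Φ([log]/(σ√τ) - σ√τ/2)`. -/
theorem stmt_9 (S K r σ τ : ℝ) (hS : 0 < S) (hK : 0 < K) (hσ : 0 < σ) (hτ : 0 < τ)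
    (llog : ℝ) (hlog : llog = Real.log (S / K) + r * τ)
    (h : llog < σ ^ 2 * τ / 2) :
    ((K * Real.exp (-(r * τ)) / 2 : ℝ) : ℂ) *
        ∑' p : ℕ × ℕ,
          ((-1 : ℂ) ^ p.1 /
              ((p.1.factorial : ℂ) *
                Complex.Gamma (1 - ((p.1 : ℂ) - ((p.2 : ℂ) + 1)) / 2))) *
            ((σ ^ 2 * τ / 2 - llog : ℝ) : ℂ) ^ p.1 *
            ((σ ^ 2 * τ / 2 : ℝ) : ℂ) ^ ((((p.2 : ℂ) + 1) - (p.1 : ℂ)) / 2) =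
      ((S * stdNormalCDF (llog / (σ * Real.sqrt τ) + σ * Real.sqrt τ / 2) -
          K * Real.exp (-(r * τ)) *
            stdNormalCDF (llog / (σ * Real.sqrt τ) - σ * Real.sqrt τ / 2) : ℝ) : ℂ) := by
  set z := σ ^ 2 * τ / 2 with hzdef
  have hz : 0 < z := by positivity
  have hsum := double_eq (√z) (Real.sqrt_pos.2 hz) (llog - z)
  have e0 : z - llog = -(llog - z) := by ring
  have hterm : ∀ p : ℕ × ℕ, _ := fun p => term_eq z (llog - z) hz p.1 p.2
  rw [e0, tsum_congr hterm, ← Complex.ofReal_tsum, hsum, ← Complex.ofReal_mul]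
  congr 1
  have hd : 0 < σ * √τ := by positivity
  have hτ2 : √τ ^ 2 = τ := Real.sq_sqrt hτ.le
  have e1 : √2 * √z = σ * √τ := by
    rw [← Real.sqrt_mul (by norm_num), show 2 * z = σ ^ 2 * τ by rw [hzdef]; ring,
      Real.sqrt_mul (by positivity), Real.sqrt_sq hσ.le]
  have e2 : (2 * z + (llog - z)) / (σ * √τ) = llog / (σ * √τ) + σ * √τ / 2 := by
    have : z = (σ * √τ) ^ 2 / 2 := by rw [mul_pow, hτ2]
    rw [this]; field_simp; ring
  have e3 : (llog - z) / (σ * √τ) = llog / (σ * √τ) - σ * √τ / 2 := by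
    have : z = (σ * √τ) ^ 2 / 2 := by rw [mul_pow, hτ2]
    rw [this]; field_simp
  have e4 : K * Real.exp (-(r * τ)) * Real.exp llog = S := by
    rw [mul_assoc, ← Real.exp_add, hlog, show -(r * τ) + (Real.log (S / K) + r * τ) = Real.log (S / K) by ring,
      Real.exp_log (by positivity)]
    field_simp
  rw [Real.sq_sqrt hz.le, e1, e2, e3, add_sub_cancel]
  linear_combination (stdNormalCDF (llog / (σ * √τ) + σ * √τ / 2)) * e4
end
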